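/- The arrangement B of 27 hyperplanes in 𝔽₁₁³ listed in the paper is recursively free (and free), even though its intersection lattice is isomorphic to that of the complex arrangement A which is not recursively free; hence recursive freeness is not a combinatorial property of the intersection lattice. -/

import Mathlib

open Module Matrix
open scoped Classical

namespace Arrgt

variable {K : Type*} [Field K]

/-- A (central) hyperplane arrangement in `K^n`: a finite set of kernels of
nonzero linear forms. -/
structure Arrangement (K : Type*) [Field K] (n : ℕ) where
  hyperplanes : Finset (Submodule K (Fin n → K))
  isHyp : ∀ H ∈ hyperplanes, ∃ f : (Fin n → K) →ₗ[K] K, f ≠ 0 ∧ H = LinearMap.ker f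

/-- The deletion `A \ {H}`. -/
noncomputable def Arrangement.delete {n : ℕ} (A : Arrangement K n) (H : Submodule K (Fin n → K)) :
    Arrangement K n :=
  ⟨A.hyperplanes.erase H, fun H' hH' => A.isHyp H' (Finset.mem_of_mem_erase hH')⟩

/-- The empty arrangement of rank `n`. -/
def emptyArr (K : Type*) [Field K] (n : ℕ) : Arrangement K n := ⟨∅, by simp⟩

/-- The linear polynomial in `K[x_1,...,x_n]` attached to a linear form. -/
noncomputable def linPoly {n : ℕ} (f : (Fin n → K) →ₗ[K] K) : MvPolynomial (Fin n) K :=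
  ∑ i, MvPolynomial.C (f (Pi.single i 1)) * MvPolynomial.X i

/-- `Q` is a defining polynomial of the arrangement `A`: a product of linear forms
whose kernels are exactly the hyperplanes of `A`. -/
def IsDefiningPoly {n : ℕ} (A : Arrangement K n) (Q : MvPolynomial (Fin n) K) : Prop :=
  ∃ α : Submodule K (Fin n → K) → ((Fin n → K) →ₗ[K] K),
    (∀ H ∈ A.hyperplanes, α H ≠ 0 ∧ LinearMap.ker (α H) = H) ∧
    Q = ∏ H ∈ A.hyperplanes, linPoly (α H)

/-- Evaluation of a derivation at the polynomial `Q`, as a linear map. -/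
noncomputable def evalDer {n : ℕ} (Q : MvPolynomial (Fin n) K) :
    Derivation K (MvPolynomial (Fin n) K) (MvPolynomial (Fin n) K) →ₗ[MvPolynomial (Fin n) K]
      MvPolynomial (Fin n) K where
  toFun θ := θ Q
  map_add' _ _ := rfl
  map_smul' _ _ := rfl

/-- The module `D(A) = {θ : θ(Q) ∈ Q·S}` of `A`-derivations (for a chosen defining
polynomial `Q`). -/
noncomputable def DerModule {n : ℕ} (Q : MvPolynomial (Fin n) K) :
    Submodule (MvPolynomial (Fin n) K)
      (Derivation K (MvPolynomial (Fin n) K) (MvPolynomial (Fin n) K)) :=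
  Submodule.comap (evalDer Q) (Ideal.span {Q})

/-- `A` is a free arrangement: `D(A)` is a free module over `S = K[x_1,...,x_n]`. -/
def IsFree {n : ℕ} (A : Arrangement K n) : Prop :=
  ∃ Q, IsDefiningPoly A Q ∧ Module.Free (MvPolynomial (Fin n) K) (DerModule Q)

/-- A nonzero derivation is homogeneous of polynomial degree `p` if all its
coefficients are homogeneous of degree `p`. -/
def IsHomogeneousDer {n : ℕ}
    (θ : Derivation K (MvPolynomial (Fin n) K) (MvPolynomial (Fin n) K)) (p : ℕ) : Prop :=
  θ ≠ 0 ∧ ∀ i, (θ (MvPolynomial.X i)).IsHomogeneous p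

/-- `A` is free with exponents the multiset `e`: `D(A)` has a homogeneous basis whose
polynomial degrees form the multiset `e`. -/
def HasExponents {n : ℕ} (A : Arrangement K n) (e : Multiset ℕ) : Prop :=
  ∃ Q, IsDefiningPoly A Q ∧
    ∃ (l : List ℕ) (b : Basis (Fin l.length) (MvPolynomial (Fin n) K) (DerModule Q)),
      (l : Multiset ℕ) = e ∧ ∀ i : Fin l.length, IsHomogeneousDer ((b i : DerModule Q) :
        Derivation K (MvPolynomial (Fin n) K) (MvPolynomial (Fin n) K)) (l.get i)

/-- `B` is (a model, via a linear identification `H ≅ K^n`, of) the restriction `A^H`. -/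
def IsRestriction {n : ℕ} (A : Arrangement K (n + 1)) (H : Submodule K (Fin (n + 1) → K))
    (B : Arrangement K n) : Prop :=
  ∃ e : H ≃ₗ[K] (Fin n → K),
    B.hyperplanes = (A.hyperplanes.erase H).image
      (fun H' => Submodule.map (e : H →ₗ[K] (Fin n → K)) (H'.comap H.subtype))

variable (K) in
/-- The class of inductively free arrangements. -/
inductive InductivelyFree : {n : ℕ} → Arrangement K n → Prop
  | empty (n : ℕ) : InductivelyFree (emptyArr K n)
  | add {n : ℕ} (A : Arrangement K (n + 1)) (H : Submodule K (Fin (n + 1) → K))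
      (hH : H ∈ A.hyperplanes) (B : Arrangement K n) (hB : IsRestriction A H B)
      (e' e'' : Multiset ℕ)
      (h1 : InductivelyFree (A.delete H)) (h2 : InductivelyFree B)
      (h3 : HasExponents (A.delete H) e') (h4 : HasExponents B e'')
      (h5 : e'' ≤ e') : InductivelyFree A

variable (K) in
/-- The class of recursively free arrangements. -/
inductive RecursivelyFree : {n : ℕ} → Arrangement K n → Prop
  | empty (n : ℕ) : RecursivelyFree (emptyArr K n)
  | add {n : ℕ} (A : Arrangement K (n + 1)) (H : Submodule K (Fin (n + 1) → K))
      (hH : H ∈ A.hyperplanes) (B : Arrangement K n) (hB : IsRestriction A H B)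
      (e' e'' : Multiset ℕ)
      (h1 : RecursivelyFree (A.delete H)) (h2 : RecursivelyFree B)
      (h3 : HasExponents (A.delete H) e') (h4 : HasExponents B e'')
      (h5 : e'' ≤ e') : RecursivelyFree A
  | del {n : ℕ} (A : Arrangement K (n + 1)) (H : Submodule K (Fin (n + 1) → K))
      (hH : H ∈ A.hyperplanes) (B : Arrangement K n) (hB : IsRestriction A H B)
      (e e'' : Multiset ℕ)
      (h1 : RecursivelyFree A) (h2 : RecursivelyFree B)
      (h3 : HasExponents A e) (h4 : HasExponents B e'')
      (h5 : e'' ≤ e) : RecursivelyFree (A.delete H)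

/-- The intersection lattice of a set of hyperplanes: all intersections of finite
subsets (including the ambient space `⊤` as the empty intersection). -/
def setLattice {n : ℕ} (𝓐 : Set (Submodule K (Fin n → K))) : Set (Submodule K (Fin n → K)) :=
  {X | ∃ s : Finset (Submodule K (Fin n → K)), ↑s ⊆ 𝓐 ∧ X = s.inf id}

/-- The intersection lattice of an arrangement. -/
def Arrangement.lattice {n : ℕ} (A : Arrangement K n) : Set (Submodule K (Fin n → K)) :=
  setLattice (↑A.hyperplanes)

/-- The linear form `x ↦ ∑ v i * x i` attached to a normal vector `v`. -/
noncomputable def lf {n : ℕ} (v : Fin n → K) : (Fin n → K) →ₗ[K] K :=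
  ∑ i, v i • LinearMap.proj i

lemma lf_single {n : ℕ} (v : Fin n → K) (j : Fin n) : lf v (Pi.single j 1) = v j := by
  simp [lf, Pi.single_apply, mul_ite, Finset.sum_ite_eq']

lemma lf_ne_zero {n : ℕ} {v : Fin n → K} (hv : v ≠ 0) : lf v ≠ 0 := by
  intro h
  apply hv
  funext j
  have := congrArg (fun f : (Fin n → K) →ₗ[K] K => f (Pi.single j 1)) h
  simpa [lf_single] using this

/-- The hyperplane `v^⊥` with normal vector `v`. -/
noncomputable def perp {n : ℕ} (v : Fin n → K) : Submodule K (Fin n → K) :=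
  LinearMap.ker (lf v)

/-- Build an arrangement from a finite set of nonzero normal vectors. -/
noncomputable def mkArr {n : ℕ} (vs : Finset (Fin n → K)) (h : (0 : Fin n → K) ∉ vs) :
    Arrangement K n :=
  ⟨vs.image perp, by
    intro H hH
    obtain ⟨v, hv, rfl⟩ := Finset.mem_image.mp hH
    exact ⟨lf v, lf_ne_zero (fun h0 => h (h0 ▸ hv)), rfl⟩⟩

end Arrgt

open Arrgt

instance : Fact (Nat.Prime 11) := ⟨by norm_num⟩

/-- The normal vectors of the arrangement `B` in `𝔽₁₁³`. -/
def Bvecs : List (Fin 3 → ZMod 11) :=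
  [![0,0,1], ![0,1,1], ![0,1,2], ![0,1,3], ![0,1,4], ![0,1,5], ![0,1,6],
   ![1,0,0], ![1,0,1], ![1,2,2], ![1,3,1], ![1,3,10], ![1,4,3], ![1,4,4],
   ![1,5,7], ![1,6,4], ![1,6,6], ![1,8,5], ![1,8,8], ![1,9,0], ![1,9,1],
   ![1,9,4], ![1,9,5], ![1,9,8], ![1,9,9], ![1,10,0], ![1,10,5]]

namespace Arrgt

section Forms

variable {K : Type*} [Field K] {m n : ℕ}

/-- The value of the derivation with coefficient vector `θ` on the linear form `f`. -/
noncomputable def app {R : Type*} [CommRing R] [Algebra K R] (θ : Fin n → R)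
    (f : (Fin n → K) →ₗ[K] K) : R :=
  ∑ i, f (Pi.single i 1) • θ i

section App

variable {R R' : Type*} [CommRing R] [Algebra K R] [CommRing R'] [Algebra K R']

lemma app_add_left (θ η : Fin n → R) (f : (Fin n → K) →ₗ[K] K) :
    app (θ + η) f = app θ f + app η f := by
  simp [app, Finset.sum_add_distrib]

lemma app_sub_left (θ η : Fin n → R) (f : (Fin n → K) →ₗ[K] K) :
    app (θ - η) f = app θ f - app η f := by
  simp [app, smul_sub, Finset.sum_sub_distrib]

lemma app_smul_left (r : R) (θ : Fin n → R) (f : (Fin n → K) →ₗ[K] K) :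
    app (r • θ) f = r * app θ f := by
  simp [app, Finset.mul_sum]

lemma app_zero_left (f : (Fin n → K) →ₗ[K] K) : app (0 : Fin n → R) f = 0 := by
  simp [app]

lemma app_add (θ : Fin n → R) (f g : (Fin n → K) →ₗ[K] K) :
    app θ (f + g) = app θ f + app θ g := by
  simp [app, add_smul, Finset.sum_add_distrib]

lemma app_smul (θ : Fin n → R) (c : K) (f : (Fin n → K) →ₗ[K] K) :
    app θ (c • f) = c • app θ f := by
  simp [app, mul_smul, Finset.smul_sum]

lemma app_zero (θ : Fin n → R) : app θ (0 : (Fin n → K) →ₗ[K] K) = 0 := by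
  simp [app]

lemma app_proj (θ : Fin n → R) (j : Fin n) :
    app θ (LinearMap.proj j : (Fin n → K) →ₗ[K] K) = θ j := by
  simp [app, Pi.single_apply]

lemma map_app (φ : R →ₐ[K] R') (θ : Fin n → R) (f : (Fin n → K) →ₗ[K] K) :
    φ (app θ f) = app (fun i => φ (θ i)) f := by
  simp [app]

lemma form_apply (f : (Fin n → K) →ₗ[K] K) (x : Fin n → K) :
    f x = ∑ i, x i * f (Pi.single i 1) := by
  conv_lhs => rw [pi_eq_sum_univ' x]
  simp

lemma app_comp (θ : Fin m → R) (f : (Fin n → K) →ₗ[K] K)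
    (L : (Fin m → K) →ₗ[K] (Fin n → K)) :
    app θ (f ∘ₗ L) = app (fun j => app θ (LinearMap.proj j ∘ₗ L)) f := by
  simp only [app, LinearMap.comp_apply, LinearMap.proj_apply, Finset.smul_sum]
  rw [Finset.sum_comm]
  refine Finset.sum_congr rfl fun i _ => ?_
  rw [form_apply f, Finset.sum_smul]
  refine Finset.sum_congr rfl fun j _ => ?_
  rw [smul_smul, mul_comm]

end App

lemma linPoly_eq_app (f : (Fin n → K) →ₗ[K] K) : linPoly f = app MvPolynomial.X f := by
  simp [linPoly, app, MvPolynomial.smul_eq_C_mul]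

lemma linPoly_add (f g : (Fin n → K) →ₗ[K] K) : linPoly (f + g) = linPoly f + linPoly g := by
  simp [linPoly_eq_app, app_add]

lemma linPoly_smul (c : K) (f : (Fin n → K) →ₗ[K] K) : linPoly (c • f) = c • linPoly f := by
  simp [linPoly_eq_app, app_smul]

@[simp] lemma linPoly_zero : linPoly (0 : (Fin n → K) →ₗ[K] K) = 0 := by
  simp [linPoly_eq_app, app_zero]

lemma linPoly_isHomogeneous (f : (Fin n → K) →ₗ[K] K) : (linPoly f).IsHomogeneous 1 :=
  MvPolynomial.IsHomogeneous.sum _ _ _ fun _ _ => MvPolynomial.isHomogeneous_C_mul_X _ _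

lemma coeff_linPoly (f : (Fin n → K) →ₗ[K] K) (i : Fin n) :
    (linPoly f).coeff (Finsupp.single i 1) = f (Pi.single i 1) := by
  simp [linPoly, MvPolynomial.coeff_sum, MvPolynomial.coeff_C_mul, MvPolynomial.coeff_X,
    Finsupp.single_left_inj]

lemma linPoly_injective : Function.Injective (linPoly : ((Fin n → K) →ₗ[K] K) → _) := by
  intro f g h
  refine LinearMap.pi_ext' fun i => LinearMap.ext_ring ?_
  simp [← coeff_linPoly, h]

lemma linPoly_ne_zero {f : (Fin n → K) →ₗ[K] K} (hf : f ≠ 0) : linPoly f ≠ 0 := fun h =>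
  hf (linPoly_injective (by simpa using h))

/-- Pullback of polynomials along a linear map. -/
noncomputable def pull (L : (Fin m → K) →ₗ[K] (Fin n → K)) :
    MvPolynomial (Fin n) K →ₐ[K] MvPolynomial (Fin m) K :=
  MvPolynomial.aeval fun j => linPoly (LinearMap.proj j ∘ₗ L)

lemma pull_linPoly (L : (Fin m → K) →ₗ[K] (Fin n → K)) (f : (Fin n → K) →ₗ[K] K) :
    pull L (linPoly f) = linPoly (f ∘ₗ L) := by
  rw [linPoly_eq_app, map_app, linPoly_eq_app, app_comp]
  simp [pull, linPoly_eq_app]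

lemma pull_isHomogeneous (L : (Fin m → K) →ₗ[K] (Fin n → K)) {p : MvPolynomial (Fin n) K}
    {d : ℕ} (hp : p.IsHomogeneous d) : (pull L p).IsHomogeneous d := by
  have := hp.aeval (fun j => linPoly (LinearMap.proj j ∘ₗ L)) (fun _ => linPoly_isHomogeneous _)
  rwa [one_mul] at this

lemma linPoly_dvd_sub_pull_pull {L : (Fin m → K) →ₗ[K] (Fin n → K)}
    {M : (Fin n → K) →ₗ[K] (Fin m → K)} {f : (Fin n → K) →ₗ[K] K} {v : Fin n → K}
    (h : ∀ x, L (M x) + f x • v = x) (p : MvPolynomial (Fin n) K) :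
    linPoly f ∣ p - pull M (pull L p) := by
  rw [← Ideal.mem_span_singleton, ← Ideal.Quotient.eq]
  have : (Ideal.Quotient.mkₐ K (Ideal.span {linPoly f})) =
      (Ideal.Quotient.mkₐ K (Ideal.span {linPoly f})).comp ((pull M).comp (pull L)) := by
    refine MvPolynomial.algHom_ext fun j => ?_
    simp only [AlgHom.comp_apply, Ideal.Quotient.mkₐ_eq_mk]
    rw [Ideal.Quotient.eq, Ideal.mem_span_singleton]
    have hX : (MvPolynomial.X j : MvPolynomial (Fin n) K) = linPoly (LinearMap.proj j) := by
      rw [linPoly_eq_app, app_proj]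
    rw [hX, pull_linPoly, pull_linPoly]
    have : (LinearMap.proj j : (Fin n → K) →ₗ[K] K) =
        (LinearMap.proj j ∘ₗ L) ∘ₗ M + (v j) • f := by
      ext1 i; refine LinearMap.ext_ring ?_
      have := congrFun (h (Pi.single i 1)) j
      simp only [Pi.add_apply, Pi.smul_apply, smul_eq_mul] at this
      simp [← this, mul_comm]
    nth_rw 1 [this]
    rw [linPoly_add, linPoly_smul, add_sub_cancel_left]
    exact ⟨MvPolynomial.C (v j), by rw [MvPolynomial.smul_eq_C_mul, mul_comm]⟩
  exact congrArg (fun φ => φ p) this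

lemma linPoly_dvd_iff {L : (Fin m → K) →ₗ[K] (Fin n → K)}
    {M : (Fin n → K) →ₗ[K] (Fin m → K)} {f : (Fin n → K) →ₗ[K] K} {v : Fin n → K}
    (h : ∀ x, L (M x) + f x • v = x) (hf : f ∘ₗ L = 0) (p : MvPolynomial (Fin n) K) :
    linPoly f ∣ p ↔ pull L p = 0 := by
  constructor
  · rintro ⟨q, rfl⟩
    rw [map_mul, pull_linPoly, hf, linPoly_zero, zero_mul]
  · intro hp
    simpa [hp] using linPoly_dvd_sub_pull_pull h p

lemma exists_form_eq_one {f : (Fin n → K) →ₗ[K] K} (hf : f ≠ 0) : ∃ v, f v = 1 := by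
  obtain ⟨x, hx⟩ : ∃ x, f x ≠ 0 := by
    by_contra! h
    exact hf (LinearMap.ext h)
  exact ⟨(f x)⁻¹ • x, by simp [hx]⟩

lemma exists_projection {f : (Fin n → K) →ₗ[K] K} (hf : f ≠ 0) :
    ∃ (L : (Fin n → K) →ₗ[K] (Fin n → K)) (v : Fin n → K),
      (∀ x, L (LinearMap.id (R := K) x) + f x • v = x) ∧ f ∘ₗ L = 0 ∧ f v = 1 := by
  obtain ⟨v, hv⟩ := exists_form_eq_one hf
  refine ⟨LinearMap.id - f.smulRight v, v, fun x => by simp, ?_, hv⟩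
  refine LinearMap.ext fun x => ?_
  simp [hv]

lemma linPoly_prime {f : (Fin n → K) →ₗ[K] K} (hf : f ≠ 0) : Prime (linPoly f) := by
  obtain ⟨L, v, h, h0, -⟩ := exists_projection hf
  refine ⟨linPoly_ne_zero hf, fun hu => ?_, fun a b hab => ?_⟩
  · have := hu.map (pull L)
    rw [pull_linPoly, h0, linPoly_zero] at this
    exact not_isUnit_zero this
  · rw [linPoly_dvd_iff h h0] at hab ⊢
    rw [linPoly_dvd_iff h h0]
    simpa using hab

lemma eq_smul_of_ker_le {f g : (Fin n → K) →ₗ[K] K} (hf : f ≠ 0)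
    (h : LinearMap.ker f ≤ LinearMap.ker g) : ∃ c : K, g = c • f := by
  obtain ⟨v, hv⟩ := exists_form_eq_one hf
  refine ⟨g v, LinearMap.ext fun x => ?_⟩
  have : x - f x • v ∈ LinearMap.ker g := h (by simp [hv])
  rw [LinearMap.mem_ker, map_sub, map_smul, sub_eq_zero] at this
  simpa [mul_comm] using this

lemma linPoly_dvd_linPoly {f g : (Fin n → K) →ₗ[K] K} (hf : f ≠ 0)
    (h : linPoly f ∣ linPoly g) : ∃ c : K, g = c • f := by
  obtain ⟨L, v, hL, h0, -⟩ := exists_projection hf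
  rw [linPoly_dvd_iff hL h0, pull_linPoly] at h
  have h' : g ∘ₗ L = 0 := linPoly_injective (by simpa using h)
  refine ⟨g v, LinearMap.ext fun x => ?_⟩
  conv_lhs => rw [← hL x, map_add]
  have := LinearMap.congr_fun h' x
  simp only [LinearMap.comp_apply, LinearMap.zero_apply] at this
  simp [this, mul_comm]

lemma ker_eq_of_eq_smul {f g : (Fin n → K) →ₗ[K] K} (hg : g ≠ 0) {c : K} (h : g = c • f) :
    LinearMap.ker g = LinearMap.ker f := by
  have hc : c ≠ 0 := by rintro rfl; exact hg (by simp [h])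
  rw [h, LinearMap.ker_smul _ _ hc]

lemma isRelPrime_linPoly {f g : (Fin n → K) →ₗ[K] K} (hf : f ≠ 0) (hg : g ≠ 0)
    (h : LinearMap.ker f ≠ LinearMap.ker g) : IsRelPrime (linPoly f) (linPoly g) := by
  refine ((linPoly_prime hf).irreducible.isRelPrime_iff_not_dvd).2 fun hd => h ?_
  obtain ⟨c, hc⟩ := linPoly_dvd_linPoly hf hd
  exact (ker_eq_of_eq_smul hg hc).symm

end Forms

section LogarithmicDerivations

variable {K : Type*} [Field K] {n : ℕ}

/-- The logarithmic derivations of an arrangement, as coefficient vectors. -/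
def LD (A : Arrangement K n) :
    Submodule (MvPolynomial (Fin n) K) (Fin n → MvPolynomial (Fin n) K) where
  carrier := {θ | ∀ f : (Fin n → K) →ₗ[K] K, f ≠ 0 → LinearMap.ker f ∈ A.hyperplanes →
    linPoly f ∣ app θ f}
  add_mem' ha hb f h0 hf := by
    rw [app_add_left]
    exact dvd_add (ha f h0 hf) (hb f h0 hf)
  zero_mem' f _ _ := by
    rw [app_zero_left]
    exact dvd_zero _
  smul_mem' r θ h f h0 hf := by
    rw [app_smul_left]
    exact (h f h0 hf).mul_left r

lemma LD_mono {A A' : Arrangement K n} (h : A'.hyperplanes ⊆ A.hyperplanes) : LD A ≤ LD A' :=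
  fun _ hθ f h0 hf => hθ f h0 (h hf)

lemma X_mem_LD (A : Arrangement K n) : (MvPolynomial.X : Fin n → MvPolynomial (Fin n) K) ∈ LD A :=
  fun f _ _ => by rw [linPoly_eq_app]

lemma dvd_app_of_dvd {θ : Fin n → MvPolynomial (Fin n) K} {f g : (Fin n → K) →ₗ[K] K} {c : K}
    (hg : g ≠ 0) (h : g = c • f) (hf : linPoly f ∣ app θ f) : linPoly g ∣ app θ g := by
  have hc : c ≠ 0 := by rintro rfl; exact hg (by simp [h])
  rw [h, linPoly_smul, app_smul, MvPolynomial.smul_eq_C_mul, MvPolynomial.smul_eq_C_mul]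
  exact mul_dvd_mul_left _ hf

/-- It suffices to test one form for each hyperplane. -/
lemma mem_LD_of_forall {A : Arrangement K n} {θ : Fin n → MvPolynomial (Fin n) K}
    (h : ∀ H ∈ A.hyperplanes, ∃ f : (Fin n → K) →ₗ[K] K, f ≠ 0 ∧ LinearMap.ker f = H ∧
      linPoly f ∣ app θ f) : θ ∈ LD A := by
  intro g hg hgA
  obtain ⟨f, hf, hk, hd⟩ := h _ hgA
  obtain ⟨c, hc⟩ := eq_smul_of_ker_le hf hk.le
  exact dvd_app_of_dvd hg hc hd

/-- A linear form with the given kernel, when there is one. -/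
noncomputable def formOf (H : Submodule K (Fin n → K)) : (Fin n → K) →ₗ[K] K :=
  if h : ∃ f : (Fin n → K) →ₗ[K] K, f ≠ 0 ∧ H = LinearMap.ker f then h.choose else 0

lemma formOf_spec {A : Arrangement K n} {H : Submodule K (Fin n → K)} (hH : H ∈ A.hyperplanes) :
    formOf H ≠ 0 ∧ LinearMap.ker (formOf H) = H := by
  have h := A.isHyp H hH
  rw [formOf, dif_pos h]
  exact ⟨h.choose_spec.1, h.choose_spec.2.symm⟩

/-- The product of the chosen linear forms of an arrangement. -/
noncomputable def defPoly (A : Arrangement K n) : MvPolynomial (Fin n) K :=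
  ∏ H ∈ A.hyperplanes, linPoly (formOf H)

lemma isDefiningPoly_defPoly (A : Arrangement K n) : IsDefiningPoly A (defPoly A) :=
  ⟨formOf, fun _ hH => formOf_spec hH, rfl⟩

lemma defPoly_ne_zero (A : Arrangement K n) : defPoly A ≠ 0 :=
  Finset.prod_ne_zero_iff.2 fun _ hH => linPoly_ne_zero (formOf_spec hH).1

lemma defPoly_isHomogeneous (A : Arrangement K n) :
    (defPoly A).IsHomogeneous A.hyperplanes.card := by
  have := MvPolynomial.IsHomogeneous.prod A.hyperplanes (fun H => linPoly (formOf H)) (fun _ => 1)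
    fun H _ => linPoly_isHomogeneous _
  simpa [defPoly] using this

lemma linPoly_dvd_defPoly {A : Arrangement K n} {f : (Fin n → K) →ₗ[K] K} (hf : f ≠ 0)
    (hA : LinearMap.ker f ∈ A.hyperplanes) : linPoly f ∣ defPoly A := by
  obtain ⟨c, hc⟩ := eq_smul_of_ker_le hf (formOf_spec hA).2.symm.le
  have hc0 : c ≠ 0 := by rintro rfl; exact (formOf_spec hA).1 (by simp [hc])
  refine dvd_trans ?_ (Finset.dvd_prod_of_mem _ hA)
  rw [hc, linPoly_smul, MvPolynomial.smul_eq_C_mul]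
  exact dvd_mul_left _ _

lemma isRelPrime_forms {A : Arrangement K n}
    {α : Submodule K (Fin n → K) → ((Fin n → K) →ₗ[K] K)}
    (hα : ∀ H ∈ A.hyperplanes, α H ≠ 0 ∧ LinearMap.ker (α H) = H) {H H' : Submodule K (Fin n → K)}
    (hH : H ∈ A.hyperplanes) (hH' : H' ∈ A.hyperplanes) (hne : H ≠ H') :
    IsRelPrime (linPoly (α H)) (linPoly (α H')) :=
  isRelPrime_linPoly (hα H hH).1 (hα H' hH').1 (by rwa [(hα H hH).2, (hα H' hH').2])

lemma defPoly_dvd {A : Arrangement K n} {p : MvPolynomial (Fin n) K}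
    (h : ∀ f : (Fin n → K) →ₗ[K] K, f ≠ 0 → LinearMap.ker f ∈ A.hyperplanes → linPoly f ∣ p) :
    defPoly A ∣ p := by
  refine Finset.prod_dvd_of_isRelPrime ?_ fun H hH => ?_
  · intro H hH H' hH' hne
    exact isRelPrime_forms (A := A) (fun _ h => formOf_spec h) hH hH' hne
  · obtain ⟨h0, hk⟩ := formOf_spec hH
    exact h _ h0 (by rwa [hk])

lemma derivation_linPoly (D : Derivation K (MvPolynomial (Fin n) K) (MvPolynomial (Fin n) K))
    (f : (Fin n → K) →ₗ[K] K) : D (linPoly f) = app (fun i => D (MvPolynomial.X i)) f := by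
  simp [linPoly_eq_app, app]

lemma prod_dvd_derivation_iff {ι R S : Type*} [CommRing R] [CommRing S] [IsDomain S] [Algebra R S]
    [DecompositionMonoid S] (D : Derivation R S S) (s : Finset ι) (p : ι → S)
    (h : ∀ i ∈ s, ∀ j ∈ s, i ≠ j → IsRelPrime (p i) (p j)) (h0 : ∀ i ∈ s, p i ≠ 0) :
    ∏ i ∈ s, p i ∣ D (∏ i ∈ s, p i) ↔ ∀ i ∈ s, p i ∣ D (p i) := by
  induction s using Finset.induction_on with
  | empty => simp
  | insert a s ha ih =>
    have hrel : IsRelPrime (p a) (∏ i ∈ s, p i) := IsRelPrime.prod_right fun i hi =>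
      h a (Finset.mem_insert_self _ _) i (Finset.mem_insert_of_mem hi)
        (fun e => ha (e ▸ hi))
    rw [Finset.forall_mem_insert, Finset.prod_insert ha,
      ← ih (fun i hi j hj => h i (Finset.mem_insert_of_mem hi) j (Finset.mem_insert_of_mem hj))
        (fun i hi => h0 i (Finset.mem_insert_of_mem hi)), Derivation.leibniz, smul_eq_mul,
      smul_eq_mul]
    constructor
    · intro hd
      constructor
      · have := (dvd_add_right (dvd_mul_right (p a) _)).1 ((dvd_mul_right _ _).trans hd)
        exact hrel.dvd_of_dvd_mul_left this
      · have := (dvd_add_left (dvd_mul_right (∏ i ∈ s, p i) _)).1 ((dvd_mul_left _ _).trans hd)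
        exact hrel.symm.dvd_of_dvd_mul_left this
    · rintro ⟨⟨u, hu⟩, ⟨v, hv⟩⟩
      exact ⟨u + v, by rw [hu, hv]; ring⟩

variable (K n) in
/-- Derivations of the polynomial ring correspond to coefficient vectors. -/
noncomputable def derEquiv :
    Derivation K (MvPolynomial (Fin n) K) (MvPolynomial (Fin n) K) ≃ₗ[MvPolynomial (Fin n) K]
      (Fin n → MvPolynomial (Fin n) K) where
  toFun D i := D (MvPolynomial.X i)
  map_add' _ _ := rfl
  map_smul' _ _ := rfl
  invFun v := MvPolynomial.mkDerivation K v
  left_inv D := MvPolynomial.derivation_ext fun i => by rw [MvPolynomial.mkDerivation_X]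
  right_inv v := funext fun i => MvPolynomial.mkDerivation_X K v i

lemma mem_DerModule_iff {A : Arrangement K n} {Q : MvPolynomial (Fin n) K}
    (hQ : IsDefiningPoly A Q)
    (D : Derivation K (MvPolynomial (Fin n) K) (MvPolynomial (Fin n) K)) :
    D ∈ DerModule Q ↔ derEquiv K n D ∈ LD A := by
  obtain ⟨α, hα, rfl⟩ := hQ
  have : D ∈ DerModule (∏ H ∈ A.hyperplanes, linPoly (α H)) ↔
      ∏ H ∈ A.hyperplanes, linPoly (α H) ∣ D (∏ H ∈ A.hyperplanes, linPoly (α H)) :=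
    Ideal.mem_span_singleton
  rw [this, prod_dvd_derivation_iff]
  · constructor
    · intro h
      refine mem_LD_of_forall fun H hH => ⟨α H, (hα H hH).1, (hα H hH).2, ?_⟩
      have := h H hH
      rwa [derivation_linPoly] at this
    · intro h H hH
      rw [derivation_linPoly]
      exact h (α H) (hα H hH).1 (by rwa [(hα H hH).2])
  · exact fun H hH H' hH' hne => isRelPrime_forms hα hH hH' hne
  · exact fun H hH => linPoly_ne_zero (hα H hH).1

/-- The module of derivations is isomorphic to the module of coefficient vectors. -/
noncomputable def derModuleEquiv {A : Arrangement K n} {Q : MvPolynomial (Fin n) K}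
    (hQ : IsDefiningPoly A Q) : DerModule Q ≃ₗ[MvPolynomial (Fin n) K] LD A :=
  (derEquiv K n).ofSubmodules _ _ (by
    ext θ
    constructor
    · rintro ⟨D, hD, rfl⟩
      exact (mem_DerModule_iff hQ D).1 hD
    · intro hθ
      exact ⟨(derEquiv K n).symm θ, (mem_DerModule_iff hQ _).2 (by simpa using hθ), by simp⟩)

lemma derModuleEquiv_apply {A : Arrangement K n} {Q : MvPolynomial (Fin n) K}
    (hQ : IsDefiningPoly A Q) (D : DerModule Q) (i : Fin n) :
    (derModuleEquiv hQ D : Fin n → MvPolynomial (Fin n) K) i = D.1 (MvPolynomial.X i) := rfl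

lemma linPoly_dvd_det {f : (Fin n → K) →ₗ[K] K} (hf : f ≠ 0)
    {M : Matrix (Fin n) (Fin n) (MvPolynomial (Fin n) K)} (h : ∀ k, linPoly f ∣ app (M k) f) :
    linPoly f ∣ M.det := by
  obtain ⟨j, hj⟩ : ∃ j, f (Pi.single j 1) ≠ 0 := by
    by_contra! h
    exact hf (LinearMap.pi_ext' fun i => LinearMap.ext_ring (by simpa using h i))
  choose q hq using h
  have h1 : M *ᵥ (fun i => MvPolynomial.C (f (Pi.single i 1))) = linPoly f • q := by
    ext1 k
    rw [Pi.smul_apply, smul_eq_mul, ← hq, app, Matrix.mulVec, dotProduct]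
    simp [MvPolynomial.smul_eq_C_mul, mul_comm]
  have h2 := congrFun (congrArg (M.adjugate *ᵥ ·) h1) j
  simp only [Matrix.mulVec_mulVec, Matrix.adjugate_mul, Matrix.mulVec_smul, Matrix.smul_mulVec,
    Matrix.one_mulVec, Pi.smul_apply, smul_eq_mul] at h2
  have hu : IsUnit (MvPolynomial.C (σ := Fin n) (f (Pi.single j 1))) :=
    (isUnit_iff_ne_zero.2 hj).map MvPolynomial.C
  rw [← hu.dvd_mul_right, h2]
  exact dvd_mul_right _ _

lemma defPoly_dvd_det {A : Arrangement K n} {M : Matrix (Fin n) (Fin n) (MvPolynomial (Fin n) K)}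
    (h : ∀ k, M k ∈ LD A) : defPoly A ∣ M.det :=
  defPoly_dvd fun f h0 hf => linPoly_dvd_det h0 fun k => h k f h0 hf

lemma isHomogeneous_det {M : Matrix (Fin n) (Fin n) (MvPolynomial (Fin n) K)} {d : Fin n → ℕ}
    (h : ∀ k i, (M k i).IsHomogeneous (d k)) : M.det.IsHomogeneous (∑ k, d k) := by
  rw [Matrix.det_apply]
  refine MvPolynomial.IsHomogeneous.sum _ _ _ fun σ _ => ?_
  have : (∏ i, M (σ i) i).IsHomogeneous (∑ k, d k) := by
    rw [← Equiv.sum_comp σ]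
    exact MvPolynomial.IsHomogeneous.prod _ _ _ fun i _ => h _ _
  rcases Int.units_eq_one_or (Equiv.Perm.sign σ) with hs | hs <;> rw [hs]
  · simpa using this
  · simpa using this.neg

lemma card_le_of_det_ne_zero {A : Arrangement K n}
    {M : Matrix (Fin n) (Fin n) (MvPolynomial (Fin n) K)} {d : Fin n → ℕ}
    (h : ∀ k, M k ∈ LD A) (hd : ∀ k i, (M k i).IsHomogeneous (d k)) (h0 : M.det ≠ 0) :
    A.hyperplanes.card ≤ ∑ k, d k := by
  obtain ⟨q, hq⟩ := defPoly_dvd_det h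
  have h1 := (isHomogeneous_det hd).totalDegree h0
  rw [hq] at h0
  rw [hq, MvPolynomial.totalDegree_mul_of_isDomain (left_ne_zero_of_mul h0)
    (right_ne_zero_of_mul h0), (defPoly_isHomogeneous A).totalDegree (defPoly_ne_zero A)] at h1
  omega

/-- Saito's criterion data: homogeneous logarithmic derivations of degrees `d` whose coefficient
determinant is nonzero of degree the number of hyperplanes. -/
def Saito (A : Arrangement K n) (d : Fin n → ℕ) : Prop :=
  ∃ M : Matrix (Fin n) (Fin n) (MvPolynomial (Fin n) K), (∀ k, M k ∈ LD A) ∧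
    (∀ k i, (M k i).IsHomogeneous (d k)) ∧ M.det ≠ 0 ∧ ∑ k, d k = A.hyperplanes.card

lemma exists_basis_of_saito {A : Arrangement K n}
    {M : Matrix (Fin n) (Fin n) (MvPolynomial (Fin n) K)} {d : Fin n → ℕ}
    (h : ∀ k, M k ∈ LD A) (hd : ∀ k i, (M k i).IsHomogeneous (d k)) (h0 : M.det ≠ 0)
    (hs : ∑ k, d k = A.hyperplanes.card) :
    ∃ b : Basis (Fin n) (MvPolynomial (Fin n) K) (LD A),
      ∀ k, (b k : Fin n → MvPolynomial (Fin n) K) = M k := by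
  obtain ⟨q, hq⟩ := defPoly_dvd_det h
  have hq0 : q ≠ 0 := by rintro rfl; simp [hq] at h0
  have h1 := (isHomogeneous_det hd).totalDegree h0
  rw [hq, MvPolynomial.totalDegree_mul_of_isDomain (defPoly_ne_zero A) hq0,
    (defPoly_isHomogeneous A).totalDegree (defPoly_ne_zero A), hs] at h1
  have hqd : q.totalDegree = 0 := by omega
  rw [MvPolynomial.totalDegree_eq_zero_iff_eq_C] at hqd
  have hqu : IsUnit q := by
    rw [hqd]
    refine (isUnit_iff_ne_zero.2 fun hc => hq0 ?_).map MvPolynomial.C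
    rw [hqd, hc, map_zero]
  have hdvd : ∀ N : Matrix (Fin n) (Fin n) (MvPolynomial (Fin n) K), (∀ k, N k ∈ LD A) →
      M.det ∣ N.det := fun N hN => by
    rw [hq, hqu.mul_right_dvd]
    exact defPoly_dvd_det hN
  have hli : LinearIndependent (MvPolynomial (Fin n) K)
      (fun k => (⟨M k, h k⟩ : LD A)) :=
    LinearIndependent.of_comp (LD A).subtype (Matrix.linearIndependent_rows_of_det_ne_zero h0)
  have hsp : ⊤ ≤ Submodule.span (MvPolynomial (Fin n) K)
      (Set.range fun k => (⟨M k, h k⟩ : LD A)) := by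
    rintro ⟨η, hη⟩ -
    have hc : ∀ k, M.det ∣ (M.updateRow k η).det := fun k => hdvd _ fun j => by
      by_cases hj : j = k
      · subst hj; simpa using hη
      · rw [Matrix.updateRow_ne hj]; exact h j
    choose c hc using hc
    have key : η = ∑ k, c k • M k := by
      have h2 := Matrix.mulVec_cramer Mᵀ η
      have h3 : (Mᵀ.cramer η) = M.det • c := by
        ext1 k
        rw [Matrix.cramer_transpose_apply, hc]; rfl
      rw [h3, Matrix.mulVec_smul, Matrix.det_transpose, Matrix.mulVec_transpose] at h2
      have h4 := smul_right_injective _ h0 h2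
      rw [← h4, Matrix.vecMul_eq_sum]
    have : (⟨η, hη⟩ : LD A) = ∑ k, c k • (⟨M k, h k⟩ : LD A) := by
      apply Subtype.ext
      simpa using key
    rw [this]
    exact Submodule.sum_mem _ fun k _ => Submodule.smul_mem _ _ (Submodule.subset_span ⟨k, rfl⟩)
  exact ⟨Basis.mk hli hsp, fun k => by rw [Basis.mk_apply]⟩

lemma row_ne_zero {R : Type*} [CommRing R] {M : Matrix (Fin n) (Fin n) R} (h0 : M.det ≠ 0)
    (k : Fin n) : M k ≠ 0 := fun h =>
  h0 (Matrix.det_eq_zero_of_row_eq_zero k fun j => congrFun h j)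

lemma Saito.hasExponents {A : Arrangement K n} {d : Fin n → ℕ} (h : Saito A d) :
    HasExponents A (Finset.univ.val.map d) := by
  obtain ⟨M, hM, hd, h0, hs⟩ := h
  obtain ⟨b, hb⟩ := exists_basis_of_saito hM hd h0 hs
  refine ⟨defPoly A, isDefiningPoly_defPoly A, List.ofFn d, (b.map
    (derModuleEquiv (isDefiningPoly_defPoly A)).symm).reindex (finCongr (by simp)), ?_, ?_⟩
  · rw [Fin.univ_val_map]
  · intro i
    have key : ∀ j, ((b.map (derModuleEquiv (isDefiningPoly_defPoly A)).symm).reindex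
        (finCongr (List.length_ofFn (f := d)).symm) i).1 (MvPolynomial.X j) =
          M (i.cast (by simp)) j := by
      intro j
      rw [← derModuleEquiv_apply (isDefiningPoly_defPoly A), ← hb]
      simp
    constructor
    · intro hz
      refine row_ne_zero h0 (i.cast (by simp)) (funext fun j => ?_)
      rw [← key, hz]
      rfl
    · intro j
      rw [key, List.get_ofFn]
      exact hd _ j

lemma Saito.isFree {A : Arrangement K n} {d : Fin n → ℕ} (h : Saito A d) : IsFree A := by
  obtain ⟨Q, hQ, l, b, -, -⟩ := h.hasExponents
  exact ⟨Q, hQ, Module.Free.of_basis b⟩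

end LogarithmicDerivations

section SaitoConverse

variable {K : Type*} [Field K] {n : ℕ}

lemma det_dvd_det_of_basis {A : Arrangement K n}
    (b : Basis (Fin n) (MvPolynomial (Fin n) K) (LD A))
    {N : Matrix (Fin n) (Fin n) (MvPolynomial (Fin n) K)} (hN : ∀ k, N k ∈ LD A) :
    (Matrix.of fun k => (b k : Fin n → MvPolynomial (Fin n) K)).det ∣ N.det := by
  have : N = (Matrix.of fun k j => b.repr ⟨N k, hN k⟩ j) *
      (Matrix.of fun k => (b k : Fin n → MvPolynomial (Fin n) K)) := by
    ext1 k i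
    have h := congrArg (fun x : LD A => (x : Fin n → MvPolynomial (Fin n) K) i)
      (b.sum_repr ⟨N k, hN k⟩)
    simp only [Submodule.coe_sum, Submodule.coe_smul, Finset.sum_apply, Pi.smul_apply,
      smul_eq_mul] at h
    rw [Matrix.mul_apply, ← h]
    rfl
  rw [this, Matrix.det_mul]
  exact dvd_mul_left _ _

lemma smul_mem_LD {A : Arrangement K n} {p : MvPolynomial (Fin n) K} (hp : defPoly A ∣ p)
    (θ : Fin n → MvPolynomial (Fin n) K) : p • θ ∈ LD A := fun f h0 hf => by
  rw [app_smul_left]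
  exact ((linPoly_dvd_defPoly h0 hf).trans hp).mul_right _

lemma not_sq_dvd_det {A : Arrangement K n}
    (b : Basis (Fin n) (MvPolynomial (Fin n) K) (LD A)) {f : (Fin n → K) →ₗ[K] K} (hf : f ≠ 0) :
    ¬ linPoly f * linPoly f ∣
      (Matrix.of fun k => (b k : Fin n → MvPolynomial (Fin n) K)).det := by
  intro hsq
  obtain ⟨v, hv⟩ := exists_form_eq_one hf
  set H := LinearMap.ker f with hH
  set Q' := defPoly (A.delete H) with hQ'
  have hQ : ∀ g : (Fin n → K) →ₗ[K] K, g ≠ 0 → LinearMap.ker g ∈ A.hyperplanes →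
      LinearMap.ker g ≠ H → linPoly g ∣ Q' := fun g hg hgA hne =>
    linPoly_dvd_defPoly hg (Finset.mem_erase.2 ⟨hne, hgA⟩)
  have hfQ : ¬ linPoly f ∣ Q' := by
    intro hd
    obtain ⟨H', hH', hd'⟩ := (linPoly_prime hf).exists_mem_finset_dvd hd
    obtain ⟨c, hc⟩ := linPoly_dvd_linPoly hf hd'
    have hs := formOf_spec hH'
    exact (Finset.mem_erase.1 hH').1 (by rw [← hs.2, hH]; exact ker_eq_of_eq_smul hs.1 hc)
  let u : Fin n → MvPolynomial (Fin n) K := fun i =>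
    MvPolynomial.C (f (Pi.single i 1)) * (linPoly f - 1)
  let w : Fin n → MvPolynomial (Fin n) K := fun i => MvPolynomial.C (v i)
  have hsum : ∑ i, MvPolynomial.C (v i) * MvPolynomial.C (σ := Fin n) (f (Pi.single i 1)) = 1 := by
    rw [form_apply] at hv
    simp only [← MvPolynomial.C_mul, ← map_sum, hv, map_one]
  have hwf : app w f = 1 := by
    rw [← hsum, app]
    exact Finset.sum_congr rfl fun i _ => by rw [MvPolynomial.smul_eq_C_mul, mul_comm]
  set N : Matrix (Fin n) (Fin n) (MvPolynomial (Fin n) K) :=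
    Q' • (1 + Matrix.replicateCol Unit u * Matrix.replicateRow Unit w) with hN
  have hrow : ∀ k, N k = Q' • (Pi.single k 1 + u k • w) := by
    intro k
    ext1 i
    simp [hN, Matrix.one_apply, Matrix.mul_apply, Pi.single_apply, eq_comm, mul_add]
  have hNmem : ∀ k, N k ∈ LD A := by
    intro k g hg hgA
    rw [hrow, app_smul_left]
    by_cases hne : LinearMap.ker g = H
    · obtain ⟨c, hc⟩ := eq_smul_of_ker_le hf (hne ▸ le_rfl : H ≤ LinearMap.ker g)
      rw [← app_smul_left]
      refine dvd_app_of_dvd hg hc ?_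
      rw [app_smul_left, app_add_left, app_smul_left, hwf]
      have : app (Pi.single k 1 : Fin n → MvPolynomial (Fin n) K) f =
          MvPolynomial.C (f (Pi.single k 1)) := by
        simp [app, Pi.single_apply, MvPolynomial.smul_eq_C_mul]
      rw [this]
      refine Dvd.dvd.mul_left ⟨MvPolynomial.C (f (Pi.single k 1)), ?_⟩ _
      simp only [u]
      ring
    · exact (hQ g hg hgA hne).mul_right _
  have hdet : N.det = Q' ^ n * linPoly f := by
    rw [hN, Matrix.det_smul, Matrix.det_one_add_replicateCol_mul_replicateRow, Fintype.card_fin]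
    congr 1
    have : w ⬝ᵥ u = linPoly f - 1 := by
      simp only [dotProduct, w, u, ← mul_assoc]
      rw [← Finset.sum_mul, hsum, one_mul]
    rw [this]; ring
  have h1 := hsq.trans (det_dvd_det_of_basis b hNmem)
  rw [hdet] at h1
  have h2 := (mul_dvd_mul_iff_right (linPoly_ne_zero hf)).1 h1
  exact hfQ ((linPoly_prime hf).dvd_of_dvd_pow h2)

lemma HasExponents.exists_saito {A : Arrangement K n} {e : Multiset ℕ} (h : HasExponents A e) :
    ∃ d : Fin n → ℕ, e = Finset.univ.val.map d ∧ Saito A d := by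
  obtain ⟨m, d, b, he, hb⟩ : ∃ (m : ℕ) (d : Fin m → ℕ)
      (b : Basis (Fin m) (MvPolynomial (Fin n) K) (LD A)), e = Finset.univ.val.map d ∧
      ∀ k i, ((b k : Fin n → MvPolynomial (Fin n) K) i).IsHomogeneous (d k) := by
    obtain ⟨Q, hQ, l, b, rfl, hb⟩ := h
    refine ⟨l.length, l.get, b.map (derModuleEquiv hQ), ?_, fun k i => ?_⟩
    · rw [Fin.univ_val_map, List.ofFn_get]
    · rw [Basis.map_apply, derModuleEquiv_apply]
      exact (hb k).2 i
  have hfin : Module.Finite (MvPolynomial (Fin n) K) (LD A) := Module.Finite.of_basis b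
  obtain rfl : m = n := by
    apply le_antisymm
    · have := (b.linearIndependent.map' (LD A).subtype
        (Submodule.ker_subtype _)).fintype_card_le_finrank
      simpa using this
    · have hli : LinearIndependent (MvPolynomial (Fin n) K) (fun k : Fin n =>
          (⟨defPoly A • Pi.single k 1, smul_mem_LD dvd_rfl _⟩ : LD A)) := by
        refine LinearIndependent.of_comp (LD A).subtype ?_
        have : ((defPoly A) • (1 : Matrix (Fin n) (Fin n) (MvPolynomial (Fin n) K))).det ≠ 0 := by
          rw [Matrix.det_smul, Matrix.det_one, mul_one]
          exact pow_ne_zero _ (defPoly_ne_zero A)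
        have h := Matrix.linearIndependent_rows_of_det_ne_zero this
        have hrow :
            (fun i => (defPoly A • (1 : Matrix (Fin n) (Fin n) (MvPolynomial (Fin n) K))) i) =
            fun k => defPoly A • Pi.single k 1 := by
          ext1 k
          ext1 i
          simp [Matrix.one_apply, Pi.single_apply, eq_comm]
        rw [hrow] at h
        exact h
      have := hli.fintype_card_le_finrank
      rwa [Module.finrank_eq_card_basis b, Fintype.card_fin, Fintype.card_fin] at this
  set M : Matrix (Fin m) (Fin m) (MvPolynomial (Fin m) K) :=
    Matrix.of fun k => (b k : Fin m → MvPolynomial (Fin m) K) with hM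
  have hMm : ∀ k, M k ∈ LD A := fun k => (b k).2
  have hMd : ∀ k i, (M k i).IsHomogeneous (d k) := hb
  have hpow : M.det ∣ defPoly A ^ m := by
    have := det_dvd_det_of_basis b
      (N := defPoly A • (1 : Matrix (Fin m) (Fin m) (MvPolynomial (Fin m) K)))
      (fun k => smul_mem_LD dvd_rfl ((1 : Matrix (Fin m) (Fin m) (MvPolynomial (Fin m) K)) k))
    rwa [Matrix.det_smul, Matrix.det_one, mul_one, Fintype.card_fin] at this
  have h0 : M.det ≠ 0 := ne_zero_of_dvd_ne_zero (pow_ne_zero _ (defPoly_ne_zero A)) hpow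
  have hsqf : Squarefree M.det := by
    rw [squarefree_iff_irreducible_sq_not_dvd_of_ne_zero h0]
    intro p hp hpp
    have hp' : Prime p := hp.prime
    obtain ⟨H, hH, hd⟩ := hp'.exists_mem_finset_dvd
      (hp'.dvd_of_dvd_pow (((dvd_mul_right p p).trans hpp).trans hpow))
    obtain ⟨hf, -⟩ := formOf_spec hH
    have has : Associated p (linPoly (formOf H)) := hp'.associated_of_dvd (linPoly_prime hf) hd
    exact not_sq_dvd_det b hf ((mul_dvd_mul has.dvd' has.dvd').trans hpp)
  have hdvd : M.det ∣ defPoly A := by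
    rcases Nat.eq_zero_or_pos m with rfl | hm
    · rw [pow_zero] at hpow
      exact hpow.trans (one_dvd _)
    · exact (hsqf.dvd_pow_iff_dvd hm.ne').1 hpow
  refine ⟨d, he, M, hMm, hMd, h0, ?_⟩
  have hass : Associated M.det (defPoly A) := associated_of_dvd_dvd hdvd (defPoly_dvd_det hMm)
  obtain ⟨q, hq⟩ := hdvd
  have hq0 : q ≠ 0 := by rintro rfl; exact defPoly_ne_zero A (by simpa using hq)
  have h1 := (defPoly_isHomogeneous A).totalDegree (defPoly_ne_zero A)
  rw [hq, MvPolynomial.totalDegree_mul_of_isDomain h0 hq0,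
    (isHomogeneous_det hMd).totalDegree h0] at h1
  have h2 := card_le_of_det_ne_zero hMm hMd h0
  omega

end SaitoConverse

section LowDimension

variable {K : Type*} [Field K] {n : ℕ}

lemma Arrangement.ext_hyperplanes {A B : Arrangement K n} (h : A.hyperplanes = B.hyperplanes) :
    A = B := by
  cases A; cases B; simpa using h

lemma exists_equiv_ker {f : (Fin (n + 1) → K) →ₗ[K] K} (hf : f ≠ 0) :
    Nonempty (LinearMap.ker f ≃ₗ[K] (Fin n → K)) := by
  apply FiniteDimensional.nonempty_linearEquiv_of_finrank_eq
  have h1 := LinearMap.finrank_range_add_finrank_ker f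
  rw [LinearMap.range_eq_top.2 (LinearMap.surjective hf), finrank_top, Module.finrank_self,
    Module.finrank_fin_fun] at h1
  rw [Module.finrank_fin_fun]
  omega

lemma exists_isRestriction {A : Arrangement K (n + 1)} {H : Submodule K (Fin (n + 1) → K)}
    (hH : H ∈ A.hyperplanes) : ∃ B : Arrangement K n, IsRestriction A H B := by
  obtain ⟨f, hf, rfl⟩ := A.isHyp H hH
  obtain ⟨e⟩ := exists_equiv_ker hf
  refine ⟨⟨(A.hyperplanes.erase (LinearMap.ker f)).image (fun H' => Submodule.map
    (e : LinearMap.ker f →ₗ[K] (Fin n → K)) (H'.comap (LinearMap.ker f).subtype)), ?_⟩, e, rfl⟩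
  intro X hX
  obtain ⟨H', hH', rfl⟩ := Finset.mem_image.1 hX
  obtain ⟨hne, hA⟩ := Finset.mem_erase.1 hH'
  obtain ⟨g, hg, rfl⟩ := A.isHyp H' hA
  refine ⟨g ∘ₗ (LinearMap.ker f).subtype ∘ₗ (e.symm : (Fin n → K) →ₗ[K] LinearMap.ker f), ?_, ?_⟩
  · intro h0
    apply hne
    have hle : LinearMap.ker f ≤ LinearMap.ker g := fun x hx => by
      have := LinearMap.congr_fun h0 (e ⟨x, hx⟩)
      simpa using this
    obtain ⟨c, hc⟩ := eq_smul_of_ker_le hf hle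
    exact ker_eq_of_eq_smul hg hc
  · ext x
    simp only [Submodule.mem_map, Submodule.mem_comap, LinearMap.mem_ker, LinearMap.comp_apply]
    constructor
    · rintro ⟨y, hy, rfl⟩
      simpa using hy
    · intro hx
      exact ⟨e.symm x, hx, by simp⟩

lemma card_of_isRestriction {A : Arrangement K (n + 1)} {H : Submodule K (Fin (n + 1) → K)}
    {B : Arrangement K n} (h : IsRestriction A H B) :
    B.hyperplanes.card = ((A.hyperplanes.erase H).image fun H' => H'.comap H.subtype).card := by
  obtain ⟨e, he⟩ := h
  rw [he, ← Finset.card_image_of_injective _ (Submodule.map_injective_of_injective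
    (f := (e : H →ₗ[K] (Fin n → K))) e.injective), Finset.image_image]
  rfl

lemma saito_emptyArr : Saito (emptyArr K n) 0 := by
  refine ⟨1, fun k f _ hf => absurd hf (by simp [emptyArr]), fun k i => ?_, by simp,
    by simp [emptyArr]⟩
  rw [Matrix.one_apply]
  split_ifs
  · exact MvPolynomial.isHomogeneous_one _ _
  · exact MvPolynomial.isHomogeneous_zero _ _ _

lemma eq_emptyArr {A : Arrangement K n} (h : A.hyperplanes = ∅) : A = emptyArr K n :=
  Arrangement.ext_hyperplanes h

lemma card_le_one (A : Arrangement K 1) : A.hyperplanes.card ≤ 1 := by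
  rw [Finset.card_le_one]
  have : ∀ H ∈ A.hyperplanes, H = ⊥ := by
    intro H hH
    obtain ⟨f, hf, rfl⟩ := A.isHyp H hH
    rw [LinearMap.ker_eq_bot']
    intro x hx
    rw [form_apply, Fin.sum_univ_one] at hx
    ext i
    rcases mul_eq_zero.1 hx with h | h
    · rwa [Subsingleton.elim i 0]
    · exact absurd (LinearMap.pi_ext' fun i => LinearMap.ext_ring
        (by rw [Subsingleton.elim i 0]; simpa using h)) hf
  intro a ha b hb
  rw [this a ha, this b hb]

lemma saito_one {A : Arrangement K 1} (h : A.hyperplanes.Nonempty) : Saito A ![1] := by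
  refine ⟨Matrix.of fun _ => MvPolynomial.X, fun _ => X_mem_LD A, fun k i => ?_, ?_, ?_⟩
  · rw [Subsingleton.elim k 0]
    exact MvPolynomial.isHomogeneous_X _ _
  · simp
  · have := card_le_one A
    have := h.card_pos
    simp; omega

lemma recursivelyFree_one (A : Arrangement K 1) : RecursivelyFree K A := by
  rcases A.hyperplanes.eq_empty_or_nonempty with h | ⟨H, hH⟩
  · rw [eq_emptyArr h]; exact .empty 1
  · obtain ⟨B, hB⟩ := exists_isRestriction hH
    have hB0 : B = emptyArr K 0 := eq_emptyArr (Finset.eq_empty_of_forall_notMem fun X hX => by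
      obtain ⟨f, hf, -⟩ := B.isHyp X hX
      exact hf (LinearMap.ext fun x => by rw [form_apply]; simp))
    have hd : A.delete H = emptyArr K 1 := eq_emptyArr (by
      have := card_le_one A
      rw [← Finset.card_eq_zero, Arrangement.delete, Finset.card_erase_of_mem hH]
      omega)
    subst hB0
    refine .add A H hH _ hB _ 0 (hd ▸ .empty 1) (.empty 0) (hd ▸ saito_emptyArr.hasExponents) ?_
      (Multiset.zero_le _)
    exact (saito_emptyArr (K := K) (n := 0)).hasExponents

lemma linPoly_two (f : (Fin 2 → K) →ₗ[K] K) : linPoly f =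
    MvPolynomial.C (f (Pi.single 0 1)) * MvPolynomial.X 0 +
      MvPolynomial.C (f (Pi.single 1 1)) * MvPolynomial.X 1 := by
  simp [linPoly]

lemma saito_two {A : Arrangement K 2} (h : A.hyperplanes.Nonempty) :
    Saito A ![1, A.hyperplanes.card - 1] := by
  obtain ⟨H, hH⟩ := h
  obtain ⟨hf, hk⟩ := formOf_spec hH
  set f := formOf H
  let w : Fin 2 → MvPolynomial (Fin 2) K :=
    ![MvPolynomial.C (f (Pi.single 1 1)), - MvPolynomial.C (f (Pi.single 0 1))]
  have hw : app w f = 0 := by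
    simp [app, w, MvPolynomial.smul_eq_C_mul]; ring
  have hwd : ∀ i, (w i).IsHomogeneous 0 := by
    intro i
    fin_cases i
    · exact MvPolynomial.isHomogeneous_C _ _
    · exact (MvPolynomial.isHomogeneous_C _ _).neg
  have hcard : (A.delete H).hyperplanes.card = A.hyperplanes.card - 1 :=
    Finset.card_erase_of_mem hH
  refine ⟨Matrix.of ![MvPolynomial.X, defPoly (A.delete H) • w], ?_, ?_, ?_, ?_⟩
  · intro k
    fin_cases k
    · exact X_mem_LD A
    · intro g hg hgA
      change _ ∣ app (defPoly (A.delete H) • w) g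
      by_cases hne : LinearMap.ker g = H
      · obtain ⟨c, hc⟩ := eq_smul_of_ker_le (g := g) hf (by rw [hk, hne])
        refine dvd_app_of_dvd hg hc ?_
        rw [app_smul_left, hw, mul_zero]
        exact dvd_zero _
      · rw [app_smul_left]
        exact (linPoly_dvd_defPoly hg (Finset.mem_erase.2 ⟨hne, hgA⟩)).mul_right _
  · intro k i
    fin_cases k
    · exact MvPolynomial.isHomogeneous_X _ _
    · have := (defPoly_isHomogeneous (A.delete H)).mul (hwd i)
      rwa [hcard] at this
  · have : (Matrix.of ![MvPolynomial.X, defPoly (A.delete H) • w]).det =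
        - (defPoly (A.delete H) * linPoly f) := by
      rw [Matrix.det_fin_two, linPoly_two]
      simp [w]; ring
    rw [this, neg_ne_zero]
    exact mul_ne_zero (defPoly_ne_zero _) (linPoly_ne_zero hf)
  · have : 0 < A.hyperplanes.card := Finset.card_pos.2 ⟨H, hH⟩
    simp [Fin.sum_univ_two]; omega

lemma univ_map_two (d : Fin 2 → ℕ) : Finset.univ.val.map d = {d 0, d 1} := rfl

lemma univ_map_three (d : Fin 3 → ℕ) : Finset.univ.val.map d = {d 0, d 1, d 2} := rfl

lemma recursivelyFree_two (A : Arrangement K 2) : RecursivelyFree K A := by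
  induction hc : A.hyperplanes.card generalizing A with
  | zero => rw [eq_emptyArr (Finset.card_eq_zero.1 hc)]; exact .empty 2
  | succ m ih =>
    obtain ⟨H, hH⟩ := Finset.card_pos.1 (by omega : 0 < A.hyperplanes.card)
    obtain ⟨B, hB⟩ := exists_isRestriction hH
    have hd := ih (A.delete H) (by rw [Arrangement.delete, Finset.card_erase_of_mem hH]; omega)
    have hcB := hB
    obtain ⟨e, he⟩ := hcB
    rcases (A.delete H).hyperplanes.eq_empty_or_nonempty with h0 | h0
    · have hB0 : B = emptyArr K 1 := eq_emptyArr (by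
        rw [he, Finset.image_eq_empty]; exact h0)
      refine .add A H hH B hB _ {0} hd (recursivelyFree_one B)
        (by rw [eq_emptyArr h0]; exact saito_emptyArr.hasExponents)
        (by rw [hB0]; exact (saito_emptyArr (K := K) (n := 1)).hasExponents) ?_
      rw [univ_map_two]
      exact Multiset.singleton_le.2 (by simp)
    · refine .add A H hH B hB _ {1} hd (recursivelyFree_one B) (saito_two h0).hasExponents
        (saito_one (by rw [he, Finset.image_nonempty]; exact h0)).hasExponents ?_
      rw [univ_map_two]
      exact Multiset.singleton_le.2 (by simp)

lemma X_ne_X_smul {a b : MvPolynomial (Fin n) K} {i j : Fin n} (hij : i ≠ j)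
    (h : MvPolynomial.X i * b = MvPolynomial.X j * a) : MvPolynomial.X i ∣ a := by
  have hp : Prime (MvPolynomial.X i : MvPolynomial (Fin n) K) := MvPolynomial.X_prime
  rcases hp.dvd_or_dvd (Dvd.intro _ h) with h | h
  · exact absurd (MvPolynomial.X_dvd_X.1 h) hij
  · exact h

lemma exists_eq_smul_X_two {θ : Fin 2 → MvPolynomial (Fin 2) K}
    (h : (Matrix.of ![MvPolynomial.X, θ]).det = 0) : ∃ p : MvPolynomial (Fin 2) K,
      θ = p • MvPolynomial.X := by
  rw [Matrix.det_fin_two] at h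
  simp only [Matrix.of_apply, Matrix.cons_val_zero, Matrix.cons_val_one] at h
  obtain ⟨p, hp⟩ := X_ne_X_smul (by decide) (sub_eq_zero.1 h)
  refine ⟨p, funext fun i => ?_⟩
  fin_cases i
  · simp [hp, mul_comm]
  · rw [hp] at h
    have hX : (MvPolynomial.X 0 : MvPolynomial (Fin 2) K) ≠ 0 := MvPolynomial.X_ne_zero _
    apply mul_left_cancel₀ hX
    simp only [Fin.mk_one, Pi.smul_apply, smul_eq_mul]
    linear_combination h

lemma two_hom {θ : Fin 2 → MvPolynomial (Fin 2) K} {d : ℕ} (hd : ∀ i, (θ i).IsHomogeneous d)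
    (k i : Fin 2) : (Matrix.of ![MvPolynomial.X, θ] k i).IsHomogeneous (![1, d] k) := by
  fin_cases k
  · exact MvPolynomial.isHomogeneous_X _ _
  · exact hd i

lemma card_le_of_two {A : Arrangement K 2} {θ : Fin 2 → MvPolynomial (Fin 2) K} {d : ℕ}
    (hθ : θ ∈ LD A) (hd : ∀ i, (θ i).IsHomogeneous d)
    (h : (Matrix.of ![MvPolynomial.X, θ]).det ≠ 0) : A.hyperplanes.card ≤ 1 + d := by
  have := card_le_of_det_ne_zero (A := A) (M := Matrix.of ![MvPolynomial.X, θ]) (d := ![1, d])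
    (fun k => by fin_cases k; exacts [X_mem_LD A, hθ]) (two_hom hd) h
  simpa [Fin.sum_univ_two] using this

lemma exists_eq_smul_X_of_lt {A : Arrangement K 2} {θ : Fin 2 → MvPolynomial (Fin 2) K} {d : ℕ}
    (hθ : θ ∈ LD A) (hd : ∀ i, (θ i).IsHomogeneous d) (h : d + 1 < A.hyperplanes.card) :
    ∃ p : MvPolynomial (Fin 2) K, θ = p • MvPolynomial.X := by
  refine exists_eq_smul_X_two ?_
  by_contra h0
  have := card_le_of_two hθ hd h0
  omega

lemma HasExponents.eq_of_two {A : Arrangement K 2} {e : Multiset ℕ} (h : HasExponents A e)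
    (h3 : 3 ≤ A.hyperplanes.card) : e = {1, A.hyperplanes.card - 1} := by
  obtain ⟨d, rfl, M, hM, hd, h0, hs⟩ := h.exists_saito
  rw [Fin.sum_univ_two] at hs
  rw [univ_map_two]
  have key : ∀ k j : Fin 2, d k + d j = A.hyperplanes.card → M k 0 * M j 1 - M k 1 * M j 0 ≠ 0 →
      d k + 1 < A.hyperplanes.card → d k = 1 := by
    intro k j hs hdet hlt
    obtain ⟨p, hp⟩ := exists_eq_smul_X_of_lt (hM k) (hd k) hlt
    have hdet' : M k 0 * M j 1 - M k 1 * M j 0 =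
        p * (Matrix.of ![MvPolynomial.X, M j]).det := by
      rw [hp, Matrix.det_fin_two]
      simp; ring
    rw [hdet'] at hdet
    have h1 := card_le_of_two (hM j) (hd j) (right_ne_zero_of_mul hdet)
    have h2 : d k ≠ 0 := by
      intro h2
      have h3 := hd k 0
      have hp0 := left_ne_zero_of_mul hdet
      have hX : (MvPolynomial.X 0 : MvPolynomial (Fin 2) K) ≠ 0 := MvPolynomial.X_ne_zero _
      rw [hp, Pi.smul_apply, smul_eq_mul, h2] at h3
      have h4 := h3.totalDegree (mul_ne_zero hp0 hX)
      rw [MvPolynomial.totalDegree_mul_of_isDomain hp0 hX, MvPolynomial.totalDegree_X] at h4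
      omega
    omega
  rw [Matrix.det_fin_two] at h0
  by_cases hlt : d 0 + 1 < A.hyperplanes.card
  · have h1 := key 0 1 hs (fun h => h0 (by linear_combination h)) hlt
    rw [h1, ← hs, h1]; simp
  · have h1 := key 1 0 (by omega) (fun h => h0 (by linear_combination -h)) (by omega)
    rw [h1, ← hs, h1, Multiset.pair_comm]; simp

end LowDimension

section Slices

variable {K : Type*} [Field K] {n : ℕ}

lemma homogeneousComponent_mul {σ : Type*} {p : MvPolynomial σ K} {a : ℕ} (hp : p.IsHomogeneous a)
    (q : MvPolynomial σ K) (j : ℕ) : MvPolynomial.homogeneousComponent (a + j) (p * q) =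
      p * MvPolynomial.homogeneousComponent j q := by
  conv_lhs => rw [← MvPolynomial.sum_homogeneousComponent q, Finset.mul_sum, map_sum]
  have : ∀ i ∈ Finset.range (q.totalDegree + 1), MvPolynomial.homogeneousComponent (a + j)
      (p * MvPolynomial.homogeneousComponent i q) =
        if i = j then p * MvPolynomial.homogeneousComponent j q else 0 := by
    intro i _
    rw [MvPolynomial.homogeneousComponent_of_mem
      (hp.mul (MvPolynomial.homogeneousComponent_isHomogeneous i q))]
    by_cases h : i = j
    · simp [h]
    · rw [if_neg (by omega), if_neg h]
  rw [Finset.sum_congr rfl this, Finset.sum_ite_eq']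
  split_ifs with h
  · rfl
  · rw [MvPolynomial.homogeneousComponent_eq_zero j q
      (by rw [Finset.mem_range] at h; omega), mul_zero]

lemma isHomogeneous_of_mul_left {σ : Type*} {p q : MvPolynomial σ K} {a b : ℕ}
    (hp : p.IsHomogeneous a) (hp0 : p ≠ 0) (h : (p * q).IsHomogeneous b) :
    q.IsHomogeneous (b - a) := by
  by_cases hq : q = 0
  · rw [hq]; exact MvPolynomial.isHomogeneous_zero _ _ _
  have htd := h.totalDegree (mul_ne_zero hp0 hq)
  rw [MvPolynomial.totalDegree_mul_of_isDomain hp0 hq, hp.totalDegree hp0] at htd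
  have hab : a + (b - a) = b := by omega
  have h1 := homogeneousComponent_mul hp q (b - a)
  rw [hab, MvPolynomial.homogeneousComponent_of_mem h, if_pos rfl] at h1
  rw [mul_left_cancel₀ hp0 h1]
  exact MvPolynomial.homogeneousComponent_isHomogeneous _ _

variable (n) in
/-- A splitting of the coordinate space along the kernel of a linear form. -/
structure Slice (f : (Fin (n + 1) → K) →ₗ[K] K) where
  /-- the parametrization of the kernel -/
  ι : (Fin n → K) →ₗ[K] (Fin (n + 1) → K)
  /-- the projection to the kernel -/
  π : (Fin (n + 1) → K) →ₗ[K] (Fin n → K)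
  /-- a vector off the kernel -/
  v : Fin (n + 1) → K
  f_v : f v = 1
  f_ι : f ∘ₗ ι = 0
  ι_π : ∀ x, ι (π x) + f x • v = x
  π_ι : ∀ y, π (ι y) = y

lemma exists_slice_of_equiv {f : (Fin (n + 1) → K) →ₗ[K] K} (hf : f ≠ 0)
    (e : LinearMap.ker f ≃ₗ[K] (Fin n → K)) : ∃ s : Slice n f, ∀ y, s.ι y = e.symm y := by
  obtain ⟨v, hv⟩ := exists_form_eq_one hf
  let p : (Fin (n + 1) → K) →ₗ[K] LinearMap.ker f :=
    LinearMap.codRestrict (LinearMap.ker f) (LinearMap.id - f.smulRight v) (fun x => by simp [hv])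
  have hp : ∀ x, (p x : Fin (n + 1) → K) = x - f x • v := fun _ => rfl
  refine ⟨⟨(LinearMap.ker f).subtype ∘ₗ e.symm, (e : LinearMap.ker f →ₗ[K] _) ∘ₗ p, v, hv, ?_, ?_,
    ?_⟩, fun y => rfl⟩
  · ext1 i; refine LinearMap.ext_ring ?_
    simp
  · intro x; simp [hp]
  · intro y
    have : p (e.symm y) = e.symm y := by
      apply Subtype.ext
      have : f (e.symm y) = 0 := (e.symm y).2
      rw [hp, this, zero_smul, sub_zero]
    simp [this]

lemma IsRestriction.exists_slice {A : Arrangement K (n + 1)} {f : (Fin (n + 1) → K) →ₗ[K] K}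
    (hf : f ≠ 0) {B : Arrangement K n} (h : IsRestriction A (LinearMap.ker f) B) :
    ∃ s : Slice n f, B.hyperplanes =
      (A.hyperplanes.erase (LinearMap.ker f)).image fun H => H.comap s.ι := by
  obtain ⟨e, he⟩ := h
  obtain ⟨s, hs⟩ := exists_slice_of_equiv hf e
  refine ⟨s, he.trans (Finset.image_congr fun H _ => ?_)⟩
  ext x
  simp only [Submodule.mem_map, Submodule.mem_comap, hs]
  constructor
  · rintro ⟨y, hy, rfl⟩
    simpa using hy
  · intro hx
    exact ⟨e.symm x, hx, by simp⟩

namespace Slice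

variable {f : (Fin (n + 1) → K) →ₗ[K] K} (s : Slice n f)

lemma dvd_iff (p : MvPolynomial (Fin (n + 1)) K) : linPoly f ∣ p ↔ pull s.ι p = 0 :=
  linPoly_dvd_iff s.ι_π s.f_ι p

lemma ne_zero {f : (Fin (n + 1) → K) →ₗ[K] K} (s : Slice n f) : f ≠ 0 := by
  rintro rfl
  simpa using s.f_v

lemma pull_pull (p : MvPolynomial (Fin n) K) : pull s.ι (pull s.π p) = p := by
  have : (pull s.ι).comp (pull s.π) = AlgHom.id K _ := by
    refine MvPolynomial.algHom_ext fun j => ?_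
    have hX : (MvPolynomial.X j : MvPolynomial (Fin n) K) = linPoly (LinearMap.proj j) := by
      rw [linPoly_eq_app, app_proj]
    rw [AlgHom.comp_apply, hX, pull_linPoly, pull_linPoly]
    congr 1
    ext1 i; refine LinearMap.ext_ring ?_
    simp [s.π_ι]
  exact congrArg (fun φ => φ p) this

lemma eq_comp_add (g : (Fin (n + 1) → K) →ₗ[K] K) : g = (g ∘ₗ s.ι) ∘ₗ s.π + g s.v • f := by
  ext1 i; refine LinearMap.ext_ring ?_
  conv_lhs => rw [LinearMap.comp_apply, LinearMap.single_apply, ← s.ι_π (Pi.single i 1)]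
  simp [mul_comm]

lemma comp_π_comp_ι (g : (Fin n → K) →ₗ[K] K) : (g ∘ₗ s.π) ∘ₗ s.ι = g := by
  ext1 i; refine LinearMap.ext_ring ?_
  simp [s.π_ι]

/-- The restriction of a derivation to the kernel. -/
noncomputable def res (θ : Fin (n + 1) → MvPolynomial (Fin (n + 1)) K) :
    Fin n → MvPolynomial (Fin n) K :=
  fun k => app (fun i => pull s.ι (θ i)) (LinearMap.proj k ∘ₗ s.π)

lemma app_res (θ : Fin (n + 1) → MvPolynomial (Fin (n + 1)) K) (g : (Fin n → K) →ₗ[K] K) :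
    app (s.res θ) g = pull s.ι (app θ (g ∘ₗ s.π)) := by
  rw [map_app, app_comp]
  rfl

lemma app_res_comp {θ : Fin (n + 1) → MvPolynomial (Fin (n + 1)) K} (h : linPoly f ∣ app θ f)
    (g : (Fin (n + 1) → K) →ₗ[K] K) : app (s.res θ) (g ∘ₗ s.ι) = pull s.ι (app θ g) := by
  conv_rhs => rw [s.eq_comp_add g, app_add, app_smul, map_add, map_smul, (s.dvd_iff _).1 h,
    smul_zero, add_zero]
  rw [app_res]

lemma res_isHomogeneous {θ : Fin (n + 1) → MvPolynomial (Fin (n + 1)) K} {d : ℕ}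
    (h : ∀ i, (θ i).IsHomogeneous d) (k : Fin n) : (s.res θ k).IsHomogeneous d :=
  MvPolynomial.IsHomogeneous.sum _ _ _ fun i _ => by
    rw [MvPolynomial.smul_eq_C_mul]
    exact (pull_isHomogeneous _ (h i)).C_mul _

lemma res_X : s.res MvPolynomial.X = MvPolynomial.X := by
  funext k
  have : app (MvPolynomial.X : Fin (n + 1) → MvPolynomial (Fin (n + 1)) K)
      (LinearMap.proj k ∘ₗ s.π) = linPoly (LinearMap.proj k ∘ₗ s.π) := (linPoly_eq_app _).symm
  rw [res, ← map_app, this, pull_linPoly, comp_π_comp_ι, linPoly_eq_app, app_proj]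

lemma res_sub (θ η : Fin (n + 1) → MvPolynomial (Fin (n + 1)) K) :
    s.res (θ - η) = s.res θ - s.res η := by
  funext k
  simp only [res, Pi.sub_apply, map_sub]
  exact app_sub_left _ _ _

lemma res_smul (p : MvPolynomial (Fin (n + 1)) K)
    (θ : Fin (n + 1) → MvPolynomial (Fin (n + 1)) K) :
    s.res (p • θ) = pull s.ι p • s.res θ := by
  funext k
  simp only [res, Pi.smul_apply, smul_eq_mul, map_mul]
  exact app_smul_left _ _ _

lemma exists_eq_smul_of_res_eq_zero {θ : Fin (n + 1) → MvPolynomial (Fin (n + 1)) K}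
    (h : linPoly f ∣ app θ f) (h0 : s.res θ = 0) :
    ∃ θ' : Fin (n + 1) → MvPolynomial (Fin (n + 1)) K, θ = linPoly f • θ' := by
  have : ∀ i, linPoly f ∣ θ i := fun i => by
    have h1 := s.app_res_comp h (LinearMap.proj i)
    rw [h0, app_zero_left, app_proj] at h1
    exact (s.dvd_iff _).2 h1.symm
  choose θ' hθ' using this
  exact ⟨θ', funext hθ'⟩

lemma mem_of_smul_mem {A : Arrangement K (n + 1)}
    {θ : Fin (n + 1) → MvPolynomial (Fin (n + 1)) K} (hf : f ≠ 0) (h : linPoly f • θ ∈ LD A) :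
    θ ∈ LD (A.delete (LinearMap.ker f)) := by
  intro g hg hgA
  obtain ⟨hne, hgA⟩ := Finset.mem_erase.1 hgA
  have h1 := h g hg hgA
  rw [app_smul_left] at h1
  rcases (linPoly_prime hg).dvd_or_dvd h1 with h2 | h2
  · obtain ⟨c, hc⟩ := linPoly_dvd_linPoly hg h2
    exact absurd (ker_eq_of_eq_smul hf hc).symm hne
  · exact h2

lemma res_mem {A : Arrangement K (n + 1)} {B : Arrangement K n}
    (hB : B.hyperplanes = (A.hyperplanes.erase (LinearMap.ker f)).image fun H => H.comap s.ι)
    {θ : Fin (n + 1) → MvPolynomial (Fin (n + 1)) K} (h : θ ∈ LD A)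
    (hfθ : linPoly f ∣ app θ f) : s.res θ ∈ LD B := by
  intro h' h0 hX
  rw [hB] at hX
  obtain ⟨H, hH, hX⟩ := Finset.mem_image.1 hX
  obtain ⟨hg, hk⟩ := formOf_spec (Finset.mem_of_mem_erase hH)
  set g := formOf H
  rw [← hk] at hH hX
  have hgι : g ∘ₗ s.ι ≠ 0 := by
    intro hz
    apply h0
    rw [← LinearMap.ker_eq_top, ← hX, eq_top_iff]
    intro x _
    exact LinearMap.congr_fun hz x
  obtain ⟨c, hc⟩ := eq_smul_of_ker_le hgι (g := h') hX.le
  refine dvd_app_of_dvd h0 hc ?_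
  rw [s.app_res_comp hfθ, ← pull_linPoly]
  exact map_dvd _ (h g hg (Finset.mem_of_mem_erase hH))

end Slice

lemma exists_eq_add_of_res {A : Arrangement K 3} {f : (Fin 3 → K) →ₗ[K] K} (s : Slice 2 f)
    (hA : LinearMap.ker f ∈ A.hyperplanes) {θ : Fin 3 → MvPolynomial (Fin 3) K} {d : ℕ}
    (hθ : θ ∈ LD A) (hd : ∀ i, (θ i).IsHomogeneous d) {p : MvPolynomial (Fin 2) K}
    (hp : s.res θ = p • MvPolynomial.X) :
    ∃ (p : MvPolynomial (Fin 3) K) (θ' : Fin 3 → MvPolynomial (Fin 3) K),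
      θ = p • MvPolynomial.X + linPoly f • θ' ∧ θ' ∈ LD (A.delete (LinearMap.ker f)) ∧
      ∀ i, (θ' i).IsHomogeneous (d - 1) := by
  have hmem : θ - pull s.π p • MvPolynomial.X ∈ LD A :=
    sub_mem hθ (Submodule.smul_mem _ _ (X_mem_LD A))
  have h0 : s.res (θ - pull s.π p • MvPolynomial.X) = 0 := by
    rw [s.res_sub, s.res_smul, s.res_X, s.pull_pull, hp, sub_self]
  obtain ⟨θ', hθ'⟩ := s.exists_eq_smul_of_res_eq_zero (hmem f s.ne_zero hA) h0
  refine ⟨pull s.π p, θ', by rw [← hθ']; abel, ?_, fun i => ?_⟩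
  · rw [hθ'] at hmem
    exact Slice.mem_of_smul_mem s.ne_zero hmem
  · refine isHomogeneous_of_mul_left (linPoly_isHomogeneous f) (linPoly_ne_zero s.ne_zero) ?_
    have h1 : linPoly f * θ' i = θ i - pull s.π p * MvPolynomial.X i :=
      (congrFun hθ' i).symm
    rw [h1]
    refine (hd i).sub ?_
    have h2 : (p * MvPolynomial.X 0).IsHomogeneous d := by
      have := s.res_isHomogeneous hd 0
      rwa [hp] at this
    rw [mul_comm] at h2
    have h3 := isHomogeneous_of_mul_left (MvPolynomial.isHomogeneous_X _ _)
      (MvPolynomial.X_ne_zero _) h2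
    rcases Nat.eq_zero_or_pos d with rfl | hpos
    · have : p = 0 := by
        by_contra hp0
        have h4 := h2.totalDegree (mul_ne_zero (MvPolynomial.X_ne_zero _) hp0)
        rw [MvPolynomial.totalDegree_mul_of_isDomain (MvPolynomial.X_ne_zero _) hp0,
          MvPolynomial.totalDegree_X] at h4
        omega
      rw [this, map_zero, zero_mul]
      exact MvPolynomial.isHomogeneous_zero _ _ _
    · have h5 := (pull_isHomogeneous s.π h3).mul (MvPolynomial.isHomogeneous_X K i)
      rwa [Nat.sub_add_cancel hpos] at h5

lemma exists_eq_add_of_lt {A : Arrangement K 3} {f : (Fin 3 → K) →ₗ[K] K} (s : Slice 2 f)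
    {B : Arrangement K 2}
    (hB : B.hyperplanes = (A.hyperplanes.erase (LinearMap.ker f)).image fun H => H.comap s.ι)
    (hA : LinearMap.ker f ∈ A.hyperplanes) {θ : Fin 3 → MvPolynomial (Fin 3) K} {d : ℕ}
    (hθ : θ ∈ LD A) (hd : ∀ i, (θ i).IsHomogeneous d) (hlt : d + 1 < B.hyperplanes.card) :
    ∃ (p : MvPolynomial (Fin 3) K) (θ' : Fin 3 → MvPolynomial (Fin 3) K),
      θ = p • MvPolynomial.X + linPoly f • θ' ∧ θ' ∈ LD (A.delete (LinearMap.ker f)) ∧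
      ∀ i, (θ' i).IsHomogeneous (d - 1) := by
  obtain ⟨p, hp⟩ :=
    exists_eq_smul_X_of_lt (s.res_mem hB hθ (hθ f s.ne_zero hA)) (s.res_isHomogeneous hd) hlt
  exact exists_eq_add_of_res s hA hθ hd hp

end Slices

section PolynomialB

variable {K : Type*} [Field K] {n : ℕ}

lemma eq_zero_of_dvd_of_lt {σ : Type*} {p q : MvPolynomial σ K} {a b : ℕ} (hq : q.IsHomogeneous a)
    (hp : p.IsHomogeneous b) (h : q ∣ p) (hlt : b < a) : p = 0 := by
  by_contra hp0
  obtain ⟨r, rfl⟩ := h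
  have h1 := hp.totalDegree hp0
  rw [MvPolynomial.totalDegree_mul_of_isDomain (left_ne_zero_of_mul hp0)
    (right_ne_zero_of_mul hp0), hq.totalDegree (left_ne_zero_of_mul hp0)] at h1
  omega

lemma app_isHomogeneous {θ : Fin n → MvPolynomial (Fin n) K} {d : ℕ}
    (h : ∀ i, (θ i).IsHomogeneous d) (f : (Fin n → K) →ₗ[K] K) : (app θ f).IsHomogeneous d :=
  MvPolynomial.IsHomogeneous.sum _ _ _ fun i _ => by
    rw [MvPolynomial.smul_eq_C_mul]
    exact (h i).C_mul _

namespace Slice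

variable {f : (Fin (n + 1) → K) →ₗ[K] K} (s : Slice n f)

lemma exists_form_eq {h : (Fin (n + 1) → K) →ₗ[K] K} {g : (Fin n → K) →ₗ[K] K} (hg : g ≠ 0)
    (hk : (LinearMap.ker h).comap s.ι = LinearMap.ker g) :
    ∃ c d : K, c ≠ 0 ∧ h ∘ₗ s.ι = c • g ∧ h = c • (g ∘ₗ s.π) + d • f := by
  obtain ⟨c, hc⟩ := eq_smul_of_ker_le hg (g := h ∘ₗ s.ι) (by rw [← hk]; exact le_rfl)
  refine ⟨c, h s.v, ?_, hc, ?_⟩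
  · rintro rfl
    rw [zero_smul] at hc
    have : LinearMap.ker g = ⊤ := by
      rw [← hk, eq_top_iff]
      exact fun x _ => LinearMap.congr_fun hc x
    exact hg (LinearMap.ker_eq_top.1 this)
  · conv_lhs => rw [s.eq_comp_add h, hc]
    rw [LinearMap.smul_comp]

lemma pow_dvd_pull {A : Arrangement K (n + 1)} {g : (Fin n → K) →ₗ[K] K} (hg : g ≠ 0)
    {S : Finset (Submodule K (Fin (n + 1) → K))} (hS : S ⊆ A.hyperplanes)
    (hk : ∀ H ∈ S, H.comap s.ι = LinearMap.ker g) {p : MvPolynomial (Fin (n + 1)) K}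
    (hp : ∀ H ∈ S, linPoly (formOf H) ∣ p) : linPoly g ^ S.card ∣ pull s.ι p := by
  have h1 : ∏ H ∈ S, linPoly (formOf H) ∣ p := by
    refine Finset.prod_dvd_of_isRelPrime ?_ hp
    intro H hH H' hH' hne
    exact isRelPrime_forms (A := A) (fun _ h => formOf_spec h) (hS hH) (hS hH') hne
  refine dvd_trans ?_ (map_dvd (pull s.ι) h1)
  rw [map_prod, ← Finset.prod_const]
  refine Finset.prod_dvd_prod_of_dvd _ _ fun H hH => ?_
  obtain ⟨-, hkH⟩ := formOf_spec (hS hH)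
  obtain ⟨c, d, hc, hcg, -⟩ := s.exists_form_eq hg (h := formOf H) (by rw [hkH, hk H hH])
  rw [pull_linPoly, hcg, linPoly_smul, MvPolynomial.smul_eq_C_mul]
  exact dvd_mul_left _ _

/-- Multiplicities along the restriction of a derivation annihilating the form. -/
lemma pow_dvd_app_res {A : Arrangement K (n + 1)} {g : (Fin n → K) →ₗ[K] K} (hg : g ≠ 0)
    {S : Finset (Submodule K (Fin (n + 1) → K))} (hS : S ⊆ A.hyperplanes)
    (hk : ∀ H ∈ S, H.comap s.ι = LinearMap.ker g)
    {θ : Fin (n + 1) → MvPolynomial (Fin (n + 1)) K} (hθ : θ ∈ LD A) (h0 : app θ f = 0) :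
    linPoly g ^ S.card ∣ app (s.res θ) g := by
  rw [app_res]
  refine s.pow_dvd_pull hg hS hk fun H hH => ?_
  obtain ⟨hh, hkH⟩ := formOf_spec (hS hH)
  obtain ⟨c, d, hc, -, hcd⟩ := s.exists_form_eq hg (h := formOf H) (by rw [hkH, hk H hH])
  have h1 := hθ (formOf H) hh (by rw [hkH]; exact hS hH)
  have h2 : app θ (formOf H) = MvPolynomial.C c * app θ (g ∘ₗ s.π) := by
    rw [hcd, app_add, app_smul, app_smul, h0, smul_zero, add_zero, MvPolynomial.smul_eq_C_mul]
  rw [h2] at h1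
  exact ((isUnit_iff_ne_zero.2 hc).map MvPolynomial.C).dvd_mul_left.1 h1

lemma pow_dvd_pull_app {A : Arrangement K (n + 1)} {g : (Fin n → K) →ₗ[K] K} (hg : g ≠ 0)
    {S : Finset (Submodule K (Fin (n + 1) → K))} (hS : S ⊆ A.hyperplanes)
    (hk : ∀ H ∈ S, H.comap s.ι = LinearMap.ker g)
    {θ : Fin (n + 1) → MvPolynomial (Fin (n + 1)) K} (hθ : θ ∈ LD A) :
    linPoly g ^ (S.card - 1) ∣ pull s.ι (app θ f) := by
  rcases Nat.eq_zero_or_pos S.card with h0 | hpos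
  · rw [h0]; exact one_dvd _
  have h1 : linPoly g ^ S.card ∣ pull s.ι (linPoly (g ∘ₗ s.π) * app θ f -
      linPoly f * app θ (g ∘ₗ s.π)) := by
    refine s.pow_dvd_pull hg hS hk fun H hH => ?_
    obtain ⟨hh, hkH⟩ := formOf_spec (hS hH)
    obtain ⟨c, d, hc, -, hcd⟩ := s.exists_form_eq hg (h := formOf H) (by rw [hkH, hk H hH])
    have h1 := hθ (formOf H) hh (by rw [hkH]; exact hS hH)
    have h2 : MvPolynomial.C c * (linPoly (g ∘ₗ s.π) * app θ f -
        linPoly f * app θ (g ∘ₗ s.π)) = linPoly (formOf H) * app θ f -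
          linPoly f * app θ (formOf H) := by
      rw [hcd, app_add, app_smul, app_smul, linPoly_add, linPoly_smul, linPoly_smul]
      simp only [MvPolynomial.smul_eq_C_mul]
      ring
    rw [← ((isUnit_iff_ne_zero.2 hc).map MvPolynomial.C).dvd_mul_left, h2]
    exact dvd_sub (dvd_mul_right _ _) (h1.mul_left _)
  rw [map_sub, map_mul, map_mul, pull_linPoly, pull_linPoly, comp_π_comp_ι, s.f_ι, linPoly_zero,
    zero_mul, sub_zero] at h1
  obtain ⟨k, hk⟩ := Nat.exists_eq_add_of_lt hpos
  rw [hk, zero_add, pow_succ'] at h1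
  rw [hk, zero_add, Nat.add_sub_cancel]
  exact (mul_dvd_mul_iff_left (linPoly_ne_zero hg)).1 h1

/-- The polynomial of degree `|A'| - |A''|` dividing the restricted values on the removed form. -/
lemma exists_dvd_pull_app {A : Arrangement K (n + 1)} {B : Arrangement K n}
    (hB : B.hyperplanes = (A.hyperplanes.erase (LinearMap.ker f)).image fun H => H.comap s.ι) :
    ∃ q : MvPolynomial (Fin n) K, q ≠ 0 ∧
      q.IsHomogeneous ((A.delete (LinearMap.ker f)).hyperplanes.card - B.hyperplanes.card) ∧
      ∀ θ ∈ LD (A.delete (LinearMap.ker f)), q ∣ pull s.ι (app θ f) := by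
  set A' := A.delete (LinearMap.ker f) with hA'
  let S : Submodule K (Fin n → K) → Finset (Submodule K (Fin (n + 1) → K)) := fun X =>
    A'.hyperplanes.filter fun H => H.comap s.ι = X
  refine ⟨∏ X ∈ B.hyperplanes, linPoly (formOf X) ^ ((S X).card - 1), ?_, ?_, ?_⟩
  · exact Finset.prod_ne_zero_iff.2 fun X hX => pow_ne_zero _ (linPoly_ne_zero (formOf_spec hX).1)
  · have hpos : ∀ X ∈ B.hyperplanes, 1 ≤ (S X).card := fun X hX => by
      rw [hB] at hX
      obtain ⟨H, hH, hX⟩ := Finset.mem_image.1 hX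
      exact Finset.card_pos.2 ⟨H, Finset.mem_filter.2 ⟨hH, hX⟩⟩
    have hsum : A'.hyperplanes.card = ∑ X ∈ B.hyperplanes, (S X).card :=
      Finset.card_eq_sum_card_fiberwise fun H hH => by
        rw [hB]; exact Finset.mem_coe.2 (Finset.mem_image_of_mem _ hH)
    have hdeg : A'.hyperplanes.card - B.hyperplanes.card =
        ∑ X ∈ B.hyperplanes, 1 * ((S X).card - 1) := by
      simp only [one_mul]
      rw [hsum, Finset.sum_tsub_distrib _ hpos]
      simp
    rw [hdeg]
    exact MvPolynomial.IsHomogeneous.prod _ _ _ fun X _ => (linPoly_isHomogeneous _).pow _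
  · intro θ hθ
    refine Finset.prod_dvd_of_isRelPrime ?_ fun X hX => ?_
    · intro X hX Y hY hne
      exact (isRelPrime_forms (A := B) (fun _ h => formOf_spec h) hX hY hne).pow
    · obtain ⟨hg, hk⟩ := formOf_spec hX
      exact s.pow_dvd_pull_app (A := A') hg (Finset.filter_subset _ _)
        (fun H hH => by rw [hk]; exact (Finset.mem_filter.1 hH).2) hθ

lemma mem_of_dvd {f : (Fin (n + 1) → K) →ₗ[K] K} (s : Slice n f) {A : Arrangement K (n + 1)}
    {θ : Fin (n + 1) → MvPolynomial (Fin (n + 1)) K}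
    (hθ : θ ∈ LD (A.delete (LinearMap.ker f))) (h : linPoly f ∣ app θ f) : θ ∈ LD A := by
  intro g hg hgA
  by_cases hne : LinearMap.ker g = LinearMap.ker f
  · obtain ⟨c, hc⟩ := eq_smul_of_ker_le s.ne_zero hne.symm.le
    exact dvd_app_of_dvd hg hc h
  · exact hθ g hg (Finset.mem_erase.2 ⟨hne, hgA⟩)

lemma mem_of_lt {A : Arrangement K (n + 1)} {B : Arrangement K n}
    (hB : B.hyperplanes = (A.hyperplanes.erase (LinearMap.ker f)).image fun H => H.comap s.ι)
    {θ : Fin (n + 1) → MvPolynomial (Fin (n + 1)) K} {d : ℕ}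
    (hθ : θ ∈ LD (A.delete (LinearMap.ker f))) (hd : ∀ i, (θ i).IsHomogeneous d)
    (hlt : d < (A.delete (LinearMap.ker f)).hyperplanes.card - B.hyperplanes.card) : θ ∈ LD A := by
  obtain ⟨q, -, hq, hdvd⟩ := s.exists_dvd_pull_app hB
  refine s.mem_of_dvd hθ ((s.dvd_iff _).2 ?_)
  exact eq_zero_of_dvd_of_lt hq (pull_isHomogeneous _ (app_isHomogeneous hd f)) (hdvd θ hθ) hlt

end Slice

end PolynomialB

section AdditionDeletion

variable {K : Type*} [Field K]

/-- The coefficient determinant of the Euler derivation and two further derivations. -/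
noncomputable def eulerDet (θ η : Fin 3 → MvPolynomial (Fin 3) K) : MvPolynomial (Fin 3) K :=
  (Matrix.of ![MvPolynomial.X, θ, η]).det

lemma eulerDet_eq (θ η : Fin 3 → MvPolynomial (Fin 3) K) : eulerDet θ η =
    MvPolynomial.X 0 * θ 1 * η 2 - MvPolynomial.X 0 * θ 2 * η 1 - MvPolynomial.X 1 * θ 0 * η 2 +
      MvPolynomial.X 1 * θ 2 * η 0 + MvPolynomial.X 2 * θ 0 * η 1 -
        MvPolynomial.X 2 * θ 1 * η 0 := by
  rw [eulerDet, Matrix.det_fin_three]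
  simp

lemma eulerDet_swap (θ η : Fin 3 → MvPolynomial (Fin 3) K) :
    eulerDet η θ = - eulerDet θ η := by
  rw [eulerDet_eq, eulerDet_eq]; ring

lemma eulerDet_add_smul (θ η' : Fin 3 → MvPolynomial (Fin 3) K) (p t f : MvPolynomial (Fin 3) K) :
    eulerDet θ (p • MvPolynomial.X + t • θ + f • η') = f * eulerDet θ η' := by
  rw [eulerDet_eq, eulerDet_eq]
  simp only [Pi.add_apply, Pi.smul_apply, smul_eq_mul]
  ring

lemma eulerDet_add_smul' (θ η : Fin 3 → MvPolynomial (Fin 3) K) (p f : MvPolynomial (Fin 3) K) :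
    eulerDet θ (p • MvPolynomial.X + f • η) = f * eulerDet θ η := by
  have := eulerDet_add_smul θ η p 0 f
  rwa [zero_smul, add_zero] at this

lemma eulerDet_smul (θ η : Fin 3 → MvPolynomial (Fin 3) K) (f : MvPolynomial (Fin 3) K) :
    eulerDet θ (f • η) = f * eulerDet θ η := by
  have := eulerDet_add_smul' θ η 0 f
  rwa [zero_smul, zero_add] at this

lemma eulerDet_sub_smul (θ η : Fin 3 → MvPolynomial (Fin 3) K) (t : MvPolynomial (Fin 3) K) :
    eulerDet (θ - t • η) η = eulerDet θ η := by
  rw [eulerDet_eq, eulerDet_eq]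
  simp only [Pi.sub_apply, Pi.smul_apply, smul_eq_mul]
  ring

/-- `A` is free with exponents `1, a, b`, witnessed by a basis containing the Euler derivation. -/
def EulerFree (A : Arrangement K 3) (a b : ℕ) : Prop :=
  ∃ θ η : Fin 3 → MvPolynomial (Fin 3) K, θ ∈ LD A ∧ η ∈ LD A ∧ (∀ i, (θ i).IsHomogeneous a) ∧
    (∀ i, (η i).IsHomogeneous b) ∧ eulerDet θ η ≠ 0 ∧ 1 + a + b = A.hyperplanes.card

lemma rows_mem {A : Arrangement K 3} {θ η : Fin 3 → MvPolynomial (Fin 3) K} (hθ : θ ∈ LD A)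
    (hη : η ∈ LD A) (k : Fin 3) : Matrix.of ![MvPolynomial.X, θ, η] k ∈ LD A := by
  fin_cases k
  exacts [X_mem_LD A, hθ, hη]

lemma rows_isHomogeneous {θ η : Fin 3 → MvPolynomial (Fin 3) K} {a b : ℕ}
    (ha : ∀ i, (θ i).IsHomogeneous a) (hb : ∀ i, (η i).IsHomogeneous b) (k i : Fin 3) :
    (Matrix.of ![MvPolynomial.X, θ, η] k i).IsHomogeneous (![1, a, b] k) := by
  fin_cases k
  exacts [MvPolynomial.isHomogeneous_X _ _, ha i, hb i]

lemma card_le_of_eulerDet_ne_zero {A : Arrangement K 3} {θ η : Fin 3 → MvPolynomial (Fin 3) K}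
    {a b : ℕ} (hθ : θ ∈ LD A) (hη : η ∈ LD A) (ha : ∀ i, (θ i).IsHomogeneous a)
    (hb : ∀ i, (η i).IsHomogeneous b) (h : eulerDet θ η ≠ 0) : A.hyperplanes.card ≤ 1 + a + b := by
  have := card_le_of_det_ne_zero (A := A) (rows_mem hθ hη) (rows_isHomogeneous ha hb) h
  simpa [Fin.sum_univ_three] using this

lemma EulerFree.saito {A : Arrangement K 3} {a b : ℕ} (h : EulerFree A a b) :
    Saito A ![1, a, b] := by
  obtain ⟨θ, η, hθ, hη, ha, hb, h0, hs⟩ := h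
  exact ⟨_, rows_mem hθ hη, rows_isHomogeneous ha hb, h0, by simpa [Fin.sum_univ_three] using hs⟩

lemma EulerFree.swap {A : Arrangement K 3} {a b : ℕ} (h : EulerFree A a b) : EulerFree A b a := by
  obtain ⟨θ, η, hθ, hη, ha, hb, h0, hs⟩ := h
  exact ⟨η, θ, hη, hθ, hb, ha, by rwa [eulerDet_swap, neg_ne_zero], by omega⟩

lemma smul_mem_of_mem_delete {n : ℕ} {A : Arrangement K n} {f : (Fin n → K) →ₗ[K] K}
    {θ : Fin n → MvPolynomial (Fin n) K} (h : θ ∈ LD (A.delete (LinearMap.ker f))) :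
    linPoly f • θ ∈ LD A := by
  intro g hg hgA
  rw [app_smul_left]
  by_cases hne : LinearMap.ker g = LinearMap.ker f
  · obtain ⟨c, hc⟩ := eq_smul_of_ker_le hg hne.le
    rw [hc, linPoly_smul, MvPolynomial.smul_eq_C_mul]
    exact ((dvd_mul_left _ _).mul_right _)
  · exact (h g hg (Finset.mem_erase.2 ⟨hne, hgA⟩)).mul_left _

lemma smul_isHomogeneous {n a b : ℕ} {p : MvPolynomial (Fin n) K}
    {θ : Fin n → MvPolynomial (Fin n) K} (hp : p.IsHomogeneous a)
    (hθ : ∀ i, (θ i).IsHomogeneous b) (i : Fin n) : ((p • θ) i).IsHomogeneous (a + b) :=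
  hp.mul (hθ i)

lemma card_delete {n : ℕ} {A : Arrangement K n} {H : Submodule K (Fin n → K)}
    (hH : H ∈ A.hyperplanes) : (A.delete H).hyperplanes.card + 1 = A.hyperplanes.card :=
  Finset.card_erase_add_one hH

/-- The addition theorem in dimension three. -/
lemma EulerFree.of_delete {A : Arrangement K 3} {f : (Fin 3 → K) →ₗ[K] K} (s : Slice 2 f)
    {B : Arrangement K 2}
    (hB : B.hyperplanes = (A.hyperplanes.erase (LinearMap.ker f)).image fun H => H.comap s.ι)
    (hA : LinearMap.ker f ∈ A.hyperplanes) {a b : ℕ}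
    (h : EulerFree (A.delete (LinearMap.ker f)) a b) (hc : B.hyperplanes.card = 1 + a) :
    EulerFree A a (b + 1) := by
  obtain ⟨θ, η, hθ, hη, ha, hb, h0, hs⟩ := h
  have hcard := card_delete hA
  have hf1 : ∀ {d : ℕ} {ψ : Fin 3 → MvPolynomial (Fin 3) K}, (∀ i, (ψ i).IsHomogeneous d) →
      ∀ i, ((linPoly f • ψ) i).IsHomogeneous (d + 1) := fun h i => by
    rw [add_comm]; exact smul_isHomogeneous (linPoly_isHomogeneous f) h i
  have hf0 := linPoly_ne_zero s.ne_zero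
  rcases lt_or_ge a b with hab | hab
  · refine ⟨θ, linPoly f • η, s.mem_of_lt hB hθ ha (by omega), smul_mem_of_mem_delete hη,
      ha, hf1 hb, ?_, by omega⟩
    rw [eulerDet_smul]
    exact mul_ne_zero hf0 h0
  obtain ⟨q, hq0, hq, hdvd⟩ := s.exists_dvd_pull_app hB
  rw [← hs, hc, Nat.add_sub_cancel_left] at hq
  obtain ⟨p, hp⟩ := hdvd θ hθ
  obtain ⟨r, hr⟩ := hdvd η hη
  have hpd := isHomogeneous_of_mul_left hq hq0
    (hp ▸ pull_isHomogeneous _ (app_isHomogeneous ha f))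
  have hrd := isHomogeneous_of_mul_left hq hq0
    (hr ▸ pull_isHomogeneous _ (app_isHomogeneous hb f))
  rw [Nat.sub_self, ← MvPolynomial.totalDegree_zero_iff_isHomogeneous,
    MvPolynomial.totalDegree_eq_zero_iff_eq_C] at hrd
  set c := MvPolynomial.coeff 0 r
  rw [hrd] at hr
  by_cases hc0 : c = 0
  · have hηA : η ∈ LD A := s.mem_of_dvd hη ((s.dvd_iff _).2 (by rw [hr, hc0, map_zero, mul_zero]))
    rcases hab.eq_or_lt with rfl | hab
    · refine ⟨η, linPoly f • θ, hηA, smul_mem_of_mem_delete hθ, hb, hf1 ha, ?_,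
        by omega⟩
      rw [eulerDet_smul, eulerDet_swap]
      exact mul_ne_zero hf0 (neg_ne_zero.2 h0)
    · obtain ⟨t, η', hη', hmem, hdeg⟩ := exists_eq_add_of_lt s hB hA hηA hb (by omega)
      rcases Nat.eq_zero_or_pos b with rfl | hpos
      · have hz : η = 0 := funext fun i => by
          have h1 := hb i
          rw [← MvPolynomial.totalDegree_zero_iff_isHomogeneous,
            MvPolynomial.totalDegree_eq_zero_iff_eq_C] at h1
          have h2 : MvPolynomial.constantCoeff (η i) = 0 := by
            rw [hη']
            simp [linPoly]
          rw [MvPolynomial.constantCoeff_eq] at h2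
          rw [h1, h2, map_zero, Pi.zero_apply]
        exact absurd (by simp [hz, eulerDet_eq]) h0
      · rw [hη', eulerDet_add_smul'] at h0
        have := card_le_of_eulerDet_ne_zero hθ hmem ha hdeg (right_ne_zero_of_mul h0)
        omega
  · have hc1 : MvPolynomial.C c * MvPolynomial.C c⁻¹ = (1 : MvPolynomial (Fin 2) K) := by
      rw [← map_mul, mul_inv_cancel₀ hc0, map_one]
    set T := pull s.π (MvPolynomial.C c⁻¹ * p) with hT
    have hTd : T.IsHomogeneous (a - b) := pull_isHomogeneous _ (hpd.C_mul _)
    refine ⟨θ - T • η, linPoly f • η, s.mem_of_dvd (sub_mem hθ (Submodule.smul_mem _ _ hη))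
      ((s.dvd_iff _).2 ?_), smul_mem_of_mem_delete hη, fun i => (ha i).sub ?_, hf1 hb,
      ?_, by omega⟩
    · rw [app_sub_left, app_smul_left, map_sub, map_mul, hp, hr, hT, s.pull_pull]
      linear_combination -(q * p) * hc1
    · have := smul_isHomogeneous hTd hb i
      rwa [Nat.sub_add_cancel hab] at this
    · rw [eulerDet_smul, eulerDet_sub_smul]
      exact mul_ne_zero hf0 h0

/-- The deletion theorem in dimension three. -/
lemma EulerFree.delete {A : Arrangement K 3} {f : (Fin 3 → K) →ₗ[K] K} (s : Slice 2 f)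
    {B : Arrangement K 2}
    (hB : B.hyperplanes = (A.hyperplanes.erase (LinearMap.ker f)).image fun H => H.comap s.ι)
    (hA : LinearMap.ker f ∈ A.hyperplanes) {a b : ℕ} (ha1 : 1 ≤ a) (hab : a ≤ b)
    (h : EulerFree A a (b + 1)) (hcB : B.hyperplanes.card = 1 + a) :
    EulerFree (A.delete (LinearMap.ker f)) a b := by
  obtain ⟨θ, η, hθ, hη, ha, hb, h0, hs⟩ := h
  have hcard := card_delete hA
  have hsub : LD A ≤ LD (A.delete (LinearMap.ker f)) := LD_mono (Finset.erase_subset _ _)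
  have hf0 := linPoly_ne_zero s.ne_zero
  have hresθ := s.res_mem hB hθ (hθ f s.ne_zero hA)
  have hresη := s.res_mem hB hη (hη f s.ne_zero hA)
  have hda := s.res_isHomogeneous ha
  have hdb := s.res_isHomogeneous hb
  by_cases hdet : (Matrix.of ![MvPolynomial.X, s.res θ]).det = 0
  · obtain ⟨p, hp⟩ := exists_eq_smul_X_two hdet
    obtain ⟨P, θ', hθ', hmem, hdeg⟩ := exists_eq_add_of_res s hA hθ ha hp
    have hA' := s.mem_of_lt hB hmem hdeg (by omega)
    rw [hθ', ← neg_ne_zero, ← eulerDet_swap, eulerDet_add_smul'] at h0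
    have := card_le_of_eulerDet_ne_zero hη hA' hb hdeg (right_ne_zero_of_mul h0)
    omega
  · obtain ⟨c, hc⟩ := defPoly_dvd_det (A := B) (M := Matrix.of ![MvPolynomial.X, s.res θ])
      (fun k => by fin_cases k; exacts [X_mem_LD B, hresθ])
    obtain ⟨t, ht⟩ := defPoly_dvd_det (A := B) (M := Matrix.of ![MvPolynomial.X, s.res η])
      (fun k => by fin_cases k; exacts [X_mem_LD B, hresη])
    have hQ := defPoly_isHomogeneous B
    have hQ0 := defPoly_ne_zero B
    have hcd := isHomogeneous_det (two_hom hda)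
    have htd := isHomogeneous_det (two_hom hdb)
    rw [hc] at hcd hdet
    rw [ht] at htd
    replace hcd := isHomogeneous_of_mul_left hQ hQ0 hcd
    replace htd := isHomogeneous_of_mul_left hQ hQ0 htd
    simp only [Fin.sum_univ_two, Matrix.cons_val_zero, Matrix.cons_val_one, hcB, Nat.sub_self,
      Nat.add_sub_add_left] at hcd htd
    rw [← MvPolynomial.totalDegree_zero_iff_isHomogeneous,
      MvPolynomial.totalDegree_eq_zero_iff_eq_C] at hcd
    set c₀ := MvPolynomial.coeff 0 c
    have hc0 : c₀ ≠ 0 := by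
      intro h
      rw [hcd, h, map_zero, mul_zero] at hdet
      exact hdet rfl
    have hc1 : MvPolynomial.C c₀ * MvPolynomial.C c₀⁻¹ = (1 : MvPolynomial (Fin 2) K) := by
      rw [← map_mul, mul_inv_cancel₀ hc0, map_one]
    set T := pull s.π (MvPolynomial.C c₀⁻¹ * t) with hT
    have hTθ : ∀ i, ((T • θ) i).IsHomogeneous (b + 1) := fun i => by
      have := smul_isHomogeneous (pull_isHomogeneous s.π (htd.C_mul c₀⁻¹)) ha i
      rwa [Nat.sub_add_cancel (by omega)] at this
    have hdet' : (Matrix.of ![MvPolynomial.X, s.res (η - T • θ)]).det = 0 := by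
      rw [Matrix.det_fin_two] at hc ht ⊢
      simp only [Matrix.of_apply, Matrix.cons_val_zero, Matrix.cons_val_one, s.res_sub, s.res_smul,
        Pi.sub_apply, Pi.smul_apply, smul_eq_mul, hT, s.pull_pull] at hc ht ⊢
      rw [hcd] at hc
      linear_combination ht - MvPolynomial.C c₀⁻¹ * t * hc - defPoly B * t * hc1
    obtain ⟨p, hp⟩ := exists_eq_smul_X_two hdet'
    obtain ⟨P, η', hη', hmem, hdeg⟩ := exists_eq_add_of_res s hA
      (sub_mem hη (Submodule.smul_mem _ T hθ)) (fun i => (hb i).sub (hTθ i)) hp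
    refine ⟨θ, η', hsub hθ, hmem, ha, hdeg, ?_, by omega⟩
    rw [sub_eq_iff_eq_add, add_right_comm] at hη'
    rw [hη', eulerDet_add_smul] at h0
    exact right_ne_zero_of_mul h0

end AdditionDeletion

section Counting

variable {K : Type*} [Field K]

/-- The number of classes of a relation on the entries of a list. -/
def classCount {α : Type*} (r : α → α → Bool) : List α → ℕ
  | [] => 0
  | v :: l => classCount r l + if l.any (r v) then 0 else 1

lemma card_image_eq_classCount {α β : Type*} {r : α → α → Bool} {f : α → β} {l : List α}
    (h : ∀ v ∈ l, ∀ w ∈ l, r v w = true ↔ f v = f w) :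
    (l.map f).toFinset.card = classCount r l := by
  induction l with
  | nil => rfl
  | cons v l ih =>
    rw [List.map_cons, List.toFinset_cons, Finset.card_insert_eq_ite, classCount,
      ih fun v hv w hw => h v (List.mem_cons_of_mem _ hv) w (List.mem_cons_of_mem _ hw)]
    have : f v ∈ (l.map f).toFinset ↔ l.any (r v) = true := by
      rw [List.mem_toFinset, List.mem_map, List.any_eq_true]
      refine exists_congr fun w => and_congr_right fun hw => ?_
      rw [h v List.mem_cons_self w (List.mem_cons_of_mem _ hw), eq_comm]
    by_cases h1 : f v ∈ (l.map f).toFinset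
    · rw [if_pos h1, if_pos (this.1 h1), add_zero]
    · rw [if_neg h1, if_neg fun h2 => h1 (this.2 h2)]

/-- The cross product, in coordinates. -/
def cross {R : Type*} [Add R] [Sub R] [Mul R] (u v : Fin 3 → R) : Fin 3 → R :=
  ![u 1 * v 2 - u 2 * v 1, u 2 * v 0 - u 0 * v 2, u 0 * v 1 - u 1 * v 0]

/-- The dot product, in coordinates. -/
def dot {R : Type*} [Add R] [Mul R] (u v : Fin 3 → R) : R := u 0 * v 0 + u 1 * v 1 + u 2 * v 2

lemma mem_perp {v x : Fin 3 → K} : x ∈ perp v ↔ dot v x = 0 := by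
  simp [perp, lf, dot, Fin.sum_univ_three]

lemma dot_cross_left (u v : Fin 3 → K) : dot u (cross u v) = 0 := by
  simp [dot, cross]; ring

lemma dot_cross_right (u v : Fin 3 → K) : dot v (cross u v) = 0 := by
  simp [dot, cross]; ring

lemma dot_eq_zero_of_cross {n x w : Fin 3 → K} (hn : n ≠ 0) (hx : cross x n = 0)
    (hw : dot w n = 0) : dot w x = 0 := by
  have h0 := congrFun hx 0
  have h1 := congrFun hx 1
  have h2 := congrFun hx 2
  simp [cross] at h0 h1 h2
  obtain ⟨k, hk⟩ := Function.ne_iff.1 hn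
  rw [Pi.zero_apply] at hk
  refine (mul_eq_zero.1 (?_ : n k * dot w x = 0)).resolve_left hk
  unfold dot at hw ⊢
  fin_cases k
  · simp only [Fin.zero_eta]
    linear_combination x 0 * hw + w 1 * (-h2) + w 2 * h1
  · simp only [Fin.mk_one]
    linear_combination x 1 * hw + w 0 * h2 - w 2 * h0
  · simp only [Fin.reduceFinMk]
    linear_combination x 2 * hw - w 0 * h1 + w 1 * h0

lemma cross_cross (x h v : Fin 3 → K) : cross x (cross h v) = dot x v • h - dot x h • v := by
  funext i
  fin_cases i <;> simp [cross, dot] <;> ring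

lemma dot_comm (u v : Fin 3 → K) : dot u v = dot v u := by
  simp only [dot]; ring

lemma comap_perp_le {h v w : Fin 3 → K} (hv : cross h v ≠ 0) (hd : dot w (cross h v) = 0) :
    (perp v).comap (perp h).subtype ≤ (perp w).comap (perp h).subtype := by
  rintro ⟨x, hx⟩ hxv
  rw [Submodule.mem_comap, Submodule.subtype_apply, mem_perp] at hxv ⊢
  rw [mem_perp] at hx
  refine dot_eq_zero_of_cross hv ?_ hd
  rw [cross_cross, dot_comm x v, dot_comm x h]
  simp only [hx, hxv, zero_smul, sub_zero]

lemma comap_perp_eq_iff {h v w : Fin 3 → K} (hv : cross h v ≠ 0) (hw : cross h w ≠ 0) :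
    (perp v).comap (perp h).subtype = (perp w).comap (perp h).subtype ↔
      dot w (cross h v) = 0 := by
  constructor
  · intro heq
    have hmem : cross h v ∈ perp h := mem_perp.2 (dot_cross_left h v)
    have : (⟨cross h v, hmem⟩ : perp h) ∈ (perp v).comap (perp h).subtype :=
      mem_perp.2 (dot_cross_right h v)
    rw [heq] at this
    exact mem_perp.1 this
  · intro hd
    refine le_antisymm (comap_perp_le hv hd) (comap_perp_le hw ?_)
    rw [← neg_eq_zero, ← hd]
    simp [dot, cross]; ring

lemma cross_eq_zero_of_perp_eq {v w : Fin 3 → K} (h : perp v = perp w) : cross v w = 0 := by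
  have key : ∀ e : Fin 3 → K, dot w (cross v e) = 0 := fun e => by
    rw [← mem_perp, ← h, mem_perp]
    exact dot_cross_left v e
  have h0 := key ![1, 0, 0]
  have h1 := key ![0, 1, 0]
  have h2 := key ![0, 0, 1]
  simp [dot, cross] at h0 h1 h2
  funext i
  fin_cases i <;> simp [cross]
  · linear_combination -h0
  · linear_combination -h1
  · linear_combination -h2

lemma perp_eq_of_cross {v w : Fin 3 → K} (hv : v ≠ 0) (hw : w ≠ 0) (h : cross v w = 0) :
    perp v = perp w := by
  have h' : cross w v = 0 := by
    rw [← neg_zero, ← h]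
    funext i
    fin_cases i <;> simp [cross] <;> ring
  ext x
  rw [mem_perp, mem_perp, dot_comm v, dot_comm w]
  exact ⟨dot_eq_zero_of_cross hv h', dot_eq_zero_of_cross hw h⟩

lemma mem_erase_perp_iff {α : Type*} {A : Finset (Submodule K (Fin 3 → K))} {h : Fin 3 → K}
    {N : α → Fin 3 → K} {l : List α} (hc : ∀ v ∈ l, cross h (N v) ≠ 0)
    (hA : ∀ H, H ∈ A ↔ H = perp h ∨ ∃ v ∈ l, perp (N v) = H) (H : Submodule K (Fin 3 → K)) :
    H ∈ A.erase (perp h) ↔ ∃ v ∈ l, perp (N v) = H := by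
  rw [Finset.mem_erase, hA]
  constructor
  · rintro ⟨hne, rfl | h'⟩
    exacts [absurd rfl hne, h']
  · rintro ⟨v, hv, rfl⟩
    exact ⟨fun he => hc v hv (cross_eq_zero_of_perp_eq he.symm), .inr ⟨v, hv, rfl⟩⟩

lemma card_restriction {α : Type*} {A : Arrangement K 3} {h : Fin 3 → K} {N : α → Fin 3 → K}
    {r : α → α → Bool} {l : List α}
    (hl : ∀ H, H ∈ A.hyperplanes.erase (perp h) ↔ ∃ v ∈ l, perp (N v) = H)
    (hc : ∀ v ∈ l, cross h (N v) ≠ 0)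
    (hr : ∀ v ∈ l, ∀ w ∈ l, r v w = true ↔ dot (N w) (cross h (N v)) = 0) :
    ((A.hyperplanes.erase (perp h)).image fun H => H.comap (perp h).subtype).card =
      classCount r l := by
  rw [← card_image_eq_classCount (f := fun v => (perp (N v)).comap (perp h).subtype)
    fun v hv w hw => (hr v hv w hw).trans (comap_perp_eq_iff (hc v hv) (hc w hw)).symm]
  congr 1
  ext X
  simp only [Finset.mem_image, hl, List.mem_toFinset, List.mem_map]
  constructor
  · rintro ⟨_, ⟨v, hv, rfl⟩, rfl⟩
    exact ⟨v, hv, rfl⟩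
  · rintro ⟨v, hv, rfl⟩
    exact ⟨_, ⟨v, hv, rfl⟩, rfl⟩

end Counting

section Chains

variable {K : Type*} [Field K]

/-- Recursively free with exponents `1, a, b`. -/
def RecFree (A : Arrangement K 3) (a b : ℕ) : Prop := RecursivelyFree K A ∧ EulerFree A a b

lemma perp_mem {A : Arrangement K 3} {h : Fin 3 → K} (hA : perp h ∈ A.hyperplanes) : lf h ≠ 0 := by
  obtain ⟨f, hf, he⟩ := A.isHyp _ hA
  intro h0
  rw [perp, h0, LinearMap.ker_zero] at he
  exact hf (LinearMap.ker_eq_top.1 he.symm)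

lemma exists_restriction_data {A : Arrangement K 3} {h : Fin 3 → K} (hA : perp h ∈ A.hyperplanes)
    {a : ℕ} (hc : ((A.hyperplanes.erase (perp h)).image
      fun H => H.comap (perp h).subtype).card = 1 + a) :
    ∃ (B : Arrangement K 2) (s : Slice 2 (lf h)), IsRestriction A (perp h) B ∧
      B.hyperplanes = (A.hyperplanes.erase (perp h)).image (fun H => H.comap s.ι) ∧
      B.hyperplanes.card = 1 + a ∧ HasExponents B {1, a} := by
  obtain ⟨B, hB⟩ := exists_isRestriction hA
  obtain ⟨s, hs⟩ := hB.exists_slice (perp_mem hA)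
  have hcard := (card_of_isRestriction hB).trans hc
  refine ⟨B, s, hB, hs, hcard, ?_⟩
  have := (saito_two (A := B) (Finset.card_pos.1 (by omega))).hasExponents
  rwa [hcard, Nat.add_sub_cancel_left] at this

lemma pair_le (a b : ℕ) : ({1, a} : Multiset ℕ) ≤ Finset.univ.val.map ![1, a, b] := by
  rw [univ_map_three]
  exact Multiset.cons_le_cons _ (Multiset.singleton_le.2 (by simp))

lemma RecFree.of_delete {A : Arrangement K 3} {h : Fin 3 → K} (hA : perp h ∈ A.hyperplanes)
    {a b : ℕ} (hd : RecFree (A.delete (perp h)) a b)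
    (hc : ((A.hyperplanes.erase (perp h)).image fun H => H.comap (perp h).subtype).card = 1 + a) :
    RecFree A a (b + 1) := by
  obtain ⟨B, s, hB, hs, hcard, he⟩ := exists_restriction_data hA hc
  exact ⟨.add A _ hA B hB _ _ hd.1 (recursivelyFree_two B) hd.2.saito.hasExponents he
    (pair_le a b), hd.2.of_delete s hs hA hcard⟩

lemma RecFree.delete {A : Arrangement K 3} {h : Fin 3 → K} (hA : perp h ∈ A.hyperplanes)
    {a b : ℕ} (ha : 1 ≤ a) (hab : a ≤ b) (hd : RecFree A a (b + 1))
    (hc : ((A.hyperplanes.erase (perp h)).image fun H => H.comap (perp h).subtype).card = 1 + a) :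
    RecFree (A.delete (perp h)) a b := by
  obtain ⟨B, s, hB, hs, hcard, he⟩ := exists_restriction_data hA hc
  exact ⟨.del A _ hA B hB _ _ hd.1 (recursivelyFree_two B) hd.2.saito.hasExponents he
    (pair_le a (b + 1)), hd.2.delete s hs hA ha hab hcard⟩

lemma RecFree.swap {A : Arrangement K 3} {a b : ℕ} (h : RecFree A a b) : RecFree A b a :=
  ⟨h.1, h.2.swap⟩

lemma recFree_singleton {A : Arrangement K 3} {c : K} (hA : A.hyperplanes = {perp ![1, c, 0]}) :
    RecFree A 0 0 := by
  have hmem : perp ![1, c, 0] ∈ A.hyperplanes := by rw [hA]; exact Finset.mem_singleton_self _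
  have hdel : A.delete (perp ![1, c, 0]) = emptyArr K 3 := eq_emptyArr (by
    change A.hyperplanes.erase _ = ∅
    rw [hA, Finset.erase_singleton])
  obtain ⟨B, hB⟩ := exists_isRestriction hmem
  have hB0 : B = emptyArr K 2 := eq_emptyArr (by
    obtain ⟨e, he⟩ := hB
    rw [he, hA, Finset.erase_singleton, Finset.image_empty])
  constructor
  · refine .add A _ hmem B hB _ _ (by rw [hdel]; exact .empty 3) (recursivelyFree_two B)
      (by rw [hdel]; exact saito_emptyArr.hasExponents)
      (by rw [hB0]; exact saito_emptyArr.hasExponents) ?_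
    rw [univ_map_two, univ_map_three]
    exact Multiset.cons_le_cons _ (Multiset.cons_le_cons _ (Multiset.zero_le _))
  · refine ⟨fun i => MvPolynomial.C (![-c, 1, 0] i), fun i => MvPolynomial.C (![0, 0, 1] i),
      ?_, ?_, fun i => MvPolynomial.isHomogeneous_C _ _, fun i => MvPolynomial.isHomogeneous_C _ _,
      ?_, by rw [hA]; rfl⟩
    · refine mem_LD_of_forall fun H hH => ⟨lf ![1, c, 0], perp_mem hmem, ?_, ?_⟩
      · rw [hA, Finset.mem_singleton] at hH
        exact hH.symm
      · simp [app, lf_single, Fin.sum_univ_three, MvPolynomial.smul_eq_C_mul]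
    · refine mem_LD_of_forall fun H hH => ⟨lf ![1, c, 0], perp_mem hmem, ?_, ?_⟩
      · rw [hA, Finset.mem_singleton] at hH
        exact hH.symm
      · simp [app, lf_single, Fin.sum_univ_three, MvPolynomial.smul_eq_C_mul]
    intro h
    have h1 := congrArg (MvPolynomial.eval ![1, 0, 0]) h
    rw [eulerDet_eq] at h1
    simp at h1

lemma exists_cons_perp_iff {α : Type*} {N : α → Fin 3 → K} {v : α} {l : List α}
    {H : Submodule K (Fin 3 → K)} : (∃ u ∈ v :: l, perp (N u) = H) ↔
      H = perp (N v) ∨ ∃ u ∈ l, perp (N u) = H := by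
  rw [List.exists_mem_cons_iff, eq_comm]

end Chains

section FiniteField

lemma mem_mkArr_map {K α : Type*} [Field K] {n : ℕ} [DecidableEq (Fin n → K)]
    {N : α → Fin n → K} {l : List α} (h : (0 : Fin n → K) ∉ (l.map N).toFinset)
    (H : Submodule K (Fin n → K)) :
    H ∈ (mkArr (l.map N).toFinset h).hyperplanes ↔ ∃ u ∈ l, perp (N u) = H := by
  rw [mkArr, Finset.mem_image]
  simp_rw [List.mem_toFinset]
  constructor
  · rintro ⟨_, hw, rfl⟩
    obtain ⟨u, hu, rfl⟩ := List.mem_map.1 hw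
    exact ⟨u, hu, rfl⟩
  · rintro ⟨u, hu, rfl⟩
    exact ⟨_, List.mem_map_of_mem hu, rfl⟩

/-- The vector over `ZMod p` with the given natural number representatives. -/
def natVec (p : ℕ) (v : ℕ × ℕ × ℕ) : Fin 3 → ZMod p := ![v.1, v.2.1, v.2.2]

/-- Vanishing modulo `p` of the determinant of three vectors. -/
def coplanarMod (p : ℕ) (h v w : ℕ × ℕ × ℕ) : Bool :=
  Nat.beq
    (Nat.mod (Nat.add (Nat.mul w.1 (Nat.mul h.2.1 v.2.2))
      (Nat.add (Nat.mul w.2.1 (Nat.mul h.2.2 v.1)) (Nat.mul w.2.2 (Nat.mul h.1 v.2.1)))) p)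
    (Nat.mod (Nat.add (Nat.mul w.1 (Nat.mul h.2.2 v.2.1))
      (Nat.add (Nat.mul w.2.1 (Nat.mul h.1 v.2.2)) (Nat.mul w.2.2 (Nat.mul h.2.1 v.1)))) p)

/-- Non-vanishing modulo `p` of the cross product of two vectors. -/
def independentMod (p : ℕ) (h v : ℕ × ℕ × ℕ) : Bool :=
  !((h.2.1 * v.2.2) % p == (h.2.2 * v.2.1) % p && (h.2.2 * v.1) % p == (h.1 * v.2.2) % p &&
    (h.1 * v.2.1) % p == (h.2.1 * v.1) % p)

lemma coplanarMod_iff {p : ℕ} {h v w : ℕ × ℕ × ℕ} : coplanarMod p h v w = true ↔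
    dot (natVec p w) (cross (natVec p h) (natVec p v)) = 0 := by
  rw [coplanarMod, Nat.beq_eq]
  change (w.1 * (h.2.1 * v.2.2) + (w.2.1 * (h.2.2 * v.1) + w.2.2 * (h.1 * v.2.1))) % p =
    (w.1 * (h.2.2 * v.2.1) + (w.2.1 * (h.1 * v.2.2) + w.2.2 * (h.2.1 * v.1))) % p ↔ _
  rw [← ZMod.natCast_eq_natCast_iff', ← sub_eq_zero]
  push_cast
  simp only [dot, cross, natVec, Matrix.cons_val]
  exact Eq.congr (by ring) rfl

lemma cross_ne_zero_of_independentMod {p : ℕ} {h v : ℕ × ℕ × ℕ}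
    (hi : independentMod p h v = true) : cross (natVec p h) (natVec p v) ≠ 0 := by
  intro h0
  have e0 := congrFun h0 0
  have e1 := congrFun h0 1
  have e2 := congrFun h0 2
  simp only [cross, natVec, Matrix.cons_val, Pi.zero_apply, sub_eq_zero] at e0 e1 e2
  norm_cast at e0 e1 e2
  rw [ZMod.natCast_eq_natCast_iff'] at e0 e1 e2
  simp [independentMod, e0, e1, e2] at hi

/-- The last two exponents obtained by adding hyperplanes one at a time. -/
def chainExps : List (ℕ × ℕ × ℕ) → Option (ℕ × ℕ)
  | [] => none
  | [v] => if v.1 = 1 ∧ v.2.2 = 0 then some (0, 0) else none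
  | v :: w :: l =>
    match chainExps (w :: l) with
    | none => none
    | some (a, b) =>
      if (w :: l).all (independentMod 11 v) then
        if classCount (coplanarMod 11 v) (w :: l) = 1 + a then some (a, b + 1)
        else if classCount (coplanarMod 11 v) (w :: l) = 1 + b then some (a + 1, b) else none
      else none

lemma recFree_of_chainExps {l : List (ℕ × ℕ × ℕ)} : ∀ {a b : ℕ}, chainExps l = some (a, b) →
    ∀ {A : Arrangement (ZMod 11) 3}, (∀ H, H ∈ A.hyperplanes ↔ ∃ v ∈ l, perp (natVec 11 v) = H) →
      RecFree A a b := by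
  induction l with
  | nil => exact fun h => by simp [chainExps] at h
  | cons v l ih =>
    intro a b h A hA
    cases l with
    | nil =>
      rw [chainExps] at h
      split_ifs at h with hv
      obtain ⟨rfl, rfl⟩ : 0 = a ∧ 0 = b := by simpa using h
      refine recFree_singleton (c := natVec 11 v 1) (Finset.ext fun H => ?_)
      have : natVec 11 v = ![1, natVec 11 v 1, 0] := by
        funext i; fin_cases i <;> simp [natVec, hv]
      rw [hA, Finset.mem_singleton, ← this]
      simp [eq_comm]
    | cons w l =>
      rw [chainExps] at h
      rcases hl : chainExps (w :: l) with _ | ⟨a', b'⟩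
      · simp [hl] at h
      simp only [hl] at h
      have hv : perp (natVec 11 v) ∈ A.hyperplanes := (hA _).2 ⟨v, List.mem_cons_self, rfl⟩
      split_ifs at h with hfresh h1 h2
      all_goals
        replace hfresh : ∀ u ∈ w :: l, cross (natVec 11 v) (natVec 11 u) ≠ 0 := fun u hu =>
          cross_ne_zero_of_independentMod (List.all_eq_true.1 hfresh u hu)
        have hl' : ∀ H, H ∈ A.hyperplanes.erase (perp (natVec 11 v)) ↔
            ∃ u ∈ w :: l, perp (natVec 11 u) = H := by
          refine mem_erase_perp_iff hfresh fun H => ?_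
          rw [hA, exists_cons_perp_iff]
        have hcard := card_restriction (r := coplanarMod 11 v) (N := natVec 11) hl' hfresh
          fun u _ u' _ => coplanarMod_iff
        have hd := ih hl (A := A.delete (perp (natVec 11 v))) hl'
      · obtain ⟨rfl, rfl⟩ : a' = a ∧ b' + 1 = b := by simpa using h
        exact hd.of_delete hv (hcard.trans h1)
      · obtain ⟨rfl, rfl⟩ : a' + 1 = a ∧ b' = b := by simpa using h
        exact (hd.swap.of_delete hv (hcard.trans h2)).swap

/-- Removing the hyperplanes of the first list one at a time keeps the arrangement free. -/
def deletionChain (a : ℕ) : List (ℕ × ℕ × ℕ) → List (ℕ × ℕ × ℕ) → Bool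
  | [], _ => true
  | v :: s, l => (s ++ l).all (independentMod 11 v) &&
      (classCount (coplanarMod 11 v) (s ++ l) = 1 + a) && deletionChain a s l

lemma recFree_of_deletionChain {a b : ℕ} (ha : 1 ≤ a) (hab : a ≤ b) {l : List (ℕ × ℕ × ℕ)} :
    ∀ {s : List (ℕ × ℕ × ℕ)}, deletionChain a s l = true → (∀ v ∈ s ++ l, natVec 11 v ≠ 0) →
    (∀ {A : Arrangement (ZMod 11) 3}, (∀ H, H ∈ A.hyperplanes ↔ ∃ v ∈ s ++ l,
      perp (natVec 11 v) = H) → RecFree A a (b + s.length)) →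
    ∀ {A : Arrangement (ZMod 11) 3}, (∀ H, H ∈ A.hyperplanes ↔ ∃ v ∈ l, perp (natVec 11 v) = H) →
      RecFree A a b := by
  intro s
  induction s with
  | nil => exact fun _ _ h => h
  | cons v s ih =>
    intro hs h0 h A₀ hA₀
    simp only [deletionChain, Bool.and_eq_true, List.all_eq_true, decide_eq_true_eq] at hs
    obtain ⟨⟨hfresh, hcount⟩, hs⟩ := hs
    have hfresh' : ∀ u ∈ s ++ l, cross (natVec 11 v) (natVec 11 u) ≠ 0 := fun u hu =>
      cross_ne_zero_of_independentMod (hfresh u hu)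
    refine ih hs (fun u hu => h0 u (List.mem_cons_of_mem _ hu)) (fun {A} hA => ?_) hA₀
    let A' : Arrangement (ZMod 11) 3 := mkArr ((v :: (s ++ l)).map (natVec 11)).toFinset
      fun h00 => by
        obtain ⟨u, hu, hu0⟩ := List.mem_map.1 (List.mem_toFinset.1 h00)
        exact h0 u hu hu0
    have hA' : ∀ H, H ∈ A'.hyperplanes ↔ ∃ u ∈ v :: s ++ l, perp (natVec 11 u) = H := fun H =>
      mem_mkArr_map _ H
    have hl : ∀ H, H ∈ A'.hyperplanes.erase (perp (natVec 11 v)) ↔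
        ∃ u ∈ s ++ l, perp (natVec 11 u) = H := by
      refine mem_erase_perp_iff hfresh' fun H => ?_
      rw [hA', List.cons_append, exists_cons_perp_iff]
    have hcard := card_restriction (r := coplanarMod 11 v) (N := natVec 11) hl hfresh'
      fun u _ u' _ => coplanarMod_iff
    have hd := (h hA').delete ((hA' _).2 ⟨v, List.mem_cons_self, rfl⟩) ha
      (hab.trans (Nat.le_add_right _ _)) (hcard.trans hcount)
    have hAA : A = A'.delete (perp (natVec 11 v)) :=
      Arrangement.ext_hyperplanes (Finset.ext fun H => (hA H).trans (hl H).symm)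
    rw [hAA]
    exact hd

/-- Representatives of the normal vectors of `B`. -/
def normals : List (ℕ × ℕ × ℕ) :=
  [(1, 2, 2), (1, 4, 3), (0, 0, 1), (1, 6, 4), (1, 9, 0), (1, 4, 4), (1, 8, 5), (1, 6, 6),
   (1, 0, 1), (1, 9, 9), (0, 1, 6), (1, 8, 8), (1, 0, 0), (1, 9, 5), (0, 1, 1), (1, 9, 1),
   (1, 9, 4), (0, 1, 2), (1, 9, 8), (0, 1, 3), (0, 1, 5), (1, 3, 1), (0, 1, 4), (1, 10, 0),
   (1, 3, 10), (1, 10, 5), (1, 5, 7)]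

/-- The normal vectors of the hyperplanes to be added to `B` and deleted again. -/
def extraNormals : List (ℕ × ℕ × ℕ) :=
  [(1, 7, 0), (1, 5, 0), (1, 4, 0), (1, 3, 0), (1, 2, 0), (1, 1, 0), (0, 1, 0)]

/-- An ordering in which the arrangement of all the normal vectors is built, last vector first. -/
def chainNormals : List (ℕ × ℕ × ℕ) :=
  [(1, 4, 3), (1, 3, 10), (1, 5, 7), (1, 10, 5), (1, 9, 5), (1, 0, 1), (1, 9, 4),
   (1, 8, 8), (1, 9, 9), (1, 9, 1), (1, 6, 6), (0, 0, 1), (0, 1, 5), (1, 3, 1),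
   (0, 1, 6), (1, 9, 8), (0, 1, 2), (1, 4, 4), (1, 8, 5), (0, 1, 3), (1, 1, 0),
   (1, 6, 4), (0, 1, 1), (1, 10, 0), (1, 3, 0), (0, 1, 0), (1, 4, 0), (1, 2, 2),
   (1, 7, 0), (0, 1, 4), (1, 0, 0), (1, 9, 0), (1, 5, 0), (1, 2, 0)]

lemma chainExps_chainNormals : chainExps chainNormals = some (11, 22) := by decide +kernel

lemma deletionChain_extraNormals : deletionChain 11 extraNormals normals = true := by
  decide +kernel

lemma chainNormals_perm : chainNormals.Perm (extraNormals ++ normals) := by decide +kernel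

lemma natVec_ne_zero : ∀ v ∈ extraNormals ++ normals, natVec 11 v ≠ 0 := by decide +kernel

lemma map_normals_perm : (normals.map (natVec 11)).Perm Bvecs := by decide +kernel

lemma recFree_of_normals {A : Arrangement (ZMod 11) 3}
    (hA : ∀ H, H ∈ A.hyperplanes ↔ ∃ v ∈ normals, perp (natVec 11 v) = H) : RecFree A 11 15 := by
  refine recFree_of_deletionChain (by norm_num) (by norm_num) deletionChain_extraNormals
    natVec_ne_zero (fun {A'} hA' => ?_) hA
  refine recFree_of_chainExps chainExps_chainNormals fun H => (hA' H).trans ?_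
  simp only [chainNormals_perm.mem_iff]

lemma mem_mkArr_Bvecs (h : (0 : Fin 3 → ZMod 11) ∉ Bvecs.toFinset)
    (H : Submodule (ZMod 11) (Fin 3 → ZMod 11)) :
    H ∈ (mkArr Bvecs.toFinset h).hyperplanes ↔ ∃ v ∈ normals, perp (natVec 11 v) = H := by
  have hperm := List.toFinset_eq_of_perm _ _ map_normals_perm
  rw [← mem_mkArr_map (hperm ▸ h)]
  simp only [mkArr, hperm]

end FiniteField

section Cyclotomic

/-- An element `c0 + c1 ζ + c2 ζ² + c3 ζ³` of the ring of integers of the fifth cyclotomic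
field. -/
@[ext]
structure CycInt where
  c0 : ℤ
  c1 : ℤ
  c2 : ℤ
  c3 : ℤ

namespace CycInt

instance : DecidableEq CycInt := fun _ _ => decidable_of_iff _ CycInt.ext_iff.symm

instance : Zero CycInt := ⟨⟨0, 0, 0, 0⟩⟩

instance : Add CycInt := ⟨fun a b => ⟨a.c0 + b.c0, a.c1 + b.c1, a.c2 + b.c2, a.c3 + b.c3⟩⟩

instance : Sub CycInt := ⟨fun a b => ⟨a.c0 - b.c0, a.c1 - b.c1, a.c2 - b.c2, a.c3 - b.c3⟩⟩

instance : Mul CycInt := ⟨fun a b =>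
  let d := a.c1 * b.c3 + a.c2 * b.c2 + a.c3 * b.c1
  ⟨a.c0 * b.c0 + (a.c2 * b.c3 + a.c3 * b.c2) - d,
    a.c0 * b.c1 + a.c1 * b.c0 + a.c3 * b.c3 - d,
    a.c0 * b.c2 + a.c1 * b.c1 + a.c2 * b.c0 - d,
    a.c0 * b.c3 + a.c1 * b.c2 + a.c2 * b.c1 + a.c3 * b.c0 - d⟩⟩

/-- The value at `z`, a fifth root of unity. -/
def eval {R : Type*} [CommRing R] (z : R) (a : CycInt) : R :=
  a.c0 + a.c1 * z + a.c2 * z ^ 2 + a.c3 * z ^ 3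

variable {R : Type*} [CommRing R] {z : R}

lemma eval_zero : eval z 0 = 0 := by
  change ((0 : ℤ) : R) + (0 : ℤ) * z + (0 : ℤ) * z ^ 2 + (0 : ℤ) * z ^ 3 = 0
  simp

lemma eval_add (a b : CycInt) : eval z (a + b) = eval z a + eval z b := by
  change (((a.c0 + b.c0 : ℤ) : R)) + (a.c1 + b.c1 : ℤ) * z + (a.c2 + b.c2 : ℤ) * z ^ 2 +
    (a.c3 + b.c3 : ℤ) * z ^ 3 = _
  simp only [eval]
  push_cast
  ring

lemma eval_sub (a b : CycInt) : eval z (a - b) = eval z a - eval z b := by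
  change (((a.c0 - b.c0 : ℤ) : R)) + (a.c1 - b.c1 : ℤ) * z + (a.c2 - b.c2 : ℤ) * z ^ 2 +
    (a.c3 - b.c3 : ℤ) * z ^ 3 = _
  simp only [eval]
  push_cast
  ring

lemma eval_mul (hz : 1 + z + z ^ 2 + z ^ 3 + z ^ 4 = 0) (a b : CycInt) :
    eval z (a * b) = eval z a * eval z b := by
  have h : ∀ d : ℤ, eval z (a * b) = (eval z (a * b) + d * (1 + z + z ^ 2 + z ^ 3 + z ^ 4)) := by
    simp [hz]
  rw [h (a.c1 * b.c3 + a.c2 * b.c2 + a.c3 * b.c1)]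
  change (((a.c0 * b.c0 + (a.c2 * b.c3 + a.c3 * b.c2) -
      (a.c1 * b.c3 + a.c2 * b.c2 + a.c3 * b.c1) : ℤ) : R)) +
    (a.c0 * b.c1 + a.c1 * b.c0 + a.c3 * b.c3 -
      (a.c1 * b.c3 + a.c2 * b.c2 + a.c3 * b.c1) : ℤ) * z +
    (a.c0 * b.c2 + a.c1 * b.c1 + a.c2 * b.c0 -
      (a.c1 * b.c3 + a.c2 * b.c2 + a.c3 * b.c1) : ℤ) * z ^ 2 +
    (a.c0 * b.c3 + a.c1 * b.c2 + a.c2 * b.c1 + a.c3 * b.c0 -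
      (a.c1 * b.c3 + a.c2 * b.c2 + a.c3 * b.c1) : ℤ) * z ^ 3 + _ = _
  simp only [eval]
  push_cast
  linear_combination (-(a.c2 * b.c3 + a.c3 * b.c2 + a.c3 * b.c3 * z) * (z - 1) : R) * hz

lemma one_add_eq_zero {ζ : ℂ} (hζ : IsPrimitiveRoot ζ 5) : 1 + ζ + ζ ^ 2 + ζ ^ 3 + ζ ^ 4 = 0 := by
  have := hζ.geom_sum_eq_zero (by norm_num)
  simpa [Finset.sum_range_succ] using this

open Polynomial in
lemma eq_zero_of_eval {ζ : ℂ} (hζ : IsPrimitiveRoot ζ 5) {a : CycInt} (h : eval ζ a = 0) :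
    a = 0 := by
  set P : ℤ[X] := C a.c0 + C a.c1 * X + C a.c2 * X ^ 2 + C a.c3 * X ^ 3 with hP
  have hPζ : aeval ζ P = 0 := by simpa [hP, eval] using h
  have hdvd : cyclotomic 5 ℤ ∣ P := by
    rw [cyclotomic_eq_minpoly hζ (by norm_num)]
    exact minpoly.isIntegrallyClosed_dvd (hζ.isIntegral (by norm_num)) hPζ
  have hP0 : P = 0 := by
    refine eq_zero_of_dvd_of_natDegree_lt hdvd ?_
    rw [natDegree_cyclotomic, Nat.totient_prime (by norm_num), hP]
    exact Nat.lt_of_le_of_lt (by compute_degree) (by norm_num : 3 < 4)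
  have hc : ∀ n, P.coeff n = 0 := fun n => by rw [hP0, coeff_zero]
  have h0 := hc 0
  have h1 := hc 1
  have h2 := hc 2
  have h3 := hc 3
  simp [hP, coeff_X, coeff_C, coeff_X_pow, -eq_intCast] at h0 h1 h2 h3
  exact CycInt.ext h0 h1 h2 h3

/-- Evaluation of a vector. -/
def evalVec (z : R) (v : Fin 3 → CycInt) : Fin 3 → R := fun i => eval z (v i)

lemma evalVec_zero : evalVec z 0 = 0 := funext fun _ => eval_zero

lemma evalVec_cross (hz : 1 + z + z ^ 2 + z ^ 3 + z ^ 4 = 0) (u v : Fin 3 → CycInt) :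
    evalVec z (cross u v) = cross (evalVec z u) (evalVec z v) := by
  funext i
  fin_cases i <;> simp [evalVec, cross, eval_sub, eval_mul hz]

lemma eval_dot (hz : 1 + z + z ^ 2 + z ^ 3 + z ^ 4 = 0) (u v : Fin 3 → CycInt) :
    eval z (dot u v) = dot (evalVec z u) (evalVec z v) := by
  simp [evalVec, dot, eval_add, eval_mul hz]

lemma evalVec_eq_zero {ζ : ℂ} (hζ : IsPrimitiveRoot ζ 5) {v : Fin 3 → CycInt}
    (h : evalVec ζ v = 0) : v = 0 := funext fun i => eq_zero_of_eval hζ (congrFun h i)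

end CycInt

end Cyclotomic

section Configuration

/-- Normal vectors of the hyperplanes of the complex arrangement. -/
def cycNormals : List (Fin 3 → CycInt) :=
  [![⟨1, 0, 0, 0⟩, ⟨0, 0, 0, 0⟩, ⟨0, 0, 0, 0⟩], ![⟨0, 0, 0, 0⟩, ⟨1, 0, 0, 0⟩, ⟨0, 0, 0, 0⟩],
   ![⟨0, 0, 0, 0⟩, ⟨0, 0, 0, 0⟩, ⟨1, 0, 0, 0⟩], ![⟨1, 0, 0, 0⟩, ⟨0, 0, -1, 0⟩, ⟨0, 0, 0, 0⟩],
   ![⟨1, 0, 0, 0⟩, ⟨0, 0, -1, -1⟩, ⟨0, 0, 0, 0⟩], ![⟨0, 0, 0, 0⟩, ⟨1, 0, 0, 0⟩, ⟨1, 0, 0, 0⟩],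
   ![⟨0, 0, -1, -1⟩, ⟨1, 0, 0, 0⟩, ⟨0, 0, 0, 0⟩], ![⟨1, 0, 0, 0⟩, ⟨0, 0, -1, 0⟩, ⟨0, 0, -1, 0⟩],
   ![⟨-1, -1, -1, -1⟩, ⟨0, 0, -1, 0⟩, ⟨0, 0, 0, 0⟩],
   ![⟨1, 0, 0, 0⟩, ⟨0, 0, -1, -1⟩, ⟨0, 0, -1, -1⟩], ![⟨0, 0, -1, -1⟩, ⟨0, 0, -1, -1⟩, ⟨0, 0, 0, 0⟩],
   ![⟨0, 0, -1, -1⟩, ⟨1, 0, 0, 0⟩, ⟨1, 0, 0, 0⟩], ![⟨-1, -1, -1, -1⟩, ⟨0, 0, -1, 0⟩, ⟨0, 0, -1, 0⟩],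
   ![⟨1, 0, 0, 0⟩, ⟨0, 0, -1, -1⟩, ⟨0, 0, -1, 0⟩],
   ![⟨0, 0, -1, -1⟩, ⟨0, 0, -1, -1⟩, ⟨0, 0, -1, -1⟩],
   ![⟨0, 0, -1, -1⟩, ⟨1, 0, -1, -1⟩, ⟨1, 0, 0, 0⟩],
   ![⟨-1, -1, -1, -1⟩, ⟨0, -1, -1, 0⟩, ⟨0, 0, -1, 0⟩],
   ![⟨0, 0, -1, -1⟩, ⟨0, 0, -1, -1⟩, ⟨0, 0, -1, 0⟩],
   ![⟨0, 0, -1, -1⟩, ⟨1, 0, -1, -1⟩, ⟨0, 0, -1, -1⟩],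
   ![⟨1, 0, -1, -1⟩, ⟨1, 0, -1, -1⟩, ⟨1, 0, 0, 0⟩],
   ![⟨0, -1, -1, 0⟩, ⟨0, -1, -1, 0⟩, ⟨0, 0, -1, 0⟩],
   ![⟨0, 0, -1, -1⟩, ⟨1, 0, -1, 0⟩, ⟨0, 0, -1, 0⟩],
   ![⟨1, 0, -1, -1⟩, ⟨1, 0, -1, -1⟩, ⟨0, 0, -1, -1⟩],
   ![⟨0, -1, -1, 0⟩, ⟨-1, -1, -2, -1⟩, ⟨0, 0, -1, 0⟩],
   ![⟨0, 0, -1, -1⟩, ⟨1, 0, -1, 0⟩, ⟨1, 0, 0, 0⟩], ![⟨0, -1, -1, -1⟩, ⟨1, 0, -1, 0⟩, ⟨0, 0, -1, 0⟩],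
   ![⟨1, 0, -1, -1⟩, ⟨0, 0, -2, -2⟩, ⟨0, 0, -1, -1⟩]]

/-- The reductions modulo 31 of the entries of `cycNormals`, for `ζ ↦ 2`. -/
def redNormals : List (ℕ × ℕ × ℕ) :=
  [(1, 0, 0), (0, 1, 0), (0, 0, 1), (1, 27, 0), (1, 19, 0), (0, 1, 1), (19, 1, 0), (1, 27, 27),
   (16, 27, 0), (1, 19, 19), (19, 19, 0), (19, 1, 1), (16, 27, 27), (1, 19, 27), (19, 19, 19),
   (19, 20, 1), (16, 25, 27), (19, 19, 27), (19, 20, 19), (20, 20, 1), (25, 25, 27), (19, 28, 27),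
   (20, 20, 19), (25, 12, 27), (19, 28, 1), (17, 28, 27), (20, 7, 19)]

/-- The entries of `cycNormals`. -/
def cycNormal (i : Fin 27) : Fin 3 → CycInt := cycNormals.get i

/-- The entries of `redNormals`. -/
def redNormal (i : Fin 27) : ℕ × ℕ × ℕ := redNormals.get i

/-- The entries of `normals`. -/
def normal (i : Fin 27) : ℕ × ℕ × ℕ := normals.get i

lemma exists_normal_iff {P : ℕ × ℕ × ℕ → Prop} : (∃ v ∈ normals, P v) ↔ ∃ i, P (normal i) := by
  constructor
  · rintro ⟨v, hv, h⟩
    obtain ⟨i, rfl⟩ := List.mem_iff_get.1 hv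
    exact ⟨i, h⟩
  · rintro ⟨i, h⟩
    exact ⟨_, List.get_mem _ _, h⟩

lemma evalVec_cycNormal : ∀ i, CycInt.evalVec (2 : ZMod 31) (cycNormal i) =
    natVec 31 (redNormal i) := by decide +kernel

lemma two_root : (1 : ZMod 31) + 2 + 2 ^ 2 + 2 ^ 3 + 2 ^ 4 = 0 := by decide

/-- The increasing triples of entries of a list satisfy a property. -/
def allTriples {α : Type*} (q : α → α → α → Bool) : List α → Bool
  | [] => true
  | a :: l => allPairs (q a) l && allTriples q l
where
  /-- The increasing pairs of entries of a list satisfy a property. -/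
  allPairs (r : α → α → Bool) : List α → Bool
  | [] => true
  | a :: l => l.all (r a) && allPairs r l

lemma allPairs_spec {α : Type*} {r : α → α → Bool} {l : List α}
    (h : allTriples.allPairs r l = true) : l.Pairwise fun a b => r a b = true := by
  induction l with
  | nil => exact .nil
  | cons a l ih =>
    rw [allTriples.allPairs, Bool.and_eq_true, List.all_eq_true] at h
    exact .cons h.1 (ih h.2)

lemma allTriples_spec {α : Type*} {q : α → α → α → Bool} {l : List α}
    (h : allTriples q l = true) {i j k : ℕ} (hij : i < j) (hjk : j < k) (hk : k < l.length) :
    q l[i] l[j] l[k] = true := by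
  induction l generalizing i j k with
  | nil => simp at hk
  | cons a l ih =>
    rw [allTriples, Bool.and_eq_true] at h
    obtain ⟨j, rfl⟩ := Nat.exists_eq_succ_of_ne_zero (Nat.ne_zero_of_lt hij)
    obtain ⟨k, rfl⟩ := Nat.exists_eq_succ_of_ne_zero (Nat.ne_zero_of_lt hjk)
    rw [List.length_cons] at hk
    cases i with
    | zero =>
      exact List.pairwise_iff_getElem.1 (allPairs_spec h.1) j k (by omega) (by omega) (by omega)
    | succ i => exact ih h.2 (by omega) (by omega) (by omega)

lemma allTriples_normals : allTriples
    (fun u v w => (coplanarMod 31 u.2.1 v.2.1 w.2.1 == coplanarMod 11 u.2.2 v.2.2 w.2.2) &&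
      (!coplanarMod 31 u.2.1 v.2.1 w.2.1 || decide (dot w.1 (cross u.1 v.1) = 0)))
    (cycNormals.zip (redNormals.zip normals)) = true := by decide +kernel

lemma coplanarMod_redNormal {i j k : Fin 27} (hij : i < j) (hjk : j < k) :
    coplanarMod 31 (redNormal i) (redNormal j) (redNormal k) =
      coplanarMod 11 (normal i) (normal j) (normal k) ∧
    (coplanarMod 31 (redNormal i) (redNormal j) (redNormal k) = true →
      dot (cycNormal k) (cross (cycNormal i) (cycNormal j)) = 0) := by
  have hk : (k : ℕ) < (cycNormals.zip (redNormals.zip normals)).length := k.2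
  have h := allTriples_spec allTriples_normals hij hjk hk
  simp only [List.getElem_zip, Bool.and_eq_true, beq_iff_eq, Bool.or_eq_true,
    Bool.not_eq_true', ← Bool.not_eq_true, ← imp_iff_not_or, decide_eq_true_eq] at h
  exact h

lemma independentMod_redNormal : ∀ i j, i ≠ j →
    independentMod 31 (redNormal i) (redNormal j) = true := by decide +kernel

lemma independentMod_normal : ∀ i j, i ≠ j →
    independentMod 11 (normal i) (normal j) = true := by decide +kernel

/-- A relation on triples implied by another one on increasing triples is implied by it. -/
lemma forall_of_forall_lt {n : ℕ} {P Q : Fin n → Fin n → Fin n → Prop}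
    (hP : ∀ i j k, P i j k → P j i k ∧ P i k j) (hQ : ∀ i j k, Q i j k → Q j i k ∧ Q i k j)
    (hQ' : ∀ i k, Q i i k) (h : ∀ i j k, i < j → j < k → P i j k → Q i j k) :
    ∀ i j k, P i j k → Q i j k := by
  have h1 : ∀ i j k, i < j → P i j k → Q i j k := by
    intro i j k hij hp
    rcases lt_trichotomy j k with hjk | rfl | hjk
    · exact h i j k hij hjk hp
    · exact (hQ _ _ _ ((hQ _ _ _ (hQ' j i)).2)).1
    rcases lt_trichotomy i k with hik | rfl | hik
    · exact (hQ _ _ _ (h i k j hik hjk (hP _ _ _ hp).2)).2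
    · exact (hQ _ _ _ (hQ' i j)).2
    · exact (hQ _ _ _ (hQ _ _ _ (h k i j hik hij (hP _ _ _ (hP _ _ _ hp).2).1)).1).2
  intro i j k hp
  rcases lt_trichotomy i j with hij | rfl | hij
  · exact h1 i j k hij hp
  · exact hQ' i k
  · exact (hQ _ _ _ (h1 j i k hij (hP _ _ _ hp).1)).1

section Det

variable {R : Type*} [CommRing R]

lemma dot_cross_swap {u v w : Fin 3 → R} (h : dot w (cross u v) = 0) :
    dot w (cross v u) = 0 ∧ dot v (cross u w) = 0 := by
  simp only [dot, cross, Matrix.cons_val] at h ⊢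
  exact ⟨by linear_combination -h, by linear_combination -h⟩

lemma dot_cross_self (u w : Fin 3 → R) : dot w (cross u u) = 0 := by
  simp [dot, cross]; ring

end Det

variable {ζ : ℂ}

/-- Normal vectors of the complex arrangement. -/
noncomputable def cpxNormal (ζ : ℂ) (i : Fin 27) : Fin 3 → ℂ := CycInt.evalVec ζ (cycNormal i)

lemma cross_cpxNormal (hζ : IsPrimitiveRoot ζ 5) {i j : Fin 27} (hij : i ≠ j) :
    cross (cpxNormal ζ i) (cpxNormal ζ j) ≠ 0 := by
  intro h
  rw [cpxNormal, cpxNormal, ← CycInt.evalVec_cross (CycInt.one_add_eq_zero hζ)] at h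
  have h' := congrArg (CycInt.evalVec (2 : ZMod 31)) (CycInt.evalVec_eq_zero hζ h)
  rw [CycInt.evalVec_cross two_root, evalVec_cycNormal, evalVec_cycNormal,
    CycInt.evalVec_zero] at h'
  exact cross_ne_zero_of_independentMod (independentMod_redNormal i j hij) h'

lemma coplanarMod_swap {p : ℕ} {u v w : ℕ × ℕ × ℕ} (h : coplanarMod p u v w = true) :
    coplanarMod p v u w = true ∧ coplanarMod p u w v = true := by
  rw [coplanarMod_iff] at h ⊢
  rw [coplanarMod_iff]
  exact dot_cross_swap h

lemma coplanarMod_self (p : ℕ) (u w : ℕ × ℕ × ℕ) : coplanarMod p u u w = true :=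
  coplanarMod_iff.2 (dot_cross_self _ _)

lemma coplanarMod_redNormal_iff {i j k : Fin 27} :
    coplanarMod 31 (redNormal i) (redNormal j) (redNormal k) = true ↔
      coplanarMod 11 (normal i) (normal j) (normal k) = true :=
  ⟨forall_of_forall_lt
    (P := fun i j k => coplanarMod 31 (redNormal i) (redNormal j) (redNormal k) = true)
    (Q := fun i j k => coplanarMod 11 (normal i) (normal j) (normal k) = true)
    (fun _ _ _ => coplanarMod_swap) (fun _ _ _ => coplanarMod_swap)
    (fun _ _ => coplanarMod_self _ _ _)
    (fun i j k h1 h2 => by rw [(coplanarMod_redNormal h1 h2).1]; exact id) i j k,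
  forall_of_forall_lt
    (P := fun i j k => coplanarMod 11 (normal i) (normal j) (normal k) = true)
    (Q := fun i j k => coplanarMod 31 (redNormal i) (redNormal j) (redNormal k) = true)
    (fun _ _ _ => coplanarMod_swap) (fun _ _ _ => coplanarMod_swap)
    (fun _ _ => coplanarMod_self _ _ _)
    (fun i j k h1 h2 => by rw [(coplanarMod_redNormal h1 h2).1]; exact id) i j k⟩

lemma dot_cross_cpxNormal_iff (hζ : IsPrimitiveRoot ζ 5) {i j k : Fin 27} :
    dot (cpxNormal ζ k) (cross (cpxNormal ζ i) (cpxNormal ζ j)) = 0 ↔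
      coplanarMod 31 (redNormal i) (redNormal j) (redNormal k) = true := by
  have hz := CycInt.one_add_eq_zero hζ
  constructor
  · intro h
    rw [cpxNormal, cpxNormal, cpxNormal, ← CycInt.evalVec_cross hz, ← CycInt.eval_dot hz] at h
    have h' := congrArg (CycInt.eval (2 : ZMod 31)) (CycInt.eq_zero_of_eval hζ h)
    rwa [CycInt.eval_dot two_root, CycInt.evalVec_cross two_root, evalVec_cycNormal,
      evalVec_cycNormal, evalVec_cycNormal, CycInt.eval_zero, ← coplanarMod_iff] at h'
  · refine forall_of_forall_lt
      (P := fun i j k => coplanarMod 31 (redNormal i) (redNormal j) (redNormal k) = true)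
      (Q := fun i j k => dot (cpxNormal ζ k) (cross (cpxNormal ζ i) (cpxNormal ζ j)) = 0)
      (fun _ _ _ => coplanarMod_swap) (fun _ _ _ => dot_cross_swap)
      (fun _ _ => dot_cross_self _ _) (fun i j k h1 h2 h => ?_) i j k
    rw [cpxNormal, cpxNormal, cpxNormal, ← CycInt.evalVec_cross hz, ← CycInt.eval_dot hz,
      (coplanarMod_redNormal h1 h2).2 h, CycInt.eval_zero]

end Configuration

section Orbit

/-- The action of the three generating reflections on row vectors, where `t = -ζ² - ζ³`. -/
def reflect {R : Type*} [Add R] [Sub R] [Mul R] (t : R) (k : Fin 3) (v : Fin 3 → R) : Fin 3 → R :=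
  match k with
  | 0 => ![v 0, v 1, v 1 - v 2]
  | 1 => ![t * v 1 - v 0, v 1, v 2]
  | 2 => ![v 0, t * v 0 - v 1 + v 2, v 2]

lemma reflect_reflect {R : Type*} [CommRing R] (t : R) (k : Fin 3) (v : Fin 3 → R) :
    reflect t k (reflect t k v) = v := by
  funext i
  fin_cases k <;> fin_cases i <;> simp [reflect]
  ring

lemma reflect_smul {R : Type*} [CommRing R] (t c : R) (k : Fin 3) (v : Fin 3 → R) :
    reflect t k (c • v) = c • reflect t k v := by
  funext i
  fin_cases k <;> fin_cases i <;> simp [reflect] <;> ring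

lemma evalVec_reflect {R : Type*} [CommRing R] {z : R} (hz : 1 + z + z ^ 2 + z ^ 3 + z ^ 4 = 0)
    (t : CycInt) (k : Fin 3) (v : Fin 3 → CycInt) :
    CycInt.evalVec z (reflect t k v) = reflect (CycInt.eval z t) k (CycInt.evalVec z v) := by
  funext i
  fin_cases k <;> fin_cases i <;>
    simp [reflect, CycInt.evalVec, CycInt.eval_add, CycInt.eval_sub, CycInt.eval_mul hz]

/-- The permutations of the hyperplanes induced by the generating reflections. -/
def permTable : List (List (Fin 27)) :=
  [[0, 5, 2, 7, 9, 1, 11, 3, 12, 4, 14, 6, 8, 16, 10, 18, 13, 20, 15, 22, 17, 24, 19, 25, 21, 23,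
    26],
   [0, 6, 2, 8, 10, 11, 1, 12, 3, 14, 4, 5, 7, 17, 9, 19, 20, 13, 22, 15, 16, 25, 18, 24, 23, 21,
    26],
   [4, 1, 5, 8, 0, 2, 10, 13, 3, 9, 6, 15, 16, 7, 18, 11, 12, 21, 14, 19, 23, 17, 26, 20, 25, 24,
    22]]

/-- Each hyperplane from the fifth one on, as the image of an earlier one under a generating
reflection. -/
def orbitTable : List (Fin 27 × Fin 3) :=
  [(0, 2), (1, 0), (1, 1), (3, 0), (3, 1), (4, 0), (4, 1), (5, 1), (7, 1), (7, 2), (9, 1), (11, 2),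
   (12, 2), (13, 1), (14, 2), (15, 1), (16, 1), (17, 2), (18, 1), (20, 2), (21, 0), (21, 1),
   (22, 2)]

lemma cross_reflect : ∀ (k : Fin 3) (i : Fin 27), ∃ j ∈ (permTable.getD k [])[(i : ℕ)]?,
    cross (cycNormal j) (reflect ⟨0, 0, -1, -1⟩ k (cycNormal i)) = 0 := by decide +kernel

lemma reflect_cycNormal : ∀ i : Fin 27, 4 ≤ i → ∃ e ∈ orbitTable[(i : ℕ) - 4]?,
    e.1 < i ∧ cycNormal i = reflect ⟨0, 0, -1, -1⟩ e.2 (cycNormal e.1) := by decide +kernel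

lemma exists_eq_smul_of_cross {K : Type*} [Field K] {u v : Fin 3 → K} (hu : u ≠ 0)
    (h : cross u v = 0) : ∃ c : K, v = c • u := by
  obtain ⟨k, hk⟩ := Function.ne_iff.1 hu
  rw [Pi.zero_apply] at hk
  have h0 := congrFun h 0
  have h1 := congrFun h 1
  have h2 := congrFun h 2
  simp only [cross, Matrix.cons_val, Pi.zero_apply] at h0 h1 h2
  refine ⟨v k / u k, funext fun i => ?_⟩
  rw [Pi.smul_apply, smul_eq_mul, div_mul_eq_mul_div, eq_div_iff hk]
  fin_cases k <;> fin_cases i <;> simp only [Fin.zero_eta, Fin.mk_one, Fin.reduceFinMk]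
  · linear_combination h2
  · linear_combination -h1
  · linear_combination -h2
  · linear_combination h0
  · linear_combination h1
  · linear_combination -h0

variable {ζ : ℂ}

lemma cpxNormal_ne_zero (hζ : IsPrimitiveRoot ζ 5) (i : Fin 27) : cpxNormal ζ i ≠ 0 := by
  intro h
  obtain ⟨j, hj⟩ := exists_ne i
  refine cross_cpxNormal hζ hj.symm ?_
  rw [h]
  funext k
  fin_cases k <;> simp [cross]

lemma exists_cross_reflect (hζ : IsPrimitiveRoot ζ 5) {v : Fin 3 → ℂ} (k : Fin 3)
    (hv : ∃ i, cross (cpxNormal ζ i) v = 0) :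
    ∃ i, cross (cpxNormal ζ i) (reflect (CycInt.eval ζ ⟨0, 0, -1, -1⟩) k v) = 0 := by
  have hz := CycInt.one_add_eq_zero hζ
  obtain ⟨i, hi⟩ := hv
  obtain ⟨c, rfl⟩ := exists_eq_smul_of_cross (cpxNormal_ne_zero hζ i) hi
  obtain ⟨j, -, hj⟩ := cross_reflect k i
  refine ⟨j, ?_⟩
  have h := congrArg (CycInt.evalVec ζ) hj
  rw [CycInt.evalVec_cross hz, evalVec_reflect hz, CycInt.evalVec_zero] at h
  have hc : ∀ x y : Fin 3 → ℂ, cross x (c • y) = c • cross x y := fun x y => by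
    funext i
    fin_cases i <;> simp [cross] <;> ring
  rw [reflect_smul, hc]
  exact (congrArg (c • ·) h).trans (smul_zero c)

variable {g1 g2 g3 : GL (Fin 3) ℂ}

lemma vecMul_eq_reflect
    (hg1 : (g1 : Matrix (Fin 3) (Fin 3) ℂ) = !![1, 0, 0; 0, 1, 1; 0, 0, -1])
    (hg2 : (g2 : Matrix (Fin 3) (Fin 3) ℂ) = !![-1, 0, 0; -ζ^2 - ζ^3, 1, 0; 0, 0, 1])
    (hg3 : (g3 : Matrix (Fin 3) (Fin 3) ℂ) = !![1, -ζ^2 - ζ^3, 0; 0, -1, 0; 0, 1, 1])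
    (k : Fin 3) (v : Fin 3 → ℂ) :
    v ᵥ* (![g1, g2, g3] k : Matrix (Fin 3) (Fin 3) ℂ) =
      reflect (CycInt.eval ζ ⟨0, 0, -1, -1⟩) k v := by
  funext i
  fin_cases k <;> fin_cases i <;>
    simp [hg1, hg2, hg3, reflect, CycInt.eval, vecMul, dotProduct, Fin.sum_univ_three] <;> ring

lemma exists_cross_vecMul_iff (hζ : IsPrimitiveRoot ζ 5)
    (hg1 : (g1 : Matrix (Fin 3) (Fin 3) ℂ) = !![1, 0, 0; 0, 1, 1; 0, 0, -1])
    (hg2 : (g2 : Matrix (Fin 3) (Fin 3) ℂ) = !![-1, 0, 0; -ζ^2 - ζ^3, 1, 0; 0, 0, 1])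
    (hg3 : (g3 : Matrix (Fin 3) (Fin 3) ℂ) = !![1, -ζ^2 - ζ^3, 0; 0, -1, 0; 0, 1, 1])
    {g : GL (Fin 3) ℂ} (hg : g ∈ Subgroup.closure {g1, g2, g3}) : ∀ v : Fin 3 → ℂ,
    (∃ i, cross (cpxNormal ζ i) v = 0) ↔
      ∃ i, cross (cpxNormal ζ i) (v ᵥ* (g : Matrix (Fin 3) (Fin 3) ℂ)) = 0 := by
  induction hg using Subgroup.closure_induction with
  | mem x hx =>
    obtain ⟨k, rfl⟩ : ∃ k, x = ![g1, g2, g3] k := by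
      rcases hx with rfl | rfl | rfl
      exacts [⟨0, rfl⟩, ⟨1, rfl⟩, ⟨2, rfl⟩]
    intro v
    rw [vecMul_eq_reflect hg1 hg2 hg3]
    refine ⟨exists_cross_reflect hζ k, fun h => ?_⟩
    simpa only [reflect_reflect] using exists_cross_reflect hζ k h
  | one => simp
  | mul x y _ _ hx hy =>
    intro v
    rw [hx v, hy, Units.val_mul, vecMul_vecMul]
  | inv x _ hx =>
    intro v
    rw [hx (v ᵥ* ((x⁻¹ : GL (Fin 3) ℂ) : Matrix (Fin 3) (Fin 3) ℂ)), vecMul_vecMul,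
      ← Units.val_mul, inv_mul_cancel, Units.val_one, vecMul_one]

/-- The hyperplanes of the complex arrangement. -/
lemma image_perp_eq_range (hζ : IsPrimitiveRoot ζ 5)
    (hg1 : (g1 : Matrix (Fin 3) (Fin 3) ℂ) = !![1, 0, 0; 0, 1, 1; 0, 0, -1])
    (hg2 : (g2 : Matrix (Fin 3) (Fin 3) ℂ) = !![-1, 0, 0; -ζ^2 - ζ^3, 1, 0; 0, 0, 1])
    (hg3 : (g3 : Matrix (Fin 3) (Fin 3) ℂ) = !![1, -ζ^2 - ζ^3, 0; 0, -1, 0; 0, 1, 1])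
    {W : Subgroup (GL (Fin 3) ℂ)} (hW : W = Subgroup.closure {g1, g2, g3})
    {R : Set (Fin 3 → ℂ)}
    (hR : R = {w | ∃ g ∈ W, ∃ i : Fin 3,
          w = Matrix.vecMul (Pi.single i 1) (g : Matrix (Fin 3) (Fin 3) ℂ)} ∪
        {w | ∃ g ∈ W, w = Matrix.vecMul ![1, -ζ^2, 0] (g : Matrix (Fin 3) (Fin 3) ℂ)}) :
    perp '' R = Set.range fun i => perp (cpxNormal ζ i) := by
  subst hW
  have hbase : ∀ i : Fin 4, cpxNormal ζ (i.castLE (by norm_num)) =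
      ![Pi.single 0 1, Pi.single 1 1, Pi.single 2 1, ![1, -ζ ^ 2, 0]] i := by
    intro i
    funext j
    fin_cases i <;> fin_cases j <;>
      simp [cpxNormal, cycNormal, cycNormals, CycInt.evalVec, CycInt.eval]
  have hR' : R = {w | ∃ g ∈ Subgroup.closure {g1, g2, g3}, ∃ i : Fin 4,
      w = cpxNormal ζ (i.castLE (by norm_num)) ᵥ* (g : Matrix (Fin 3) (Fin 3) ℂ)} := by
    rw [hR]
    ext w
    simp only [hbase, Set.mem_union, Set.mem_ofPred_eq, ← exists_or, ← and_or_left]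
    refine exists_congr fun g => and_congr_right fun _ => ?_
    simp [Fin.exists_fin_succ, or_assoc]
  apply Set.Subset.antisymm
  · rintro _ ⟨w, hw, rfl⟩
    rw [hR'] at hw
    obtain ⟨g, hg, i, rfl⟩ := hw
    obtain ⟨j, hj⟩ := (exists_cross_vecMul_iff hζ hg1 hg2 hg3 hg _).1
      ⟨i.castLE (by norm_num), show cross _ (cpxNormal ζ (i.castLE (by norm_num))) = 0 by
        funext k
        fin_cases k <;> simp [cross] <;> ring⟩
    refine ⟨j, perp_eq_of_cross (cpxNormal_ne_zero hζ j) (fun h => ?_) hj⟩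
    refine cpxNormal_ne_zero hζ (i.castLE (by norm_num)) ?_
    have := congrArg (· ᵥ* ((g⁻¹ : GL (Fin 3) ℂ) : Matrix (Fin 3) (Fin 3) ℂ)) h
    simpa only [vecMul_vecMul, ← Units.val_mul, mul_inv_cancel, Units.val_one, vecMul_one,
      zero_vecMul] using this
  · rintro _ ⟨i, rfl⟩
    refine ⟨_, ?_, rfl⟩
    rw [hR']
    induction i using WellFoundedLT.induction with
    | _ i ih =>
      by_cases hi : (i : ℕ) < 4
      · exact ⟨1, one_mem _, ⟨i, hi⟩, by rw [Units.val_one, vecMul_one]; rfl⟩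
      · obtain ⟨e, -, he, hr⟩ := reflect_cycNormal i (by rw [Fin.le_def]; exact not_lt.1 hi)
        obtain ⟨g, hg, j, hj⟩ := ih e.1 he
        refine ⟨g * ![g1, g2, g3] e.2, mul_mem hg (Subgroup.subset_closure ?_), j, ?_⟩
        · generalize e.2 = k
          fin_cases k <;> simp
        · rw [Units.val_mul, ← vecMul_vecMul, ← hj, vecMul_eq_reflect hg1 hg2 hg3, cpxNormal, hr,
            evalVec_reflect (CycInt.one_add_eq_zero hζ), cpxNormal]

end Orbit

section Lattice

lemma nonempty_range_orderIso {P α β : Type*} [PartialOrder α] [PartialOrder β] {F : P → α}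
    {G : P → β} (h : ∀ S T, F S ≤ F T ↔ G S ≤ G T) :
    Nonempty (Set.range F ≃o Set.range G) := by
  have hF : ∀ x : Set.range F, ∃ S, F S = x := fun x => x.2
  choose c hc using hF
  refine ⟨RelIso.ofSurjective (OrderEmbedding.ofMapLEIff
    (fun x : Set.range F => (⟨G (c x), Set.mem_range_self _⟩ : Set.range G)) fun x y => ?_) ?_⟩
  · rw [Subtype.mk_le_mk, ← h, hc, hc, Subtype.coe_le_coe]
  · rintro ⟨_, S, rfl⟩
    have := hc ⟨F S, S, rfl⟩
    exact ⟨⟨F S, S, rfl⟩, Subtype.ext (le_antisymm ((h _ _).1 this.le) ((h _ _).1 this.ge))⟩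

variable {K K' ι : Type*} [Field K] [Field K']

lemma setLattice_range (f : ι → Submodule K (Fin 3 → K)) :
    setLattice (Set.range f) = Set.range fun S : Finset ι => S.inf f := by
  ext X
  constructor
  · rintro ⟨s, hs, rfl⟩
    rw [← Set.image_univ, Finset.subset_set_image_iff] at hs
    obtain ⟨t, -, rfl⟩ := hs
    exact ⟨t, by simp [Finset.inf_image]⟩
  · rintro ⟨S, rfl⟩
    exact ⟨S.image f, by simp, by simp [Finset.inf_image]⟩

lemma exists_dot_cross_ne_zero {u w : Fin 3 → K} (h : cross u w ≠ 0) :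
    ∃ e, dot w (cross u e) ≠ 0 := by
  obtain ⟨k, hk⟩ := Function.ne_iff.1 h
  refine ⟨Pi.single k 1, fun h0 => hk ?_⟩
  fin_cases k <;> simp [dot, cross] at h0 ⊢ <;> linear_combination -h0

lemma inf_perp_le_iff {N : ι → Fin 3 → K} (hN : ∀ i, N i ≠ 0)
    (hc : ∀ i j, i ≠ j → cross (N i) (N j) ≠ 0) (S : Finset ι) (k : ι) :
    S.inf (fun i => perp (N i)) ≤ perp (N k) ↔
      k ∈ S ∨ (∃ i ∈ S, ∃ j ∈ S, i ≠ j ∧ dot (N k) (cross (N i) (N j)) = 0) ∨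
        ∃ i ∈ S, ∃ j ∈ S, ∃ l ∈ S, dot (N l) (cross (N i) (N j)) ≠ 0 := by
  have hmem : ∀ x, x ∈ S.inf (fun i => perp (N i)) ↔ ∀ i ∈ S, dot (N i) x = 0 := fun x => by
    simp [Submodule.mem_finsetInf, mem_perp]
  have hx : ∀ x ∈ S.inf (fun i => perp (N i)), ∀ i ∈ S, ∀ j ∈ S,
      cross x (cross (N i) (N j)) = 0 := fun x hx i hi j hj => by
    rw [hmem] at hx
    rw [cross_cross, dot_comm x, dot_comm x, hx i hi, hx j hj, zero_smul, zero_smul, sub_zero]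
  constructor
  · intro h
    by_contra! hcon
    obtain ⟨h1, h2, h3⟩ := hcon
    obtain ⟨x, hx1, hx2⟩ : ∃ x, (∀ i ∈ S, dot (N i) x = 0) ∧ dot (N k) x ≠ 0 := by
      rcases (S : Set ι).subsingleton_or_nontrivial with hs | ⟨i, hi, j, hj, hij⟩
      · rcases S.eq_empty_or_nonempty with rfl | ⟨i, hi⟩
        · obtain ⟨j, hj⟩ := Function.ne_iff.1 (hN k)
          refine ⟨Pi.single j 1, by simp, ?_⟩
          fin_cases j <;> simpa [dot] using hj
        · obtain ⟨e, he⟩ := exists_dot_cross_ne_zero (hc i k fun h => h1 (h ▸ hi))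
          exact ⟨_, fun j hj => by rw [hs hj hi, dot_cross_left], he⟩
      · exact ⟨_, h3 i hi j hj, h2 i hi j hj hij⟩
    exact hx2 (mem_perp.1 (h ((hmem x).2 hx1)))
  · rintro (hk | ⟨i, hi, j, hj, hij, h⟩ | ⟨i, hi, j, hj, l, hl, h⟩) x hxS
    · exact mem_perp.2 ((hmem x).1 hxS k hk)
    · exact mem_perp.2 (dot_eq_zero_of_cross (hc i j hij) (hx x hxS i hi j hj) h)
    · have h0 : cross (N i) (N j) ≠ 0 := fun h0 => h (by simp [h0, dot])
      suffices x = 0 by rw [this]; exact zero_mem _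
      by_contra hx0
      exact h (dot_eq_zero_of_cross hx0 (by
        have := hx x hxS i hi j hj
        funext m
        have := congrFun this m
        fin_cases m <;> simp [cross] at this ⊢ <;> linear_combination -this)
        ((hmem x).1 hxS l hl))

lemma nonempty_setLattice_orderIso {N : ι → Fin 3 → K} {N' : ι → Fin 3 → K'}
    (hN : ∀ i, N i ≠ 0) (hN' : ∀ i, N' i ≠ 0) (hc : ∀ i j, i ≠ j → cross (N i) (N j) ≠ 0)
    (hc' : ∀ i j, i ≠ j → cross (N' i) (N' j) ≠ 0)
    (h : ∀ i j k, dot (N k) (cross (N i) (N j)) = 0 ↔ dot (N' k) (cross (N' i) (N' j)) = 0) :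
    Nonempty (setLattice (Set.range fun i => perp (N i)) ≃o
      setLattice (Set.range fun i => perp (N' i))) := by
  rw [setLattice_range, setLattice_range]
  refine nonempty_range_orderIso fun S T => ?_
  rw [Finset.le_inf_iff, Finset.le_inf_iff]
  refine forall₂_congr fun k _ => ?_
  rw [inf_perp_le_iff hN hc, inf_perp_le_iff hN' hc']
  simp only [h, Ne]

lemma nonempty_lattice_orderIso {ζ : ℂ} (hζ : IsPrimitiveRoot ζ 5)
    (h : (0 : Fin 3 → ZMod 11) ∉ Bvecs.toFinset) :
    Nonempty ((mkArr Bvecs.toFinset h).lattice ≃o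
      setLattice (Set.range fun i => perp (cpxNormal ζ i))) := by
  have hB : ((mkArr Bvecs.toFinset h).hyperplanes : Set (Submodule (ZMod 11) (Fin 3 → ZMod 11))) =
      Set.range fun i => perp (natVec 11 (normal i)) := by
    ext H
    rw [Finset.mem_coe, mem_mkArr_Bvecs, exists_normal_iff (P := fun v => perp (natVec 11 v) = H),
      Set.mem_range]
  have hc : ∀ i j, i ≠ j → cross (natVec 11 (normal i)) (natVec 11 (normal j)) ≠ 0 :=
    fun i j hij => cross_ne_zero_of_independentMod (independentMod_normal i j hij)
  rw [Arrangement.lattice, hB]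
  refine nonempty_setLattice_orderIso (fun i h0 => ?_) (cpxNormal_ne_zero hζ) hc
    (fun i j => cross_cpxNormal hζ) fun i j k => ?_
  · obtain ⟨j, hj⟩ := exists_ne i
    refine hc i j hj.symm ?_
    rw [h0]
    funext k
    fin_cases k <;> simp [cross]
  · rw [dot_cross_cpxNormal_iff hζ, coplanarMod_redNormal_iff, coplanarMod_iff]

end Lattice

section Pencils

/-- The codimension two flats of the complex arrangement with at least two hyperplanes, as lists of
hyperplanes together with the reduction modulo 31 of a direction vector. -/
def flats : List (List ℕ × ℕ × ℕ × ℕ) :=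
  [([0, 1, 3, 4, 6, 8, 10], (0, 0, 1)), ([0, 5, 7, 9, 11, 12, 14], (0, 30, 1)),
   ([1, 11, 15, 22, 24, 25, 26], (1, 0, 12)), ([2, 4, 9, 13, 15, 16, 18], (12, 1, 0)),
   ([2, 10, 14, 17, 19, 20, 22], (12, 19, 0)), ([5, 6, 18, 19, 21, 23, 26], (30, 19, 12)),
   ([0, 13, 17], (0, 4, 19)), ([0, 15, 19], (0, 30, 20)), ([0, 16, 20], (0, 4, 25)),
   ([0, 18, 22], (0, 12, 20)), ([0, 21, 25], (0, 4, 28)), ([0, 23, 24], (0, 4, 12)),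
   ([1, 2, 5], (1, 0, 0)), ([1, 7, 13], (27, 0, 30)), ([1, 12, 16], (27, 0, 15)),
   ([1, 14, 18], (19, 0, 12)), ([1, 17, 21], (27, 0, 12)), ([1, 20, 23], (27, 0, 6)),
   ([2, 3, 7], (4, 1, 0)), ([2, 6, 11], (30, 19, 0)), ([2, 8, 12], (4, 16, 0)),
   ([2, 21, 24], (3, 19, 0)), ([2, 23, 25], (19, 25, 0)), ([3, 5, 16], (27, 30, 1)),
   ([3, 9, 24], (17, 12, 23)), ([3, 11, 17], (27, 30, 15)), ([3, 12, 26], (16, 4, 29)),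
   ([3, 13, 22], (16, 4, 23)), ([3, 14, 21], (17, 12, 2)), ([3, 15, 23], (27, 30, 3)),
   ([3, 18, 20], (17, 12, 3)), ([3, 19, 25], (27, 30, 7)), ([4, 7, 21], (17, 4, 8)),
   ([4, 11, 19], (19, 30, 12)), ([4, 12, 23], (17, 4, 2)), ([4, 14, 26], (20, 12, 30)),
   ([4, 17, 24], (17, 4, 30)), ([4, 20, 25], (17, 4, 15)), ([5, 8, 13], (4, 16, 15)),
   ([5, 10, 15], (12, 19, 12)), ([5, 17, 25], (8, 19, 12)), ([5, 20, 24], (2, 25, 6)),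
   ([6, 7, 20], (27, 14, 16)), ([6, 9, 22], (19, 11, 19)), ([6, 12, 17], (27, 14, 1)),
   ([6, 13, 25], (27, 14, 19)), ([6, 16, 24], (27, 14, 25)), ([7, 8, 26], (15, 29, 29)),
   ([7, 10, 24], (14, 17, 2)), ([7, 15, 17], (14, 16, 3)), ([7, 16, 19], (23, 2, 27)),
   ([7, 18, 25], (4, 29, 3)), ([7, 22, 23], (4, 25, 7)), ([8, 9, 25], (17, 6, 29)),
   ([8, 11, 20], (27, 15, 30)), ([8, 14, 23], (17, 6, 8)), ([8, 15, 21], (27, 15, 24)),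
   ([8, 16, 22], (16, 2, 30)), ([8, 17, 18], (16, 2, 8)), ([8, 19, 24], (27, 15, 28)),
   ([9, 10, 26], (11, 20, 30)), ([9, 17, 23], (28, 24, 30)), ([9, 20, 21], (7, 14, 15)),
   ([10, 12, 25], (17, 14, 23)), ([10, 13, 23], (17, 14, 1)), ([10, 16, 21], (17, 14, 16)),
   ([11, 13, 21], (8, 15, 19)), ([11, 16, 23], (2, 30, 25)), ([12, 13, 19], (30, 29, 29)),
   ([12, 15, 20], (14, 1, 24)), ([12, 18, 24], (4, 23, 24)), ([12, 21, 22], (4, 19, 28)),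
   ([13, 14, 24], (3, 29, 30)), ([13, 20, 26], (24, 28, 15)), ([14, 16, 25], (7, 8, 16)),
   ([16, 17, 26], (7, 19, 15)), ([0, 2], (0, 30, 0)), ([0, 26], (0, 12, 7)), ([1, 9], (19, 0, 30)),
   ([1, 19], (1, 0, 11)), ([2, 26], (24, 20, 0)), ([4, 5], (19, 30, 1)), ([4, 22], (20, 12, 12)),
   ([5, 22], (30, 20, 11)), ([6, 14], (19, 11, 1)), ([6, 15], (1, 12, 20)), ([9, 19], (11, 7, 12)),
   ([10, 11], (19, 12, 30)), ([10, 18], (20, 11, 19)), ([11, 18], (30, 30, 20)),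
   ([14, 15], (11, 1, 19))]

/-- The cross product modulo `p`. -/
def crossMod (p : ℕ) (h v : ℕ × ℕ × ℕ) : ℕ × ℕ × ℕ :=
  (Nat.mod (Nat.add (Nat.mul h.2.1 v.2.2) (Nat.mul (p - 1) (Nat.mul h.2.2 v.2.1))) p,
    Nat.mod (Nat.add (Nat.mul h.2.2 v.1) (Nat.mul (p - 1) (Nat.mul h.1 v.2.2))) p,
    Nat.mod (Nat.add (Nat.mul h.1 v.2.1) (Nat.mul (p - 1) (Nat.mul h.2.1 v.1))) p)

/-- Orthogonality modulo `p`. -/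
def orthogonalMod (p : ℕ) (v w : ℕ × ℕ × ℕ) : Bool :=
  Nat.beq (Nat.mod
    (Nat.add (Nat.mul v.1 w.1) (Nat.add (Nat.mul v.2.1 w.2.1) (Nat.mul v.2.2 w.2.2))) p) 0

/-- The total excess of the flats with a given property. -/
def excess (q : List ℕ × ℕ × ℕ × ℕ → Bool) : List (List ℕ × ℕ × ℕ × ℕ) → ℕ
  | [] => 0
  | c :: l => bif q c then Nat.add (Nat.pred c.1.length) (excess q l) else excess q l

/-- Any two flats of a list through a plane that is not in the arrangement determine a pencil of
total excess at most `m`. -/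
def excessBound (m : ℕ) : List (List ℕ × ℕ × ℕ × ℕ) → Bool
  | [] => true
  | a :: l => excessBound m l && pairBound a l
where
  /-- The condition `excessBound` for the pairs with a given first flat. -/
  pairBound (a : List ℕ × ℕ × ℕ × ℕ) : List (List ℕ × ℕ × ℕ × ℕ) → Bool
  | [] => Nat.ble (Nat.pred a.1.length) m
  | b :: l =>
    pairBound a l && bif a.1.any fun i => b.1.any (Nat.beq i) then independentMod 31 a.2 b.2
      else Nat.ble (Nat.add (Nat.pred a.1.length) (Nat.add (Nat.pred b.1.length)
        (excess (fun c => orthogonalMod 31 (crossMod 31 a.2 b.2) c.2) l))) m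

lemma excessBound_flats : excessBound 10 flats = true := by decide +kernel

end Pencils

section PencilCount

lemma excess_le_excess {q q' : List ℕ × ℕ × ℕ × ℕ → Bool} {l : List (List ℕ × ℕ × ℕ × ℕ)}
    (h : ∀ c ∈ l, q c = true → q' c = true) : excess q l ≤ excess q' l := by
  induction l with
  | nil => exact le_rfl
  | cons c l ih =>
    have ih := ih fun c hc => h c (List.mem_cons_of_mem _ hc)
    have hc := h c List.mem_cons_self
    simp only [excess, cond_eq_ite]
    split_ifs with h1 h2
    · exact Nat.add_le_add_left ih _
    · exact absurd (hc h1) h2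
    · exact ih.trans (Nat.le_add_left _ _)
    · exact ih

variable {m : ℕ} {q : List ℕ × ℕ × ℕ × ℕ → Bool}

lemma excess_add_le_of_pairBound {a : List ℕ × ℕ × ℕ × ℕ} {l : List (List ℕ × ℕ × ℕ × ℕ)}
    (h3 : ∀ b ∈ l, q b = true → ∀ c ∈ l, q c = true →
      orthogonalMod 31 (crossMod 31 a.2 b.2) c.2 = true)
    (h2 : ∀ b ∈ l, q b = true → ∀ i ∈ a.1, i ∈ b.1 → independentMod 31 a.2 b.2 = true → False)
    (h : excessBound.pairBound m a l = true) : Nat.pred a.1.length + excess q l ≤ m := by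
  induction l with
  | nil => exact Nat.le_of_ble_eq_true h
  | cons b l ih =>
    rw [excessBound.pairBound, Bool.and_eq_true] at h
    have ih := ih (fun b hb h c hc => h3 b (List.mem_cons_of_mem _ hb) h c
      (List.mem_cons_of_mem _ hc)) (fun b hb => h2 b (List.mem_cons_of_mem _ hb)) h.1
    rw [excess, cond_eq_ite]
    split_ifs with hb
    · have h' := h.2
      rw [cond_eq_ite] at h'
      split_ifs at h' with hs
      · simp only [List.any_eq_true, Nat.beq_eq] at hs
        obtain ⟨i, hi, j, hj, rfl⟩ := hs
        exact (h2 b List.mem_cons_self hb i hi hj h').elim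
      · refine le_trans (Nat.add_le_add_left (Nat.add_le_add_left (excess_le_excess
          fun c hc hqc => ?_) _) _) (Nat.le_of_ble_eq_true h')
        exact h3 b List.mem_cons_self hb c (List.mem_cons_of_mem _ hc) hqc
    · exact ih

lemma excess_le_of_excessBound {l : List (List ℕ × ℕ × ℕ × ℕ)}
    (h3 : ∀ a ∈ l, q a = true → ∀ b ∈ l, q b = true → ∀ c ∈ l, q c = true →
      orthogonalMod 31 (crossMod 31 a.2 b.2) c.2 = true)
    (h2 : ∀ a ∈ l, q a = true → ∀ b ∈ l, q b = true → ∀ i ∈ a.1, i ∈ b.1 →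
      independentMod 31 a.2 b.2 = true → False)
    (h : excessBound m l = true) : excess q l ≤ m := by
  induction l with
  | nil => exact Nat.zero_le _
  | cons a l ih =>
    rw [excessBound, Bool.and_eq_true] at h
    have hl : ∀ {c}, c ∈ l → c ∈ a :: l := List.mem_cons_of_mem _
    rw [excess, cond_eq_ite]
    split_ifs with ha
    · exact excess_add_le_of_pairBound
        (fun b hb h c hc => h3 a List.mem_cons_self ha b (hl hb) h c (hl hc))
        (fun b hb => h2 a List.mem_cons_self ha b (hl hb)) h.2
    · exact ih (fun a ha h b hb h' c hc => h3 a (hl ha) h b (hl hb) h' c (hl hc))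
        (fun a ha h b hb => h2 a (hl ha) h b (hl hb)) h.1

lemma card_le_excess {n : ℕ} {l : List (List ℕ × ℕ × ℕ × ℕ)} {S : Finset (Fin n)}
    (h : ∀ i ∈ S, ∃ c ∈ l, q c = true ∧ (i : ℕ) ∈ c.1.tail) : S.card ≤ excess q l := by
  induction l generalizing S with
  | nil =>
    have hS : S = ∅ := Finset.eq_empty_of_forall_notMem fun i hi => by simpa using h i hi
    rw [hS]
    exact Nat.zero_le _
  | cons c l ih =>
    rw [excess, cond_eq_ite]
    split_ifs with hc
    · rw [← Finset.card_filter_add_card_filter_not (s := S) fun i => (i : ℕ) ∈ c.1.tail]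
      refine Nat.add_le_add ?_ (ih fun i hi => ?_)
      · rw [← Finset.card_image_of_injective _ Fin.val_injective]
        refine le_trans (Finset.card_le_card (t := c.1.tail.toFinset) fun i hi => ?_)
          ((List.toFinset_card_le _).trans_eq List.length_tail)
        obtain ⟨j, hj, rfl⟩ := Finset.mem_image.1 hi
        exact List.mem_toFinset.2 (Finset.mem_filter.1 hj).2
      · rw [Finset.mem_filter] at hi
        obtain ⟨b, hb, hq, hi'⟩ := h i hi.1
        rcases List.mem_cons.1 hb with rfl | hb
        exacts [absurd hi' hi.2, ⟨b, hb, hq, hi'⟩]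
    · refine ih fun i hi => ?_
      obtain ⟨b, hb, hq, hi'⟩ := h i hi
      rcases List.mem_cons.1 hb with rfl | hb
      exacts [absurd hq hc, ⟨b, hb, hq, hi'⟩]

lemma orthogonalMod_crossMod {p : ℕ} (hp : 0 < p) {u v w : ℕ × ℕ × ℕ}
    (h : dot (natVec p w) (cross (natVec p u) (natVec p v)) = 0) :
    orthogonalMod p (crossMod p u v) w = true := by
  have hp1 : ((p - 1 : ℕ) : ZMod p) = -1 := by
    rw [Nat.cast_sub hp, ZMod.natCast_self, zero_sub, Nat.cast_one]
  rw [orthogonalMod, Nat.beq_eq]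
  refine Nat.mod_eq_zero_of_dvd ((ZMod.natCast_eq_zero_iff _ p).1 ?_)
  change (((u.2.1 * v.2.2 + (p - 1) * (u.2.2 * v.2.1)) % p * w.1 +
    ((u.2.2 * v.1 + (p - 1) * (u.1 * v.2.2)) % p * w.2.1 +
      (u.1 * v.2.1 + (p - 1) * (u.2.1 * v.1)) % p * w.2.2) : ℕ) : ZMod p) = 0
  push_cast
  simp only [ZMod.natCast_mod, Nat.cast_add, Nat.cast_mul, hp1]
  simp only [dot, cross, natVec, Matrix.cons_val] at h
  linear_combination h

/-- The direction of a flat. -/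
def direction (c : List ℕ × ℕ × ℕ × ℕ) : Fin 3 → CycInt :=
  match c.1 with
  | i :: j :: _ => cross (cycNormals.getD i 0) (cycNormals.getD j 0)
  | _ => 0

lemma evalVec_direction : ∀ c ∈ flats,
    CycInt.evalVec (2 : ZMod 31) (direction c) = natVec 31 c.2 := by decide +kernel

lemma dot_direction : ∀ c ∈ flats, ∀ i ∈ c.1, ∃ v ∈ cycNormals[i]?, dot v (direction c) = 0 := by
  decide +kernel

lemma exists_flat : ∀ i : Fin 27, ∀ j : Fin 27, j < i →
    (flats.any fun c => c.1.any (Nat.beq j) && c.1.tail.any (Nat.beq i)) = true := by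
  decide +kernel

variable {ζ : ℂ}

lemma dot_cpxNormal_direction (hζ : IsPrimitiveRoot ζ 5) {c : List ℕ × ℕ × ℕ × ℕ} (hc : c ∈ flats)
    {i : ℕ} (hi : i ∈ c.1) :
    ∃ j : Fin 27, (j : ℕ) = i ∧ dot (cpxNormal ζ j) (CycInt.evalVec ζ (direction c)) = 0 := by
  obtain ⟨v, hv, h⟩ := dot_direction c hc i hi
  obtain ⟨h', rfl⟩ := List.getElem?_eq_some_iff.1 hv
  refine ⟨⟨i, h'⟩, rfl, ?_⟩
  rw [cpxNormal, ← CycInt.eval_dot (CycInt.one_add_eq_zero hζ)]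
  exact (congrArg (CycInt.eval ζ) h).trans CycInt.eval_zero

/-- A plane outside the arrangement meets it in at least 17 lines. -/
lemma le_card_image (hζ : IsPrimitiveRoot ζ 5) {h : Fin 3 → ℂ} (h0 : h ≠ 0)
    (hc : ∀ i, cross h (cpxNormal ζ i) ≠ 0) :
    17 ≤ (Finset.univ.image fun i =>
      (perp (cpxNormal ζ i)).comap (perp h).subtype).card := by
  have hz := CycInt.one_add_eq_zero hζ
  set f := fun i => (perp (cpxNormal ζ i)).comap (perp h).subtype with hf
  set S := Finset.univ.filter fun i : Fin 27 => ∃ j < i, f j = f i with hS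
  have hinj : (Finset.univ.filter fun i : Fin 27 => ¬ ∃ j < i, f j = f i).card ≤
      (Finset.univ.image f).card := by
    rw [← Finset.card_image_of_injOn (f := f)]
    · exact Finset.card_le_card (Finset.image_subset_image (Finset.subset_univ _))
    · intro i hi j hj hij
      simp only [Finset.coe_filter, Finset.mem_univ, true_and, Set.mem_ofPred_eq, not_exists,
        not_and] at hi hj
      rcases lt_trichotomy i j with hlt | heq | hlt
      exacts [absurd hij (hj i hlt), heq, absurd hij.symm (hi j hlt)]
  have hcard : S.card + (Finset.univ.filter fun i : Fin 27 => ¬ ∃ j < i, f j = f i).card = 27 :=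
    (Finset.card_filter_add_card_filter_not _).trans (Fintype.card_fin 27)
  let q : List ℕ × ℕ × ℕ × ℕ → Bool := fun c => decide (dot h (CycInt.evalVec ζ (direction c)) = 0)
  have hq : ∀ c, q c = true → dot (CycInt.evalVec ζ (direction c)) h = 0 := fun c hc => by
    rw [dot_comm]; exact of_decide_eq_true hc
  have hpar : ∀ a b, q a = true → q b = true →
      cross h (cross (CycInt.evalVec ζ (direction a)) (CycInt.evalVec ζ (direction b))) = 0 :=
    fun a b ha hb => by
      rw [cross_cross, dot_comm h, dot_comm h, hq a ha, hq b hb, zero_smul, zero_smul, sub_zero]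
  have hsymm : ∀ x y : Fin 3 → ℂ, cross x y = 0 → cross y x = 0 := fun x y hxy => by
    funext i
    have := congrFun hxy i
    fin_cases i <;> simp [cross] at this ⊢ <;> linear_combination -this
  have h1 : S.card ≤ excess q flats := by
    refine card_le_excess fun i hi => ?_
    obtain ⟨j, hj, hij⟩ := (Finset.mem_filter.1 hi).2
    rw [comap_perp_eq_iff (hc j) (hc i)] at hij
    have hfl := exists_flat i j hj
    simp only [List.any_eq_true, Bool.and_eq_true, Nat.beq_eq] at hfl
    obtain ⟨c, hcf, ⟨j', hj', rfl⟩, i', hi', rfl⟩ := hfl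
    refine ⟨c, hcf, decide_eq_true ?_, hi'⟩
    obtain ⟨j', hjj, hj0⟩ := dot_cpxNormal_direction hζ hcf hj'
    obtain ⟨i', hii, hi0⟩ := dot_cpxNormal_direction hζ hcf (List.mem_of_mem_tail hi')
    obtain rfl := Fin.ext hjj
    obtain rfl := Fin.ext hii
    refine dot_eq_zero_of_cross (cross_cpxNormal hζ hj.ne') ?_ (dot_comm _ _ |>.trans ?_)
    · rw [cross_cross, dot_comm _ (cpxNormal ζ _), dot_comm _ (cpxNormal ζ _), hj0, hi0, zero_smul,
        zero_smul, sub_zero]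
    · simp only [dot, cross, Matrix.cons_val] at hij ⊢
      linear_combination -hij
  have h2 : excess q flats ≤ 10 := by
    refine excess_le_of_excessBound (fun a ha hqa b hb hqb c hc' hqc => ?_)
      (fun a ha hqa b hb hqb i hia hib hab => ?_) excessBound_flats
    · refine orthogonalMod_crossMod (by norm_num) ?_
      have := dot_eq_zero_of_cross h0 (hsymm _ _ (hpar a b hqa hqb)) (hq c hqc)
      rw [← CycInt.evalVec_cross hz, ← CycInt.eval_dot hz] at this
      have := congrArg (CycInt.eval (2 : ZMod 31)) (CycInt.eq_zero_of_eval hζ this)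
      rwa [CycInt.eval_dot two_root, CycInt.evalVec_cross two_root, evalVec_direction a ha,
        evalVec_direction b hb, evalVec_direction c hc', CycInt.eval_zero] at this
    · have hne : cross (CycInt.evalVec ζ (direction a)) (CycInt.evalVec ζ (direction b)) ≠ 0 := by
        intro hx
        rw [← CycInt.evalVec_cross hz] at hx
        have := congrArg (CycInt.evalVec (2 : ZMod 31)) (CycInt.evalVec_eq_zero hζ hx)
        rw [CycInt.evalVec_cross two_root, evalVec_direction a ha, evalVec_direction b hb,
          CycInt.evalVec_zero] at this
        exact cross_ne_zero_of_independentMod hab this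
      obtain ⟨j, hj, hja⟩ := dot_cpxNormal_direction hζ ha hia
      obtain ⟨j', hj', hjb⟩ := dot_cpxNormal_direction hζ hb hib
      obtain rfl := Fin.ext (hj.trans hj'.symm)
      have hw : cross (cpxNormal ζ j)
          (cross (CycInt.evalVec ζ (direction a)) (CycInt.evalVec ζ (direction b))) = 0 := by
        rw [cross_cross, hja, hjb, zero_smul, zero_smul, sub_zero]
      obtain ⟨s, hs⟩ := exists_eq_smul_of_cross hne (hsymm _ _ (hpar a b hqa hqb))
      obtain ⟨t, ht⟩ := exists_eq_smul_of_cross hne (hsymm _ _ hw)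
      refine hc j ?_
      rw [hs, ht]
      funext k
      fin_cases k <;> simp [cross] <;> ring
  omega

end PencilCount

section InternalRestriction

lemma classCount_redNormal : ∀ i : Fin 27,
    classCount (fun j k => coplanarMod 31 (redNormal i) (redNormal j) (redNormal k))
      ((List.finRange 27).filter fun j => !decide (j = i)) ∈ Finset.Icc 3 11 := by
  decide +kernel

variable {ζ : ℂ}

lemma card_restriction_cpxNormal (hζ : IsPrimitiveRoot ζ 5) {A : Arrangement ℂ 3}
    (hA : (A.hyperplanes : Set (Submodule ℂ (Fin 3 → ℂ))) =
      Set.range fun i => perp (cpxNormal ζ i)) (i : Fin 27) :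
    ((A.hyperplanes.erase (perp (cpxNormal ζ i))).image
      fun H => H.comap (perp (cpxNormal ζ i)).subtype).card ∈ Finset.Icc 3 11 := by
  have hmem : ∀ j, j ∈ (List.finRange 27).filter (fun j => !decide (j = i)) ↔ j ≠ i := fun j => by
    simp
  have hc : ∀ j ∈ (List.finRange 27).filter (fun j => !decide (j = i)),
      cross (cpxNormal ζ i) (cpxNormal ζ j) ≠ 0 :=
    fun j hj => cross_cpxNormal hζ ((hmem j).1 hj).symm
  rw [card_restriction (N := cpxNormal ζ) (mem_erase_perp_iff hc fun H => ?_) hc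
    fun v _ w _ => (dot_cross_cpxNormal_iff hζ).symm]
  · exact classCount_redNormal i
  · rw [← Finset.mem_coe, hA, Set.mem_range]
    constructor
    · rintro ⟨j, rfl⟩
      by_cases hj : j = i
      · exact .inl (by rw [hj])
      · exact .inr ⟨j, (hmem j).2 hj, rfl⟩
    · rintro (rfl | ⟨j, -, rfl⟩)
      exacts [⟨i, rfl⟩, ⟨j, rfl⟩]

end InternalRestriction

section BinaryForms

lemma sq_sub_dvd_of_eq {S : Type*} [CommRing S] {x y r u₀ u₁ v₀ v₁ v₂ : S}
    (h0 : v₀ * (r ^ 5) ^ 2 + v₁ * r ^ 5 + v₂ = u₀ + u₁ * r ^ 5)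
    (h1 : 11 * v₀ * (r ^ 5) ^ 2 + 6 * v₁ * r ^ 5 + v₂ = 5 * u₁ * r ^ 5) :
    (y - r * x) ^ 2 ∣ y * (v₀ * y ^ 10 + v₁ * x ^ 5 * y ^ 5 + v₂ * x ^ 10) -
      r * (x ^ 6 * (u₀ * x ^ 5 + u₁ * y ^ 5)) := by
  obtain ⟨k, hk⟩ := sq_dvd_add_pow_sub_sub (y - r * x) (r * x) 11
  obtain ⟨l, hl⟩ := sq_dvd_add_pow_sub_sub (y - r * x) (r * x) 6
  obtain ⟨m, hm⟩ := sq_dvd_add_pow_sub_sub (y - r * x) (r * x) 5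
  simp only [add_sub_cancel] at hk hl hm
  refine ⟨v₀ * k + v₁ * x ^ 5 * l - r * u₁ * x ^ 6 * m, ?_⟩
  push_cast at hk hl hm
  linear_combination v₀ * hk + v₁ * x ^ 5 * hl - r * u₁ * x ^ 6 * hm + x ^ 11 * r * h0 +
    (y - r * x) * x ^ 10 * h1

variable {K : Type*} [Field K]

open MvPolynomial

lemma isRelPrime_X_of_eval {σ : Type*} {i : σ} {p : MvPolynomial σ K} (z : σ → K) (hz : z i = 0)
    (h : eval z p ≠ 0) : IsRelPrime (X i) p := by
  refine X_prime.irreducible.isRelPrime_iff_not_dvd.2 ?_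
  rintro ⟨q, rfl⟩
  simp [hz] at h

lemma isRelPrime_binary {u₀ u₁ v₀ v₁ v₂ : K} (hu₀ : u₀ ≠ 0) (hu₁ : u₁ ≠ 0) (hv₀ : v₀ ≠ 0)
    (hρ : u₁ ^ 2 * v₂ - u₀ * u₁ * v₁ + u₀ ^ 2 * v₀ ≠ 0) :
    IsRelPrime ((X 0 : MvPolynomial (Fin 2) K) ^ 6 * (C u₀ * X 0 ^ 5 + C u₁ * X 1 ^ 5))
      (X 1 * (C v₀ * X 1 ^ 10 + C v₁ * X 0 ^ 5 * X 1 ^ 5 + C v₂ * X 0 ^ 10)) := by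
  have hxU : IsRelPrime (X 0 : MvPolynomial (Fin 2) K) (C u₀ * X 0 ^ 5 + C u₁ * X 1 ^ 5) :=
    isRelPrime_X_of_eval ![0, 1] rfl (by simpa using hu₁)
  refine IsRelPrime.mul_left (IsRelPrime.pow_left (.mul_right ?_ ?_)) (.mul_right ?_ ?_)
  · exact isRelPrime_X_of_eval ![0, 1] rfl (by simp)
  · exact isRelPrime_X_of_eval ![0, 1] rfl (by simpa using hv₀)
  · exact (isRelPrime_X_of_eval ![1, 0] rfl (by simpa using hu₀)).symm
  · intro d hU hV
    refine (hxU.symm.pow_right (n := 10)) hU ?_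
    have h : d ∣ C (u₁ ^ 2 * v₂ - u₀ * u₁ * v₁ + u₀ ^ 2 * v₀) * X 0 ^ 10 := by
      have := (hV.mul_left (C (u₁ ^ 2))).sub (hU.mul_left (C (u₁ * v₀) * X 1 ^ 5 +
        C (u₁ * v₁ - u₀ * v₀) * X 0 ^ 5))
      refine this.trans (dvd_of_eq ?_)
      simp only [C_mul, C_sub, C_add, C_pow]
      ring
    exact ((((isUnit_iff_ne_zero.2 hρ).map C).dvd_mul_left).1 h)

lemma eq_zero_of_dvd_of_binary {ι : Type*} [Fintype ι] (hι : Fintype.card ι = 10) {r : ι → K}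
    (hr : Function.Injective r) {u₀ u₁ v₀ v₁ v₂ : K}
    (h0 : ∀ i, v₀ * (r i ^ 5) ^ 2 + v₁ * r i ^ 5 + v₂ = u₀ + u₁ * r i ^ 5)
    (h1 : ∀ i, 11 * v₀ * (r i ^ 5) ^ 2 + 6 * v₁ * r i ^ 5 + v₂ = 5 * u₁ * r i ^ 5)
    (hu₀ : u₀ ≠ 0) (hu₁ : u₁ ≠ 0) (hv₀ : v₀ ≠ 0)
    (hρ : u₁ ^ 2 * v₂ - u₀ * u₁ * v₁ + u₀ ^ 2 * v₀ ≠ 0) {p q : MvPolynomial (Fin 2) K} {d : ℕ}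
    (hd : d ≤ 10) (hp : p.IsHomogeneous d) (hq : q.IsHomogeneous d) (hxp : X 0 ^ 6 ∣ p)
    (hpq : ∀ i, (X 1 - C (r i) * X 0) ^ 2 ∣ q - C (r i) * p) : p = 0 ∧ q = 0 := by
  set ψ₀ := (X 0 : MvPolynomial (Fin 2) K) ^ 6 * (C u₀ * X 0 ^ 5 + C u₁ * X 1 ^ 5) with hψ₀
  set ψ₁ := (X 1 : MvPolynomial (Fin 2) K) *
    (C v₀ * X 1 ^ 10 + C v₁ * X 0 ^ 5 * X 1 ^ 5 + C v₂ * X 0 ^ 10) with hψ₁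
  have hX : ∀ (i : Fin 2) n, ((X i : MvPolynomial (Fin 2) K) ^ n).IsHomogeneous n :=
    isHomogeneous_X_pow
  have hom₀ : ψ₀.IsHomogeneous 11 :=
    (hX 0 6).mul (((hX 0 5).C_mul _).add ((hX 1 5).C_mul _))
  have hom₁ : ψ₁.IsHomogeneous 11 := (isHomogeneous_X K 1).mul (n := 10)
    ((((hX 1 10).C_mul _).add (((hX 0 5).C_mul _).mul (hX 1 5))).add ((hX 0 10).C_mul _))
  have hψ : IsRelPrime ψ₀ ψ₁ := isRelPrime_binary hu₀ hu₁ hv₀ hρ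
  have hxy : IsRelPrime (X 0 : MvPolynomial (Fin 2) K) (X 1) :=
    isRelPrime_X_of_eval ![0, 1] rfl (by simp)
  have hxl : ∀ i, IsRelPrime (X 0 : MvPolynomial (Fin 2) K) (X 1 - C (r i) * X 0) :=
    fun i => isRelPrime_X_of_eval ![0, 1] rfl (by simp)
  have hll : ∀ i j, i ≠ j → IsRelPrime (X 1 - C (r i) * X 0 : MvPolynomial (Fin 2) K)
      (X 1 - C (r j) * X 0) := by
    intro i j hij t hi hj
    refine (hxl i) ?_ hi
    have h : t ∣ C (r j - r i) * X 0 := (hi.sub hj).trans (dvd_of_eq (by rw [C_sub]; ring))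
    exact ((isUnit_iff_ne_zero.2 (sub_ne_zero.2 fun h => hij (hr h.symm))).map C).dvd_mul_left.1 h
  have hdvd : X 0 ^ 6 * ∏ i, (X 1 - C (r i) * X 0) ^ 2 ∣ p * ψ₁ - q * ψ₀ := by
    refine IsRelPrime.mul_dvd (IsRelPrime.prod_right fun i _ => (hxl i).pow) ?_
      (Finset.prod_dvd_of_isRelPrime (fun i _ j _ hij => (hll i j hij).pow) fun i _ => ?_)
    · exact (hxp.mul_right _).sub (((dvd_mul_right _ _)).mul_left _)
    · have h := sq_sub_dvd_of_eq (x := (X 0 : MvPolynomial (Fin 2) K)) (y := X 1) (r := C (r i))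
        (u₀ := C u₀) (u₁ := C u₁) (v₀ := C v₀) (v₁ := C v₁) (v₂ := C v₂)
        (by simpa using congrArg (C (σ := Fin 2)) (h0 i))
        (by simpa [map_ofNat (C (R := K) (σ := Fin 2))] using congrArg (C (σ := Fin 2)) (h1 i))
      refine ((h.mul_left p).sub ((hpq i).mul_right ψ₀)).trans (dvd_of_eq ?_)
      rw [hψ₁, hψ₀]
      ring
  have hzero : p * ψ₁ - q * ψ₀ = 0 := by
    refine eq_zero_of_dvd_of_lt (a := 26) (b := d + 11) ?_ ((hp.mul hom₁).sub (hq.mul hom₀)) hdvd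
      (by omega)
    have h := (hX 0 6).mul (IsHomogeneous.prod Finset.univ
      (fun i => (X 1 - C (r i) * X 0 : MvPolynomial (Fin 2) K) ^ 2) (fun _ => 2) fun i _ =>
        ((isHomogeneous_X K 1).sub ((isHomogeneous_X K 0).C_mul (r i))).pow 2)
    simpa [hι] using h
  have hψ₀0 : ψ₀ ≠ 0 := fun h => by
    have := congrArg (eval ![1, 0]) h
    simp [hψ₀, hu₀] at this
  have hp0 : p = 0 := eq_zero_of_dvd_of_lt hom₀ hp
    (hψ.dvd_of_dvd_mul_right (Dvd.intro_left q (sub_eq_zero.1 hzero).symm)) (by omega)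
  rw [hp0, zero_mul, zero_sub, neg_eq_zero] at hzero
  exact ⟨hp0, (mul_eq_zero.1 hzero).resolve_right hψ₀0⟩

end BinaryForms

section LineAtPlane

/-- Two vectors spanning the fourth plane of the complex arrangement. -/
def sliceVec : Fin 2 → Fin 3 → CycInt :=
  ![![⟨0, 0, 1, -1⟩, ⟨1, -1, 0, 0⟩, ⟨-1, 0, 0, 0⟩], ![⟨0, 0, 0, 0⟩, ⟨0, 0, 0, 0⟩, ⟨1, 0, 0, 0⟩]]

/-- The lines of the fourth plane contained in two further planes of the complex arrangement,
given by their slopes and these planes. -/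
def slopes : Fin 10 → CycInt × Fin 27 × Fin 27 :=
  ![(⟨1, 0, 0, 0⟩, 2, 7), (⟨0, 1, 0, 0⟩, 5, 16), (⟨0, 0, 1, 0⟩, 15, 23), (⟨0, 0, 0, 1⟩, 19, 25),
    (⟨-1, -1, -1, -1⟩, 11, 17), (⟨-2, 0, -1, -1⟩, 12, 26), (⟨1, -1, 1, 0⟩, 13, 22),
    (⟨0, 1, -1, 1⟩, 14, 21), (⟨-1, -1, 0, -2⟩, 9, 24), (⟨2, 1, 1, 2⟩, 18, 20)]

lemma dot_sliceVec_axis : ∀ j ∈ ({0, 1, 4, 6, 8, 10} : Finset (Fin 27)),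
    dot (cycNormal j) (sliceVec 1) = 0 ∧ dot (cycNormal j) (sliceVec 0) ≠ 0 := by
  decide +kernel

lemma dot_sliceVec_slopes : ∀ i, ∀ j ∈ ({(slopes i).2.1, (slopes i).2.2} : Finset (Fin 27)),
    dot (cycNormal j) (sliceVec 1) ≠ 0 ∧
      dot (cycNormal j) (sliceVec 0) + (slopes i).1 * dot (cycNormal j) (sliceVec 1) = 0 := by
  decide +kernel

lemma slopes_ne : ∀ i, (slopes i).2.1 ≠ (slopes i).2.2 := by decide +kernel

lemma slopes_sub_ne_zero : ∀ i j, i ≠ j → (slopes i).1 - (slopes j).1 ≠ 0 := by decide +kernel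

/-- The fifth power. -/
def fifthPower (a : CycInt) : CycInt := a * (a * (a * (a * a)))

lemma slopes_relations : ∀ i, (fun c : CycInt =>
    ⟨-34, 0, 55, 55⟩ * (c * c) + ⟨198, 0, -330, -330⟩ * c + ⟨11, 0, 0, 0⟩ -
        (⟨10, 0, 0, 0⟩ + ⟨165, 0, -275, -275⟩ * c) = 0 ∧
      ⟨11, 0, 0, 0⟩ * ⟨-34, 0, 55, 55⟩ * (c * c) + ⟨6, 0, 0, 0⟩ * ⟨198, 0, -330, -330⟩ * c +
        ⟨11, 0, 0, 0⟩ - ⟨5, 0, 0, 0⟩ * ⟨165, 0, -275, -275⟩ * c = 0)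
      (fifthPower (slopes i).1) := by
  decide +kernel

variable {ζ : ℂ}

lemma exists_slice_cpxNormal (hζ : IsPrimitiveRoot ζ 5) :
    ∃ s : Slice 2 (lf (cpxNormal ζ 3)), ∀ w, lf w ∘ₗ s.ι =
      lf ![dot w (CycInt.evalVec ζ (sliceVec 0)), dot w (CycInt.evalVec ζ (sliceVec 1))] := by
  have h1 : 1 - ζ ≠ 0 := sub_ne_zero.2 (hζ.ne_one (by norm_num)).symm
  have hn : ∀ x, lf (cpxNormal ζ 3) x = x 0 - ζ ^ 2 * x 1 := fun x => by
    simp [lf, Fin.sum_univ_three, cpxNormal, cycNormal, cycNormals, CycInt.evalVec, CycInt.eval]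
    ring
  let ι : (Fin 2 → ℂ) →ₗ[ℂ] (Fin 3 → ℂ) := LinearMap.pi fun i =>
    lf (![![(1 - ζ) * ζ ^ 2, 0], ![1 - ζ, 0], ![-1, 1]] i)
  let π : (Fin 3 → ℂ) →ₗ[ℂ] (Fin 2 → ℂ) := LinearMap.pi fun i =>
    lf (![![0, (1 - ζ)⁻¹, 0], ![0, (1 - ζ)⁻¹, 1]] i)
  have hι : ∀ y, ι y = ![(1 - ζ) * ζ ^ 2 * y 0, (1 - ζ) * y 0, y 1 - y 0] := fun y => by
    funext i
    fin_cases i <;> simp [ι, lf]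
    ring
  have hπ : ∀ x, π x = ![(1 - ζ)⁻¹ * x 1, x 2 + (1 - ζ)⁻¹ * x 1] := fun x => by
    funext i
    fin_cases i <;> simp [π, lf, Fin.sum_univ_three, add_comm]
  refine ⟨⟨ι, π, ![1, 0, 0], ?_, ?_, ?_, ?_⟩, ?_⟩
  · simp [hn]
  · refine LinearMap.ext fun y => ?_
    simp [hn, hι]
    ring
  · intro x
    rw [hι, hπ]
    funext i
    fin_cases i <;> simp [hn] <;> field_simp <;> ring
  · intro y
    rw [hπ, hι]
    funext i
    fin_cases i <;> simp <;> field_simp <;> ring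
  · intro w
    refine LinearMap.ext fun y => ?_
    rw [LinearMap.comp_apply, hι]
    simp [lf, Fin.sum_univ_three, dot, CycInt.evalVec, CycInt.eval, sliceVec]
    ring

lemma linPoly_lf_X {K : Type*} [Field K] : linPoly (lf ![(1 : K), 0]) = MvPolynomial.X 0 := by
  simp [linPoly, lf_single]

lemma linPoly_lf_sub {K : Type*} [Field K] (r : K) :
    linPoly (lf ![-r, 1]) = MvPolynomial.X 1 - MvPolynomial.C r * MvPolynomial.X 0 := by
  simp [linPoly, lf_single]
  ring

lemma app_lf {K : Type*} [Field K] (φ : Fin 2 → MvPolynomial (Fin 2) K) (a b : K) :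
    app φ (lf ![a, b]) = MvPolynomial.C a * φ 0 + MvPolynomial.C b * φ 1 := by
  simp [app, lf_single, MvPolynomial.smul_eq_C_mul]

lemma comap_perp_eq_ker {K : Type*} [Field K] {ι : (Fin 2 → K) →ₗ[K] (Fin 3 → K)}
    {w : Fin 3 → K} {a b : Fin 2 → K} {c : K} (h : lf w ∘ₗ ι = lf a) (hc : c ≠ 0) (hb : b ≠ 0)
    (hab : a = c • b) : (perp w).comap ι = LinearMap.ker (lf b) := by
  have hlf : lf a = c • lf b := LinearMap.ext fun x => by
    simp [hab, lf, mul_assoc]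
  rw [perp, ← LinearMap.ker_comp, h]
  refine ker_eq_of_eq_smul ?_ hlf
  rw [hlf]
  exact smul_ne_zero hc (lf_ne_zero hb)

end LineAtPlane

section LowDegree

variable {ζ : ℂ}

lemma perp_cpxNormal_injective (hζ : IsPrimitiveRoot ζ 5) :
    Function.Injective fun i => perp (cpxNormal ζ i) := fun i j h => by
  by_contra hij
  exact cross_cpxNormal hζ hij (cross_eq_zero_of_perp_eq h)

lemma eval_ne_zero (hζ : IsPrimitiveRoot ζ 5) {a : CycInt} (h : a ≠ 0) : CycInt.eval ζ a ≠ 0 :=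
  fun h' => h (CycInt.eq_zero_of_eval hζ h')

lemma eval_slopes_relations (hζ : IsPrimitiveRoot ζ 5) (i : Fin 10) :
    (-34 + 55 * ζ ^ 2 + 55 * ζ ^ 3) * (CycInt.eval ζ (slopes i).1 ^ 5) ^ 2 +
        (198 - 330 * ζ ^ 2 - 330 * ζ ^ 3) * CycInt.eval ζ (slopes i).1 ^ 5 + 11 =
      10 + (165 - 275 * ζ ^ 2 - 275 * ζ ^ 3) * CycInt.eval ζ (slopes i).1 ^ 5 ∧
    11 * (-34 + 55 * ζ ^ 2 + 55 * ζ ^ 3) * (CycInt.eval ζ (slopes i).1 ^ 5) ^ 2 +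
        6 * (198 - 330 * ζ ^ 2 - 330 * ζ ^ 3) * CycInt.eval ζ (slopes i).1 ^ 5 + 11 =
      5 * (165 - 275 * ζ ^ 2 - 275 * ζ ^ 3) * CycInt.eval ζ (slopes i).1 ^ 5 := by
  have hz := CycInt.one_add_eq_zero hζ
  obtain ⟨h0, h1⟩ := slopes_relations i
  have h0 := congrArg (CycInt.eval ζ) h0
  have h1 := congrArg (CycInt.eval ζ) h1
  simp only [fifthPower, CycInt.eval_add, CycInt.eval_sub, CycInt.eval_mul hz,
    CycInt.eval_zero] at h0 h1
  generalize CycInt.eval ζ (slopes i).1 = r at h0 h1 ⊢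
  simp only [CycInt.eval, Int.cast_zero, Int.cast_neg, Int.cast_ofNat] at h0 h1
  exact ⟨by linear_combination h0, by linear_combination h1⟩

variable {A : Arrangement ℂ 3} {θ : Fin 3 → MvPolynomial (Fin 3) ℂ} {d : ℕ}

lemma res_eq_zero (hζ : IsPrimitiveRoot ζ 5)
    (hA : (A.hyperplanes : Set (Submodule ℂ (Fin 3 → ℂ))) =
      Set.range fun i => perp (cpxNormal ζ i)) {s : Slice 2 (lf (cpxNormal ζ 3))}
    (hs : ∀ w, lf w ∘ₗ s.ι = lf ![dot w (CycInt.evalVec ζ (sliceVec 0)),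
      dot w (CycInt.evalVec ζ (sliceVec 1))])
    (hθ : θ ∈ LD A) (hd : ∀ i, (θ i).IsHomogeneous d) (hd10 : d ≤ 10)
    (h0 : app θ (lf (cpxNormal ζ 3)) = 0) : s.res θ = 0 := by
  have hz := CycInt.one_add_eq_zero hζ
  have hdot : ∀ j k, dot (cpxNormal ζ j) (CycInt.evalVec ζ (sliceVec k)) =
      CycInt.eval ζ (dot (cycNormal j) (sliceVec k)) := fun j k => (CycInt.eval_dot hz _ _).symm
  have hdvd : ∀ (S : Finset (Fin 27)) (b : Fin 2 → ℂ) (hb : b ≠ 0),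
      (∀ j ∈ S, (perp (cpxNormal ζ j)).comap s.ι = LinearMap.ker (lf b)) →
      linPoly (lf b) ^ S.card ∣ app (s.res θ) (lf b) := fun S b hb h => by
    rw [← Finset.card_image_of_injective S (perp_cpxNormal_injective hζ)]
    refine s.pow_dvd_app_res (lf_ne_zero hb) (fun H hH => ?_) (fun H hH => ?_) hθ h0
    · obtain ⟨j, -, rfl⟩ := Finset.mem_image.1 hH
      rw [← Finset.mem_coe, hA]
      exact ⟨j, rfl⟩
    · obtain ⟨j, hj, rfl⟩ := Finset.mem_image.1 hH
      exact h j hj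
  have hx : MvPolynomial.X 0 ^ 6 ∣ s.res θ 0 := by
    have h := hdvd {0, 1, 4, 6, 8, 10} ![1, 0] (fun h => one_ne_zero (congrFun h 0))
      fun j hj => by
        obtain ⟨h1, h2⟩ := dot_sliceVec_axis j hj
        refine comap_perp_eq_ker (hs _) (eval_ne_zero hζ h2) (fun h => one_ne_zero (congrFun h 0))
          ?_
        rw [hdot, hdot, h1, CycInt.eval_zero]
        simp
    rw [linPoly_lf_X, app_lf, MvPolynomial.C_1, one_mul, MvPolynomial.C_0, zero_mul,
      add_zero] at h
    exact h
  have hr : ∀ i, (MvPolynomial.X 1 - MvPolynomial.C (CycInt.eval ζ (slopes i).1) *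
      MvPolynomial.X 0) ^ 2 ∣ s.res θ 1 - MvPolynomial.C (CycInt.eval ζ (slopes i).1) *
        s.res θ 0 := fun i => by
    have h := hdvd {(slopes i).2.1, (slopes i).2.2} ![-CycInt.eval ζ (slopes i).1, 1]
      (fun h => one_ne_zero (congrFun h 1)) fun j hj => by
        obtain ⟨h1, h2⟩ := dot_sliceVec_slopes i j hj
        refine comap_perp_eq_ker (hs _) (eval_ne_zero hζ h1) (fun h => one_ne_zero (congrFun h 1))
          ?_
        have h2 := congrArg (CycInt.eval ζ) h2
        rw [CycInt.eval_add, CycInt.eval_mul hz, CycInt.eval_zero] at h2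
        rw [hdot, hdot]
        funext k
        fin_cases k <;> simp
        linear_combination h2
    rw [Finset.card_pair (slopes_ne i), linPoly_lf_sub, app_lf, MvPolynomial.C_1, one_mul,
      MvPolynomial.C_neg] at h
    exact h.trans (dvd_of_eq (by ring))
  have hne : ∀ a : CycInt, a ≠ 0 → ∀ b, CycInt.eval ζ a = b → b ≠ 0 := fun a ha b hb =>
    hb ▸ eval_ne_zero hζ ha
  obtain ⟨hp, hq⟩ := eq_zero_of_dvd_of_binary (ι := Fin 10) (Fintype.card_fin 10)
    (r := fun i => CycInt.eval ζ (slopes i).1) (fun i j hij => by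
      by_contra hne
      refine eval_ne_zero hζ (slopes_sub_ne_zero i j hne) ?_
      rw [CycInt.eval_sub, sub_eq_zero]
      exact hij) (fun i => (eval_slopes_relations hζ i).1)
    (fun i => (eval_slopes_relations hζ i).2) (by norm_num)
    (hne ⟨165, 0, -275, -275⟩ (by decide) _ (by simp [CycInt.eval]; ring))
    (hne ⟨-34, 0, 55, 55⟩ (by decide) _ (by simp [CycInt.eval]))
    (hne (⟨165, 0, -275, -275⟩ * ⟨165, 0, -275, -275⟩ * ⟨11, 0, 0, 0⟩ -
      ⟨10, 0, 0, 0⟩ * ⟨165, 0, -275, -275⟩ * ⟨198, 0, -330, -330⟩ +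
      ⟨10, 0, 0, 0⟩ * ⟨10, 0, 0, 0⟩ * ⟨-34, 0, 55, 55⟩) (by decide +kernel) _ (by
        simp only [CycInt.eval_add, CycInt.eval_sub, CycInt.eval_mul hz]
        simp [CycInt.eval]
        ring)) hd10 (s.res_isHomogeneous hd 0) (s.res_isHomogeneous hd 1) hx hr
  funext k
  fin_cases k
  exacts [hp, hq]

lemma exists_eq_smul_linPoly (hζ : IsPrimitiveRoot ζ 5)
    (hA : (A.hyperplanes : Set (Submodule ℂ (Fin 3 → ℂ))) =
      Set.range fun i => perp (cpxNormal ζ i)) (hd10 : d ≤ 10)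
    (hθ : θ ∈ LD A) (hd : ∀ i, (θ i).IsHomogeneous d) (h0 : app θ (lf (cpxNormal ζ 3)) = 0) :
    ∃ θ' ∈ LD A, θ = linPoly (lf (cpxNormal ζ 3)) • θ' := by
  obtain ⟨s, hs⟩ := exists_slice_cpxNormal hζ
  have hf0 := linPoly_ne_zero s.ne_zero
  obtain ⟨θ', rfl⟩ := s.exists_eq_smul_of_res_eq_zero (h0 ▸ dvd_zero _)
    (res_eq_zero hζ hA hs hθ hd hd10 h0)
  rw [app_smul_left] at h0
  exact ⟨θ', s.mem_of_dvd (Slice.mem_of_smul_mem s.ne_zero hθ)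
    ((mul_eq_zero.1 h0).resolve_left hf0 ▸ dvd_zero _), rfl⟩

/-- The logarithmic derivations of the complex arrangement of degree at most ten are multiples of
the Euler derivation. -/
lemma exists_eq_smul_X_of_mem (hζ : IsPrimitiveRoot ζ 5)
    (hA : (A.hyperplanes : Set (Submodule ℂ (Fin 3 → ℂ))) =
      Set.range fun i => perp (cpxNormal ζ i)) (hd10 : d ≤ 10)
    (hθ : θ ∈ LD A) (hd : ∀ i, (θ i).IsHomogeneous d) :
    ∃ p : MvPolynomial (Fin 3) ℂ, θ = p • MvPolynomial.X := by
  set f := lf (cpxNormal ζ 3) with hf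
  have hf0 : f ≠ 0 := lf_ne_zero (cpxNormal_ne_zero hζ 3)
  have hfA : LinearMap.ker f ∈ A.hyperplanes := by
    rw [← Finset.mem_coe, hA]
    exact ⟨3, rfl⟩
  induction d generalizing θ with
  | zero =>
    have h0 : app θ f = 0 := eq_zero_of_dvd_of_lt (linPoly_isHomogeneous f)
      (app_isHomogeneous hd f) (hθ f hf0 hfA) one_pos
    obtain ⟨θ', -, hθ'⟩ := exists_eq_smul_linPoly hζ hA hd10 hθ hd h0
    refine ⟨0, ?_⟩
    rw [zero_smul]
    exact funext fun i => eq_zero_of_dvd_of_lt (linPoly_isHomogeneous f) (hd i)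
      (Dvd.intro _ (congrFun hθ' i).symm) one_pos
  | succ d ih =>
    obtain ⟨q, hq⟩ := hθ f hf0 hfA
    have hqd : q.IsHomogeneous d := isHomogeneous_of_mul_left (linPoly_isHomogeneous f)
      (linPoly_ne_zero hf0) (hq ▸ app_isHomogeneous hd f)
    have hd' : ∀ i, ((θ - q • (MvPolynomial.X : Fin 3 → MvPolynomial (Fin 3) ℂ)) i).IsHomogeneous
        (d + 1) := fun i => (hd i).sub (hqd.mul (MvPolynomial.isHomogeneous_X _ i))
    obtain ⟨θ', hmem, hθ'⟩ := exists_eq_smul_linPoly hζ hA hd10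
      (sub_mem hθ (Submodule.smul_mem _ q (X_mem_LD A))) hd' (by
        rw [app_sub_left, app_smul_left, ← linPoly_eq_app, ← hf, hq]
        ring)
    obtain ⟨p, rfl⟩ := ih (by omega) hmem fun i => isHomogeneous_of_mul_left
      (linPoly_isHomogeneous f) (linPoly_ne_zero hf0) (b := d + 1)
      (by have := hd' i; rw [hθ'] at this; exact this)
    exact ⟨q + linPoly f * p, by rw [add_smul, mul_smul, ← hθ', add_sub_cancel]⟩

end LowDegree

section NotRecursivelyFree

variable {K : Type*} [Field K]

lemma exists_ne_of_pair_le {ι : Type*} [Fintype ι] {d : ι → ℕ} {a b : ℕ}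
    (h : ({a, b} : Multiset ℕ) ≤ Finset.univ.val.map d) : ∃ i j, i ≠ j ∧ d i = a ∧ d j = b := by
  obtain ⟨i, -, rfl⟩ := Multiset.mem_map.1 (Multiset.mem_of_le h (Multiset.mem_cons_self a {b}))
  rw [← Finset.insert_erase (Finset.mem_univ i), Finset.insert_val_of_notMem
    (Finset.notMem_erase i _), Multiset.map_cons, Multiset.insert_eq_cons,
    Multiset.cons_le_cons_iff, Multiset.singleton_le] at h
  obtain ⟨j, hj, rfl⟩ := Multiset.mem_map.1 h
  exact ⟨i, j, (Finset.ne_of_mem_erase hj).symm, rfl, rfl⟩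

lemma exists_third {i j : Fin 3} (hij : i ≠ j) (d : Fin 3 → ℕ) :
    ∃ k, k ≠ i ∧ ∑ l, d l = d i + d j + d k := by
  obtain ⟨k, hki, hkj, hu⟩ : ∃ k, k ≠ i ∧ k ≠ j ∧ Finset.univ = {i, j, k} := by
    revert i j
    decide
  refine ⟨k, hki, ?_⟩
  rw [hu, Finset.sum_insert (by simp [hij, hki.symm]), Finset.sum_pair hkj.symm, add_assoc]

lemma det_eq_zero_of_smul_rows {n : ℕ} {R : Type*} [CommRing R] {M : Matrix (Fin n) (Fin n) R}
    {i j : Fin n} (hij : i ≠ j) {x : Fin n → R} {p q : R} (hi : M i = p • x) (hj : M j = q • x) :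
    M.det = 0 := by
  have h1 : M = (M.updateRow j x).updateRow j (q • x) := by
    rw [Matrix.updateRow_idem, ← hj, Matrix.updateRow_eq_self]
  have h2 : M.updateRow j x = ((M.updateRow j x).updateRow i x).updateRow i (p • x) := by
    rw [Matrix.updateRow_idem, ← hi]
    refine ((congrArg _ ?_).trans (Matrix.updateRow_eq_self _ i)).symm
    exact (Matrix.updateRow_ne hij).symm
  rw [h1, Matrix.det_updateRow_smul, Matrix.updateRow_idem, h2, Matrix.det_updateRow_smul,
    Matrix.updateRow_idem,
    Matrix.det_zero_of_row_eq (M := (M.updateRow j x).updateRow i x) hij, mul_zero, mul_zero]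
  rw [Matrix.updateRow_self, Matrix.updateRow_ne hij.symm, Matrix.updateRow_self]

lemma eq_lf (f : (Fin 3 → K) →ₗ[K] K) : f = lf fun i => f (Pi.single i 1) := by
  refine LinearMap.pi_ext' fun i => LinearMap.ext_ring ?_
  change f (Pi.single i 1) = lf (fun i => f (Pi.single i 1)) (Pi.single i 1)
  rw [lf_single]

lemma exists_of_recursivelyFree {n : ℕ} {A : Arrangement K (n + 1)} (h : RecursivelyFree K A) :
    A = emptyArr K (n + 1) ∨
    (∃ (H : Submodule K (Fin (n + 1) → K)) (B : Arrangement K n) (e e' : Multiset ℕ),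
      H ∈ A.hyperplanes ∧ IsRestriction A H B ∧ HasExponents (A.delete H) e ∧
        HasExponents B e' ∧ e' ≤ e) ∨
    ∃ (A' : Arrangement K (n + 1)) (H : Submodule K (Fin (n + 1) → K)) (B : Arrangement K n)
      (e e' : Multiset ℕ), A = A'.delete H ∧ H ∈ A'.hyperplanes ∧ IsRestriction A' H B ∧
        HasExponents A' e ∧ HasExponents B e' ∧ e' ≤ e := by
  cases h with
  | empty => exact .inl rfl
  | add A H hH B hB e' e'' h1 h2 h3 h4 h5 =>
    exact .inr (.inl ⟨H, B, e', e'', hH, hB, h3, h4, h5⟩)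
  | del A H hH B hB e e'' h1 h2 h3 h4 h5 =>
    exact .inr (.inr ⟨A, H, B, e, e'', rfl, hH, hB, h3, h4, h5⟩)

variable {ζ : ℂ} {A : Arrangement ℂ 3}

lemma card_hyperplanes (hζ : IsPrimitiveRoot ζ 5)
    (hA : (A.hyperplanes : Set (Submodule ℂ (Fin 3 → ℂ))) =
      Set.range fun i => perp (cpxNormal ζ i)) :
    A.hyperplanes = Finset.univ.image (fun i => perp (cpxNormal ζ i)) ∧
      A.hyperplanes.card = 27 := by
  have h : A.hyperplanes = Finset.univ.image fun i => perp (cpxNormal ζ i) := by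
    rw [← Finset.coe_inj, hA]
    simp
  refine ⟨h, ?_⟩
  rw [h, Finset.card_image_of_injective _ (perp_cpxNormal_injective hζ), Finset.card_univ,
    Fintype.card_fin]

lemma not_addition (hζ : IsPrimitiveRoot ζ 5)
    (hA : (A.hyperplanes : Set (Submodule ℂ (Fin 3 → ℂ))) =
      Set.range fun i => perp (cpxNormal ζ i)) {H : Submodule ℂ (Fin 3 → ℂ)}
    (hH : H ∈ A.hyperplanes) {B : Arrangement ℂ 2} (hB : IsRestriction A H B) {e e' : Multiset ℕ}
    (he : HasExponents (A.delete H) e) (he' : HasExponents B e') : ¬ e' ≤ e := by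
  intro hle
  obtain ⟨i, rfl⟩ : ∃ i, perp (cpxNormal ζ i) = H := by
    rw [← Finset.mem_coe, hA] at hH
    exact hH
  have hm := card_restriction_cpxNormal hζ hA i
  rw [← card_of_isRestriction hB, Finset.mem_Icc] at hm
  rw [he'.eq_of_two hm.1] at hle
  obtain ⟨d, rfl, M, hM, hd, h0, hs⟩ := he.exists_saito
  obtain ⟨k, l, hkl, hk, hl⟩ := exists_ne_of_pair_le hle
  have hcard := (card_delete hH).trans (card_hyperplanes hζ hA).2
  obtain ⟨s, hs'⟩ := hB.exists_slice (lf_ne_zero (cpxNormal_ne_zero hζ i))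
  have key : ∀ k, d k ≤ 10 → ∃ p : MvPolynomial (Fin 3) ℂ, M k = p • MvPolynomial.X :=
    fun k hk => exists_eq_smul_X_of_mem hζ hA hk (s.mem_of_lt hs' (hM k) (hd k)
      (lt_of_le_of_lt hk (Nat.lt_sub_of_add_lt (by
        change _ < (A.delete (perp (cpxNormal ζ i))).hyperplanes.card
        omega)))) (hd k)
  obtain ⟨p, hp⟩ := key k (by omega)
  obtain ⟨q, hq⟩ := key l (by omega)
  exact h0 (det_eq_zero_of_smul_rows hkl hp hq)

lemma not_deletion (hζ : IsPrimitiveRoot ζ 5) {H : Submodule ℂ (Fin 3 → ℂ)}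
    (hA : ((A.delete H).hyperplanes : Set (Submodule ℂ (Fin 3 → ℂ))) =
      Set.range fun i => perp (cpxNormal ζ i))
    (hH : H ∈ A.hyperplanes) {B : Arrangement ℂ 2} (hB : IsRestriction A H B) {e e' : Multiset ℕ}
    (he : HasExponents A e) (he' : HasExponents B e') : ¬ e' ≤ e := by
  intro hle
  obtain ⟨h, h0, rfl⟩ : ∃ h : Fin 3 → ℂ, h ≠ 0 ∧ H = perp h := by
    obtain ⟨f, hf, rfl⟩ := A.isHyp H hH
    refine ⟨fun i => f (Pi.single i 1), fun h0 => hf ?_, congrArg _ (eq_lf f)⟩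
    rw [eq_lf f, h0]
    simp [lf]
  obtain ⟨himg, hcard⟩ := card_hyperplanes hζ hA
  have hc : ∀ i, cross h (cpxNormal ζ i) ≠ 0 := fun i hi => by
    have hmem : perp h ∈ ((A.delete (perp h)).hyperplanes : Set (Submodule ℂ (Fin 3 → ℂ))) := by
      rw [hA]
      exact ⟨i, (perp_eq_of_cross h0 (cpxNormal_ne_zero hζ i) hi).symm⟩
    exact Finset.notMem_erase _ _ hmem
  have hm := le_card_image hζ h0 hc
  have hBc : B.hyperplanes.card = (Finset.univ.image fun i =>
      (perp (cpxNormal ζ i)).comap (perp h).subtype).card := by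
    rw [card_of_isRestriction hB]
    change (((A.delete (perp h)).hyperplanes).image _).card = _
    rw [himg, Finset.image_image]
    rfl
  rw [← hBc] at hm
  rw [he'.eq_of_two (by omega)] at hle
  obtain ⟨d, rfl, M, hM, hd, hdet, hs⟩ := he.exists_saito
  obtain ⟨i, j, hij, hi, hj⟩ := exists_ne_of_pair_le hle
  obtain ⟨k, hki, hsum⟩ := exists_third hij d
  have hcard' := card_delete hH
  obtain ⟨s, hs'⟩ := hB.exists_slice (lf_ne_zero h0)
  obtain ⟨q, hq⟩ := exists_eq_smul_X_of_mem hζ hA (by omega : d i ≤ 10)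
    (LD_mono (Finset.erase_subset _ _) (hM i)) (hd i)
  obtain ⟨p, θ, hθ, hmem, hθd⟩ := exists_eq_add_of_lt s hs' hH (hM k) (hd k) (by omega)
  obtain ⟨r, rfl⟩ := exists_eq_smul_X_of_mem hζ hA (by omega : d k - 1 ≤ 10) hmem hθd
  rw [← mul_smul, ← add_smul] at hθ
  exact hdet (det_eq_zero_of_smul_rows hki hθ hq)

lemma not_recursivelyFree (hζ : IsPrimitiveRoot ζ 5)
    (hA : (A.hyperplanes : Set (Submodule ℂ (Fin 3 → ℂ))) =
      Set.range fun i => perp (cpxNormal ζ i)) : ¬ RecursivelyFree ℂ A := by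
  intro h
  rcases exists_of_recursivelyFree h with
    rfl | ⟨H, B, e, e', hH, hB, he, he', hle⟩ | ⟨A', H, B, e, e', rfl, hH, hB, he, he', hle⟩
  · have := (card_hyperplanes hζ hA).2
    simp [emptyArr] at this
  · exact not_addition hζ hA hH hB he he' hle
  · exact not_deletion hζ hA hH hB he he' hle

end NotRecursivelyFree

end Arrgt

/-- The arrangement `B` over `𝔽₁₁` is recursively free (and free), although its
intersection lattice is isomorphic to that of the complex arrangement `𝓐`, which is
not recursively free; hence recursive freeness is not a combinatorial property of the
intersection lattice. -/
theorem B_recursivelyFree_lattice_iso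
    (ζ : ℂ) (hζ : IsPrimitiveRoot ζ 5)
    (g1 g2 g3 : GL (Fin 3) ℂ)
    (hg1 : (g1 : Matrix (Fin 3) (Fin 3) ℂ) = !![1, 0, 0; 0, 1, 1; 0, 0, -1])
    (hg2 : (g2 : Matrix (Fin 3) (Fin 3) ℂ) = !![-1, 0, 0; -ζ^2 - ζ^3, 1, 0; 0, 0, 1])
    (hg3 : (g3 : Matrix (Fin 3) (Fin 3) ℂ) = !![1, -ζ^2 - ζ^3, 0; 0, -1, 0; 0, 1, 1])
    (W : Subgroup (GL (Fin 3) ℂ)) (hW : W = Subgroup.closure {g1, g2, g3})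
    (R : Set (Fin 3 → ℂ))
    (hR : R = {w | ∃ g ∈ W, ∃ i : Fin 3,
          w = Matrix.vecMul (Pi.single i 1) (g : Matrix (Fin 3) (Fin 3) ℂ)} ∪
        {w | ∃ g ∈ W, w = Matrix.vecMul ![1, -ζ^2, 0] (g : Matrix (Fin 3) (Fin 3) ℂ)})
    (𝓐 : Set (Submodule ℂ (Fin 3 → ℂ))) (h𝓐 : 𝓐 = Arrgt.perp '' R)
    (CA : Arrangement ℂ 3) (hCA : ↑CA.hyperplanes = 𝓐)
    (B : Arrangement (ZMod 11) 3) (hB : B = mkArr Bvecs.toFinset (by decide)) :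
    RecursivelyFree (ZMod 11) B ∧ IsFree B ∧
      Nonempty ((B.lattice : Set (Submodule (ZMod 11) (Fin 3 → ZMod 11))) ≃o
        (setLattice 𝓐 : Set (Submodule ℂ (Fin 3 → ℂ)))) ∧
      ¬ RecursivelyFree ℂ CA := by
  subst hB
  have hB := recFree_of_normals (mem_mkArr_Bvecs (by decide))
  have hA := h𝓐.trans (image_perp_eq_range hζ hg1 hg2 hg3 hW hR)
  refine ⟨hB.1, hB.2.saito.isFree, ?_, not_recursivelyFree hζ (hCA.trans hA)⟩
  rw [hA]
  exact nonempty_lattice_orderIso hζ (by decide)
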